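/- There exist absolute constants c, C > 0 with the following property. Let E, A > 0, set ε = c E^{−1/14} and T = C A² E^{13/6} ε^{−4}. Let u be a smooth global solution of the defocusing quintic nonlinear wave equation with E(u(t)) ≤ E for all t ∈ ℝ, satisfying the a priori bounds with constant A. Then for all times t_j and b_j with T ≤ t_j ≤ b_j, the Duhamel integral satisfies ‖ D_{[0, t_j − T]}u ‖_{L⁸_{t,x}([t_j, b_j]×ℝ³)} ≤ ε/4. -/

import Mathlib

open MeasureTheory Real Set Function
open scoped ENNReal NNReal FourierTransform

noncomputable section

/-- Three-dimensional Euclidean space `ℝ³`. -/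
abbrev E3 : Type := EuclideanSpace ℝ (Fin 3)

/-- The time derivative `∂ₜ u` of a function `u : ℝ × ℝ³ → ℝ` (curried). -/
def tderiv (u : ℝ → E3 → ℝ) (t : ℝ) (x : E3) : ℝ := deriv (fun s => u s x) t

/-- The second time derivative `∂ₜ² u`. -/
def tderiv2 (u : ℝ → E3 → ℝ) (t : ℝ) (x : E3) : ℝ := deriv (fun s => tderiv u s x) t

/-- The spatial Laplacian `Δ f = ∑ᵢ ∂ᵢ² f` of `f : ℝ³ → ℝ`. -/
def lap (f : E3 → ℝ) (x : E3) : ℝ :=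
  ∑ i : Fin 3, iteratedFDeriv ℝ 2 f x ![EuclideanSpace.single i 1, EuclideanSpace.single i 1]

/-- `f : ℝ³ → ℝ` is a Schwartz function: it is smooth and all of its derivatives decay
faster than any polynomial. -/
def IsSchwartz (f : E3 → ℝ) : Prop :=
  ContDiff ℝ (⊤ : ℕ∞) f ∧ ∀ k n : ℕ, ∃ C : ℝ, ∀ x, ‖x‖ ^ k * ‖iteratedFDeriv ℝ n f x‖ ≤ C

/-- `u` is a smooth solution of the defocusing quintic nonlinear wave equation
`∂ₜ²u − Δu + u⁵ = 0` on the time interval `I`, Schwartz in the space variable at each time. -/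
def IsNLWOn (u : ℝ → E3 → ℝ) (I : Set ℝ) : Prop :=
  ContDiffOn ℝ (⊤ : ℕ∞) (uncurry u) (I ×ˢ univ) ∧
  (∀ t ∈ I, IsSchwartz (u t) ∧ IsSchwartz (tderiv u t)) ∧
  (∀ t ∈ I, ∀ x, tderiv2 u t x - lap (u t) x + (u t x) ^ 5 = 0)

/-- `u` is a smooth global solution of the defocusing quintic nonlinear wave equation. -/
def IsNLW (u : ℝ → E3 → ℝ) : Prop := IsNLWOn u univ

/-- The energy `E(u(t)) = ∫ (1/2)|∂ₜu|² + (1/2)|∇ₓu|² + (1/6)u⁶ dx`. -/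
def energy (u : ℝ → E3 → ℝ) (t : ℝ) : ℝ :=
  ∫ x : E3, ((1/2) * (tderiv u t x) ^ 2 + (1/2) * ‖gradient (u t) x‖ ^ 2 + (1/6) * (u t x) ^ 6)

/-- The spatial `L^q` norm (`q` finite), valued in `ℝ≥0∞`. -/
def xNorm {F : Type*} [NormedAddCommGroup F] (q : ℝ) (f : E3 → F) : ℝ≥0∞ :=
  (∫⁻ x : E3, (‖f x‖₊ : ℝ≥0∞) ^ q) ^ (1/q)

/-- The mixed norm `‖u‖_{L^p_t L^q_x (I × ℝ³)}` for finite `p, q`. -/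
def mixNorm (p q : ℝ) (I : Set ℝ) (u : ℝ → E3 → ℝ) : ℝ≥0∞ :=
  (∫⁻ t in I, (xNorm q (u t)) ^ p) ^ (1/p)

/-- The mixed norm `‖u‖_{L^∞_t L^q_x (I × ℝ³)}` (essential supremum in time). -/
def supNorm (q : ℝ) (I : Set ℝ) (u : ℝ → E3 → ℝ) : ℝ≥0∞ :=
  essSup (fun t => xNorm q (u t)) (volume.restrict I)

/-- The homogeneous Sobolev norm `‖f‖_{Ḣ^s} = (∫ |ξ|^{2s} |𝓕f(ξ)|² dξ)^{1/2}`. -/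
def sobNorm (s : ℝ) (f : E3 → ℝ) : ℝ≥0∞ :=
  (∫⁻ ξ : E3, (‖ξ‖₊ : ℝ≥0∞) ^ (2*s) *
    (‖𝓕 (fun x => (f x : ℂ)) ξ‖₊ : ℝ≥0∞) ^ (2:ℝ)) ^ ((1:ℝ)/2)

/-- The a priori bounds with constant `A`:
`‖u(t)‖_{L²} ≤ A`, `‖∂ₜu(t)‖_{Ḣ⁻¹} ≤ A`, `‖u(t)‖_{Ḣ²} ≤ A`, `‖∂ₜu(t)‖_{Ḣ¹} ≤ A` for all `t`. -/
def APriori (u : ℝ → E3 → ℝ) (A : ℝ) : Prop :=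
  ∀ t : ℝ, xNorm 2 (u t) ≤ ENNReal.ofReal A ∧ sobNorm (-1) (tderiv u t) ≤ ENNReal.ofReal A ∧
    sobNorm 2 (u t) ≤ ENNReal.ofReal A ∧ sobNorm 1 (tderiv u t) ≤ ENNReal.ofReal A

/-- The integral of `f` over the sphere of radius `r` about `x`, with respect to
two-dimensional Hausdorff (surface) measure. -/
def sphInt (x : E3) (r : ℝ) (f : E3 → ℝ) : ℝ := ∫ y in Metric.sphere x r, f y ∂(μH[2])

/-- The free wave evolution `S(t)(g, h)` given by Kirchhoff's formula. -/
def freeWave (g h : E3 → ℝ) (t : ℝ) (x : E3) : ℝ :=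
  if t = 0 then g x
  else deriv (fun s => (1/(4*π*s)) * sphInt x s g) t + (1/(4*π*t)) * sphInt x t h

/-- The Duhamel integral `D_{[s₁,s₂]}u(t,x) = ∫_{s₁}^{s₂} S(t−τ)(0, u(τ)⁵) dτ`,
written via Kirchhoff's formula. -/
def duh (u : ℝ → E3 → ℝ) (s₁ s₂ : ℝ) (t : ℝ) (x : E3) : ℝ :=
  ∫ τ in s₁..s₂, (1/(4*π*(t - τ))) * sphInt x (t - τ) (fun y => (u τ y) ^ 5)

section Parametric

variable {X G : Type*} [TopologicalSpace X] [MeasurableSpace X] [OpensMeasurableSpace X]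
  [SecondCountableTopology X] [NormedAddCommGroup G]

theorem integrable_of_continuous_of_compact {μ : Measure X} [IsFiniteMeasure μ] {K : Set X}
    (hK : IsCompact K) (hμ : ∀ᵐ ω ∂μ, ω ∈ K) {f : X → G} (hf : Continuous f) :
    Integrable f μ := by
  obtain ⟨C, hC⟩ := hK.exists_bound_of_continuousOn hf.continuousOn
  exact Integrable.of_bound hf.aestronglyMeasurable C (hμ.mono hC)

theorem hasDerivAt_integral_of_compact [NormedSpace ℝ G] {μ : Measure X} [IsFiniteMeasure μ] {K : Set X}
    (hK : IsCompact K) (hμ : ∀ᵐ ω ∂μ, ω ∈ K) {F F' : ℝ → X → G}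
    (hF : Continuous (uncurry F)) (hF' : Continuous (uncurry F'))
    (h : ∀ τ ω, HasDerivAt (fun s => F s ω) (F' τ ω) τ) (τ : ℝ) :
    HasDerivAt (fun s => ∫ ω, F s ω ∂μ) (∫ ω, F' τ ω ∂μ) τ := by
  obtain ⟨C, hC⟩ := ((isCompact_closedBall τ 1).prod hK).exists_bound_of_continuousOn
    hF'.continuousOn
  refine (hasDerivAt_integral_of_dominated_loc_of_deriv_le (bound := fun _ => C)
    (Metric.closedBall_mem_nhds τ one_pos) (.of_forall fun s => ?_)
    (integrable_of_continuous_of_compact hK hμ (hF.uncurry_left τ)) ?_ ?_ (integrable_const C)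
    (.of_forall fun ω s _ => h s ω)).2
  · exact (hF.uncurry_left s).aestronglyMeasurable
  · exact (hF'.uncurry_left τ).aestronglyMeasurable
  · exact hμ.mono fun ω hω s hs => hC (s, ω) ⟨hs, hω⟩

end Parametric

theorem eq_mul_sin_of_deriv {y y' : ℝ → ℂ} (m : ℂ) (h : ∀ s, HasDerivAt y (y' s) s)
    (h' : ∀ s, HasDerivAt y' (-y s) s) (h0 : y 0 = 0) (h1 : y' 0 = m) (s : ℝ) :
    y s = m * (sin s : ℝ) := by
  have hs (s : ℝ) : HasDerivAt (fun s : ℝ => ((sin s : ℝ) : ℂ)) ((cos s : ℝ) : ℂ) s :=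
    (hasDerivAt_sin s).ofReal_comp
  have hc (s : ℝ) : HasDerivAt (fun s : ℝ => ((cos s : ℝ) : ℂ)) ((-sin s : ℝ) : ℂ) s :=
    (hasDerivAt_cos s).ofReal_comp
  have k1 (s : ℝ) : HasDerivAt (fun s : ℝ => y s * (cos s : ℝ) - y' s * (sin s : ℝ)) 0 s := by
    refine (((h s).mul (hc s)).sub ((h' s).mul (hs s))).congr_deriv ?_
    push_cast; ring
  have k2 (s : ℝ) : HasDerivAt (fun s : ℝ => y s * (sin s : ℝ) + y' s * (cos s : ℝ)) 0 s := by
    refine (((h s).mul (hs s)).add ((h' s).mul (hc s))).congr_deriv ?_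
    push_cast; ring
  have e1 := is_const_of_deriv_eq_zero (fun s => (k1 s).differentiableAt)
    (fun s => (k1 s).deriv) s 0
  have e2 := is_const_of_deriv_eq_zero (fun s => (k2 s).differentiableAt)
    (fun s => (k2 s).deriv) s 0
  simp only [h0, h1, sin_zero, cos_zero] at e1 e2
  have e3 : ((sin s : ℝ) : ℂ) ^ 2 + ((cos s : ℝ) : ℂ) ^ 2 = 1 := by
    exact_mod_cast sin_sq_add_cos_sq s
  push_cast at e1 e2 e3 ⊢
  linear_combination (Complex.cos s) * e1 + (Complex.sin s) * e2 - (y s) * e3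

/-- A finite measure on the unit sphere which is invariant under linear isometries. -/
structure IsSphereInvariant (μ : Measure E3) : Prop where
  norm_eq_one : ∀ᵐ ω ∂μ, ‖ω‖ = 1
  map_eq : ∀ L : E3 ≃ₗᵢ[ℝ] E3, μ.map L = μ

namespace IsSphereInvariant

variable {μ : Measure E3}

theorem mem_sphere (hμ : IsSphereInvariant μ) : ∀ᵐ ω ∂μ, ω ∈ Metric.sphere (0 : E3) 1 :=
  hμ.norm_eq_one.mono fun ω h => by simpa using h

theorem charFun_congr (hμ : IsSphereInvariant μ) {ξ η : E3} (h : ‖ξ‖ = ‖η‖) :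
    charFun μ ξ = charFun μ η := by
  set L := Submodule.reflection (Submodule.span ℝ {ξ - η})ᗮ
  have hL : L ξ = η := Submodule.reflection_sub h
  rw [← hL, charFun_apply, charFun_apply]
  nth_rewrite 2 [← hμ.map_eq L]
  rw [integral_map L.continuous.aemeasurable
    (Continuous.aestronglyMeasurable (by fun_prop))]
  simp

private abbrev ax (i : Fin 3) : E3 := EuclideanSpace.single i 1

private theorem inner_ax (ω : E3) (s : ℝ) (i : Fin 3) : inner ℝ ω (s • ax i) = s * ω i := by
  simp [ax, inner_smul_right, EuclideanSpace.inner_single_right]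

theorem angular_identity [IsFiniteMeasure μ] (hμ : IsSphereInvariant μ) {i j : Fin 3} (hij : i ≠ j) (s : ℝ) :
    s * ∫ ω, (Complex.I * s * (ω j) ^ 2 - ω i) * Complex.exp (Complex.I * (s * ω i)) ∂μ = 0 := by
  have hK := isCompact_sphere (0 : E3) 1
  have hc (θ : ℝ) : ∫ ω : E3, Complex.exp (Complex.I * (s * (cos θ * ω i + sin θ * ω j : ℝ))) ∂μ
      = charFun μ (s • ax i) := by
    have : ‖s • ax i‖ = ‖(s * cos θ) • ax i + (s * sin θ) • ax j‖ := by
      have h2 : inner ℝ ((s * cos θ) • ax i) ((s * sin θ) • ax j) = 0 := by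
        simp [ax, inner_smul_left, inner_smul_right, EuclideanSpace.inner_single_left, hij]
      have := norm_add_sq_eq_norm_sq_add_norm_sq_of_inner_eq_zero _ _ h2
      rw [← sq_eq_sq₀ (norm_nonneg _) (norm_nonneg _), sq, sq, this]
      simp only [norm_smul, ax, PiLp.norm_single, norm_one, mul_one, norm_mul,
        Real.norm_eq_abs]
      have := sin_sq_add_cos_sq θ
      rw [← sq_abs (sin θ), ← sq_abs (cos θ)] at this
      linear_combination -(|s| * |s|) * this
    rw [hμ.charFun_congr this, charFun_apply]
    congr 1; ext ω
    rw [inner_add_right, inner_ax, inner_ax]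
    push_cast; ring_nf
  have d1 (θ : ℝ) := hasDerivAt_integral_of_compact hK hμ.mem_sphere
    (F := fun (θ : ℝ) (ω : E3) =>
      Complex.exp (Complex.I * (s * (cos θ * ω i + sin θ * ω j : ℝ))))
    (F' := fun (θ : ℝ) (ω : E3) =>
      Complex.exp (Complex.I * (s * (cos θ * ω i + sin θ * ω j : ℝ))) *
        (Complex.I * (s * (-sin θ * ω i + cos θ * ω j : ℝ))))
    (by simp only [Function.uncurry_def]; fun_prop)
    (by simp only [Function.uncurry_def]; fun_prop)
    (fun θ ω => (((((hasDerivAt_cos θ).mul_const (ω i)).add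
      ((hasDerivAt_sin θ).mul_const (ω j))).ofReal_comp.const_mul (s : ℂ)).const_mul
        Complex.I).cexp) θ
  have d2 := hasDerivAt_integral_of_compact hK hμ.mem_sphere
    (F := fun (θ : ℝ) (ω : E3) =>
      Complex.exp (Complex.I * (s * (cos θ * ω i + sin θ * ω j : ℝ))) *
        (Complex.I * (s * (-sin θ * ω i + cos θ * ω j : ℝ))))
    (F' := fun (θ : ℝ) (ω : E3) =>
      Complex.exp (Complex.I * (s * (cos θ * ω i + sin θ * ω j : ℝ))) *
        (Complex.I * (s * (-sin θ * ω i + cos θ * ω j : ℝ))) *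
        (Complex.I * (s * (-sin θ * ω i + cos θ * ω j : ℝ))) +
      Complex.exp (Complex.I * (s * (cos θ * ω i + sin θ * ω j : ℝ))) *
        (Complex.I * (s * (-cos θ * ω i + -sin θ * ω j : ℝ))))
    (by simp only [Function.uncurry_def]; fun_prop)
    (by simp only [Function.uncurry_def]; fun_prop)
    (fun θ ω => (((((hasDerivAt_cos θ).mul_const (ω i)).add
      ((hasDerivAt_sin θ).mul_const (ω j))).ofReal_comp.const_mul (s : ℂ)).const_mul
        Complex.I).cexp.mul (((((hasDerivAt_sin θ).neg.mul_const (ω i)).add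
      ((hasDerivAt_cos θ).mul_const (ω j))).ofReal_comp.const_mul (s : ℂ)).const_mul
        Complex.I)) 0
  have z1 (θ : ℝ) : ∫ ω : E3, Complex.exp (Complex.I * (s * (cos θ * ω i + sin θ * ω j : ℝ))) *
        (Complex.I * (s * (-sin θ * ω i + cos θ * ω j : ℝ))) ∂μ = 0 := by
    refine (d1 θ).unique ?_
    simp_rw [hc]
    exact hasDerivAt_const _ _
  simp_rw [z1] at d2
  have z2 := d2.unique (hasDerivAt_const _ _)
  simp only [cos_zero, sin_zero] at z2
  rw [← integral_const_mul]
  calc _ = -Complex.I * (∫ ω : E3, (Complex.exp (Complex.I * (s * (1 * ω i + 0 * ω j : ℝ))) *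
        (Complex.I * (s * (-0 * ω i + 1 * ω j : ℝ))) *
        (Complex.I * (s * (-0 * ω i + 1 * ω j : ℝ))) +
      Complex.exp (Complex.I * (s * (1 * ω i + 0 * ω j : ℝ))) *
        (Complex.I * (s * (-1 * ω i + -0 * ω j : ℝ)))) ∂μ) := by
        rw [← integral_const_mul]
        congr 1; ext ω
        push_cast
        ring_nf
        simp only [Complex.I_sq, show Complex.I ^ 3 = -Complex.I by
          rw [pow_succ, Complex.I_sq]; ring]
        ring_nf
    _ = 0 := by rw [z2, mul_zero]

theorem integral_coord (hμ : IsSphereInvariant μ) (i : Fin 3) : ∫ ω, ((ω i : ℝ) : ℂ) ∂μ = 0 := by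
  have h : ∫ ω, ((ω i : ℝ) : ℂ) ∂μ = -∫ ω, ((ω i : ℝ) : ℂ) ∂μ := by
    nth_rewrite 1 [← hμ.map_eq (LinearIsometryEquiv.neg ℝ)]
    rw [integral_map (LinearIsometryEquiv.continuous _).aemeasurable
      (Continuous.aestronglyMeasurable (by fun_prop)), ← integral_neg]
    simp
  exact self_eq_neg.1 h

theorem charFun_eq [IsFiniteMeasure μ] (hμ : IsSphereInvariant μ) (ξ : E3) :
    charFun μ ξ = μ.real univ * (sinc ‖ξ‖ : ℝ) := by
  have hK := isCompact_sphere (0 : E3) 1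
  set e : ℝ → E3 → ℂ := fun s ω => Complex.exp (Complex.I * (s * ω 0)) with he
  have hec : Continuous (uncurry e) := by simp only [he, Function.uncurry_def]; fun_prop
  have hd (s : ℝ) (ω : E3) : HasDerivAt (fun s => e s ω) (e s ω * (Complex.I * ω 0)) s := by
    refine (((hasDerivAt_id s).ofReal_comp.mul_const (ω 0 : ℂ)).const_mul
      Complex.I).cexp.congr_deriv ?_
    simp [he]
  have hF1 : Continuous (uncurry fun (s : ℝ) (ω : E3) => e s ω * (Complex.I * ω 0)) := by
    simp only [he, Function.uncurry_def]; fun_prop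
  have hF2 : Continuous (uncurry fun (s : ℝ) (ω : E3) =>
      e s ω * (Complex.I * ω 0) * (Complex.I * ω 0)) := by
    simp only [he, Function.uncurry_def]; fun_prop
  have g0 (s : ℝ) := hasDerivAt_integral_of_compact hK hμ.mem_sphere hec hF1 hd s
  have g1 (s : ℝ) := hasDerivAt_integral_of_compact hK hμ.mem_sphere hF1 hF2
    (fun s ω => (hd s ω).mul_const _) s
  have hs (s : ℝ) : HasDerivAt (fun s : ℝ => (s : ℂ)) 1 s := (hasDerivAt_id s).ofReal_comp
  have i0 (s : ℝ) : Integrable (e s) μ :=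
    integrable_of_continuous_of_compact hK hμ.mem_sphere (hec.uncurry_left s)
  have i1 (s : ℝ) := integrable_of_continuous_of_compact hK hμ.mem_sphere (hF1.uncurry_left s)
  have i2 (s : ℝ) := integrable_of_continuous_of_compact hK hμ.mem_sphere (hF2.uncurry_left s)
  have key (s : ℝ) : 2 * ∫ ω, e s ω * (Complex.I * ω 0) ∂μ
      + s * ∫ ω, e s ω * (Complex.I * ω 0) * (Complex.I * ω 0) ∂μ = -(s * ∫ ω, e s ω ∂μ) := by
    by_cases h0 : s = 0
    · have := hμ.integral_coord 0
      simp only [h0, he, Complex.ofReal_zero, zero_mul, mul_zero, Complex.exp_zero, one_mul]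
      rw [integral_const_mul, this]; simp
    have a (j : Fin 3) (hj : 0 ≠ j) := mul_left_cancel₀ (Complex.ofReal_ne_zero.2 h0)
      ((hμ.angular_identity hj s).trans (mul_zero _).symm)
    have ij (j : Fin 3) : Integrable (fun ω : E3 => (Complex.I * s * (ω j) ^ 2 - ω 0) *
        Complex.exp (Complex.I * (s * ω 0))) μ :=
      integrable_of_continuous_of_compact hK hμ.mem_sphere (by fun_prop)
    have b := congrArg₂ (· + ·) (a 1 (by decide)) (a 2 (by decide))
    simp only at b
    rw [← integral_add (ij 1) (ij 2), add_zero] at b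
    have c : ∫ ω, (2 * (e s ω * (Complex.I * ω 0)) +
        s * (e s ω * (Complex.I * ω 0) * (Complex.I * ω 0)) + s * e s ω) ∂μ = 0 := by
      rw [← mul_zero (-Complex.I), ← b, ← integral_const_mul]
      refine integral_congr_ae (hμ.norm_eq_one.mono fun ω hω => ?_)
      have : ((ω 0 : ℝ) : ℂ) ^ 2 + ((ω 1 : ℝ) : ℂ) ^ 2 + ((ω 2 : ℝ) : ℂ) ^ 2 = 1 := by
        have h := EuclideanSpace.real_norm_sq_eq ω
        rw [hω, Fin.sum_univ_three] at h
        have h' : ω 0 ^ 2 + ω 1 ^ 2 + ω 2 ^ 2 = 1 := by linarith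
        simpa using congrArg ((↑) : ℝ → ℂ) h'
      simp only [he]
      linear_combination (-(Complex.exp (Complex.I * (s * ω 0)))) * s * this
        + (Complex.exp (Complex.I * (s * ω 0)) * s * (ω 0 ^ 2 + ω 1 ^ 2 + ω 2 ^ 2)) * Complex.I_sq
    have i12 : Integrable (fun ω : E3 => 2 * (e s ω * (Complex.I * ω 0)) +
        s * (e s ω * (Complex.I * ω 0) * (Complex.I * ω 0))) μ :=
      ((i1 s).const_mul 2).add ((i2 s).const_mul _)
    rw [integral_add i12 ((i0 s).const_mul _),
      integral_add ((i1 s).const_mul 2) ((i2 s).const_mul _), integral_const_mul,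
      integral_const_mul, integral_const_mul] at c
    linear_combination c
  have sol := eq_mul_sin_of_deriv (y := fun s => s * ∫ ω, e s ω ∂μ)
    (y' := fun s => 1 * ∫ ω, e s ω ∂μ + s * ∫ ω, e s ω * (Complex.I * ω 0) ∂μ) (μ.real univ)
    (fun s => (hs s).mul (g0 s))
    (fun s => by
      refine (((g0 s).const_mul 1).add ((hs s).mul (g1 s))).congr_deriv ?_
      linear_combination key s) (by simp) (by simp [he])
  rw [hμ.charFun_congr (show ‖ξ‖ = ‖‖ξ‖ • ax 0‖ by simp [ax, norm_smul, PiLp.norm_single])]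
  rcases eq_or_ne ξ 0 with rfl | hξ
  · simp [charFun_zero]
  have hn := norm_ne_zero_iff.2 hξ
  rw [sinc_of_ne_zero hn]
  have hn' := Complex.ofReal_ne_zero.2 hn
  refine mul_left_cancel₀ hn' ?_
  have h1 : charFun μ (‖ξ‖ • ax 0) = ∫ ω, e ‖ξ‖ ω ∂μ := by
    rw [charFun_apply]
    congr 1; ext ω
    rw [inner_ax, he]
    push_cast; ring_nf
  rw [h1, sol ‖ξ‖, Complex.ofReal_div]
  field_simp

end IsSphereInvariant

/-- The surface measure of the unit sphere of `ℝ³`, as a measure on `ℝ³`. -/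
def sphM : Measure E3 := (volume : Measure E3).toSphere.map Subtype.val

instance : IsFiniteMeasure sphM := by unfold sphM; infer_instance

theorem sphM_ne_zero : sphM.real univ ≠ 0 := by
  have : sphM univ = (volume : Measure E3).toSphere univ := by
    rw [sphM, Measure.map_apply measurable_subtype_coe MeasurableSet.univ, preimage_univ]
  rw [measureReal_def, this, ← measureReal_def]
  intro h
  rw [measureReal_eq_zero_iff, Measure.measure_univ_eq_zero] at h
  exact Measure.toSphere_ne_zero _ h

open scoped Pointwise in
theorem isSphereInvariant_sphM : IsSphereInvariant sphM where
  norm_eq_one := by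
    rw [sphM, ae_map_iff measurable_subtype_coe.aemeasurable
      (measurableSet_eq_fun measurable_norm measurable_const)]
    exact .of_forall fun ω => by simp
  map_eq L := by
    ext s hs
    have hL : Measurable L := L.continuous.measurable
    rw [Measure.map_apply hL hs, sphM, Measure.map_apply measurable_subtype_coe (hL hs),
      Measure.map_apply measurable_subtype_coe hs,
      Measure.toSphere_apply' _ (measurable_subtype_coe (hL hs)),
      Measure.toSphere_apply' _ (measurable_subtype_coe hs)]
    congr 1
    rw [← (LinearIsometryEquiv.measurePreserving L).measure_preimage_equiv
      (f := L.toHomeomorph.toMeasurableEquiv) (Ioo (0 : ℝ) 1 • 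
        (Subtype.val '' ((Subtype.val : Metric.sphere (0 : E3) 1 → E3) ⁻¹' s)))]
    congr 1
    ext y
    simp only [mem_smul, mem_image, mem_preimage, Subtype.exists, mem_sphere_zero_iff_norm]
    constructor
    · rintro ⟨a, ha, b, ⟨c, hc, h1, rfl⟩, rfl⟩
      exact ⟨a, ha, L c, ⟨L c, by simpa using hc, h1, rfl⟩, (L.map_smul a c).symm⟩
    · rintro ⟨a, ha, b, ⟨c, hc, h1, rfl⟩, h2⟩
      have h2' : a • c = L y := h2
      refine ⟨a, ha, L.symm c, ⟨L.symm c, by simpa using hc, by simpa using h1, rfl⟩, ?_⟩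
      apply L.injective
      rw [map_smul, L.apply_symm_apply, h2']

theorem lintegral_polar {f : E3 → ℝ≥0∞} (hf : Measurable f) :
    ∫⁻ x, f x = ∫⁻ r in Ioi (0 : ℝ), ENNReal.ofReal (r ^ 2) * ∫⁻ ω, f (r • ω) ∂sphM := by
  have h0 : ∫⁻ x, f x = ∫⁻ x in ({0}ᶜ : Set E3), f x := by
    rw [restrict_compl_singleton]
  have hm : MeasurableSet ({0}ᶜ : Set E3) := (measurableSet_singleton 0).compl
  have h3 : Module.finrank ℝ E3 - 1 = 2 := by simp
  have hp := (volume : Measure E3).measurePreserving_homeomorphUnitSphereProd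
  rw [h3] at hp
  rw [h0, ← lintegral_subtype_comap hm]
  have hg : Measurable fun p : Metric.sphere (0 : E3) 1 × Ioi (0 : ℝ) =>
      f ((p.2 : ℝ) • (p.1 : E3)) := hf.comp (by fun_prop)
  have h1 := hp.lintegral_comp hg
  have h2 : ∀ x : ({0}ᶜ : Set E3), f (((homeomorphUnitSphereProd E3 x).2 : ℝ) •
      ((homeomorphUnitSphereProd E3 x).1 : E3)) = f x := by
    intro x
    congr 1
    exact congrArg Subtype.val ((homeomorphUnitSphereProd E3).symm_apply_apply x)
  simp_rw [h2] at h1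
  rw [h1, lintegral_prod_symm' _ hg, Measure.volumeIoiPow,
    lintegral_withDensity_eq_lintegral_mul _ (by fun_prop) hg.lintegral_prod_left',
    ← lintegral_subtype_comap measurableSet_Ioi]
  congr 1; ext r
  simp only [Pi.mul_apply]
  rw [sphM, lintegral_map (f := fun ω => f ((r : ℝ) • ω)) (hf.comp (by fun_prop))
    measurable_subtype_coe]

theorem IsSphereInvariant.eq_smul_sphM {μ : Measure E3} [IsFiniteMeasure μ]
    (hμ : IsSphereInvariant μ) : ∃ κ : ℝ≥0, μ = κ • sphM := by
  refine ⟨(μ.real univ / sphM.real univ).toNNReal, Measure.ext_of_charFun ?_⟩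
  ext ξ
  have h : charFun ((μ.real univ / sphM.real univ).toNNReal • sphM) ξ =
      (μ.real univ / sphM.real univ : ℝ) * charFun sphM ξ := by
    rw [charFun_apply, integral_smul_nnreal_measure, charFun_apply, NNReal.smul_def,
      Real.coe_toNNReal _ (by positivity), Complex.real_smul]
  have hne := Complex.ofReal_ne_zero.2 sphM_ne_zero
  rw [h, hμ.charFun_eq, isSphereInvariant_sphM.charFun_eq, Complex.ofReal_div]
  field_simp

/-- Spherical coordinates. -/
private def sphCoord (p : ℝ × ℝ) : E3 :=
  !₂[sin p.1 * cos p.2, sin p.1 * sin p.2, cos p.1]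

private theorem abs_mul_sub_mul_le {a b a' b' : ℝ} (hb : |b| ≤ 1) (ha : |a'| ≤ 1) :
    |a * b - a' * b'| ≤ |a - a'| + |b - b'| := by
  have : a * b - a' * b' = (a - a') * b + a' * (b - b') := by ring
  rw [this]
  refine (abs_add_le _ _).trans (add_le_add ?_ ?_)
  · rw [abs_mul]; exact mul_le_of_le_one_right (abs_nonneg _) hb
  · rw [abs_mul]; exact mul_le_of_le_one_left (abs_nonneg _) ha

private theorem lipschitz_sphCoord : ∃ K, LipschitzWith K sphCoord := by
  have h : LipschitzWith 2 (fun p : ℝ × ℝ =>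
      (![sin p.1 * cos p.2, sin p.1 * sin p.2, cos p.1] : Fin 3 → ℝ)) := by
    refine LipschitzWith.of_dist_le_mul fun p q => ?_
    have h1 : |p.1 - q.1| ≤ dist p q := by
      rw [Prod.dist_eq, ← Real.dist_eq]; exact le_max_left _ _
    have h2 : |p.2 - q.2| ≤ dist p q := by
      rw [Prod.dist_eq, ← Real.dist_eq]; exact le_max_right _ _
    have hs (a b : ℝ) : |sin a - sin b| ≤ |a - b| := by
      simpa [Real.dist_eq] using lipschitzWith_sin.dist_le_mul a b
    have hc (a b : ℝ) : |cos a - cos b| ≤ |a - b| := by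
      simpa [Real.dist_eq] using lipschitzWith_cos.dist_le_mul a b
    rw [dist_pi_le_iff (by positivity)]
    have := dist_nonneg (x := p) (y := q)
    intro i
    fin_cases i
    · have := abs_mul_sub_mul_le (a := sin p.1) (b' := cos q.2) (abs_cos_le_one p.2)
        (abs_sin_le_one q.1)
      simp [Real.dist_eq]
      linarith [hs p.1 q.1, hc p.2 q.2]
    · have := abs_mul_sub_mul_le (a := sin p.1) (b' := sin q.2) (abs_sin_le_one p.2)
        (abs_sin_le_one q.1)
      simp [Real.dist_eq]
      linarith [hs p.1 q.1, hs p.2 q.2]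
    · simp [Real.dist_eq]
      linarith [hc p.1 q.1]
  exact ⟨_, (PiLp.lipschitzWith_toLp 2 (fun _ : Fin 3 => ℝ)).comp h⟩

private theorem sphere_subset_image_sphCoord :
    Metric.sphere (0 : E3) 1 ⊆ sphCoord '' (Icc 0 π ×ˢ Icc (-π) π) := by
  intro ω hω
  have h1 : ω 0 ^ 2 + ω 1 ^ 2 + ω 2 ^ 2 = 1 := by
    have h := EuclideanSpace.real_norm_sq_eq ω
    rw [mem_sphere_zero_iff_norm.1 hω, Fin.sum_univ_three] at h
    linarith
  have h2 : -1 ≤ ω 2 := by nlinarith [sq_nonneg (ω 0), sq_nonneg (ω 1)]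
  have h3 : ω 2 ≤ 1 := by nlinarith [sq_nonneg (ω 0), sq_nonneg (ω 1)]
  set z : ℂ := ⟨ω 0, ω 1⟩
  have hz : sin (arccos (ω 2)) = ‖z‖ := by
    rw [sin_arccos, Complex.norm_def]
    congr 1
    simp only [Complex.normSq_mk, z]; linarith
  refine ⟨(arccos (ω 2), Complex.arg z), ⟨⟨arccos_nonneg _, arccos_le_pi _⟩,
    (Complex.neg_pi_lt_arg z).le, Complex.arg_le_pi z⟩, ?_⟩
  ext i
  fin_cases i
  · simp [sphCoord, hz, Complex.norm_mul_cos_arg, z]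
  · simp [sphCoord, hz, Complex.norm_mul_sin_arg, z]
  · simp [sphCoord, cos_arccos h2 h3]

theorem hausdorffMeasure_sphere_lt_top : μH[2] (Metric.sphere (0 : E3) 1) < ∞ := by
  obtain ⟨K, hK⟩ := lipschitz_sphCoord
  refine (measure_mono sphere_subset_image_sphCoord).trans_lt
    ((hK.hausdorffMeasure_image_le zero_le_two _).trans_lt ?_)
  rw [hausdorffMeasure_prod_real]
  exact ENNReal.mul_lt_top (ENNReal.rpow_lt_top_of_nonneg zero_le_two ENNReal.coe_ne_top)
    (isCompact_Icc.prod isCompact_Icc).measure_lt_top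

instance : IsFiniteMeasure ((μH[2] : Measure E3).restrict (Metric.sphere 0 1)) :=
  ⟨by rw [Measure.restrict_apply_univ]; exact hausdorffMeasure_sphere_lt_top⟩

theorem isSphereInvariant_hausdorffMeasure :
    IsSphereInvariant ((μH[2] : Measure E3).restrict (Metric.sphere 0 1)) where
  norm_eq_one := (ae_restrict_mem Metric.isClosed_sphere.measurableSet).mono
    fun ω h => by simpa using h
  map_eq L := by
    have h := (L.toIsometryEquiv.measurePreserving_hausdorffMeasure 2).restrict_preimage
      (Metric.isClosed_sphere (x := (0 : E3)) (ε := 1)).measurableSet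
    have h2 : L.toIsometryEquiv ⁻¹' Metric.sphere 0 1 = Metric.sphere (0 : E3) 1 := by
      ext; simp
    rw [h2] at h
    exact h.map_eq

open scoped Pointwise in
theorem exists_sphInt_eq : ∃ κ : ℝ, 0 ≤ κ ∧ ∀ (x : E3) (r : ℝ) (f : E3 → ℝ), 0 < r →
    sphInt x r f = κ * r ^ 2 * ∫ ω, f (x + r • ω) ∂sphM := by
  obtain ⟨κ, hκ⟩ := isSphereInvariant_hausdorffMeasure.eq_smul_sphM
  refine ⟨κ, κ.2, fun x r f hr => ?_⟩
  set h : E3 ≃ₜ E3 := (Homeomorph.smulOfNeZero r hr.ne').trans (Homeomorph.addLeft x)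
  have hh (y : E3) : h y = x + r • y := rfl
  have h1 : (μH[2] : Measure E3) = (‖r‖₊ ^ 2 : ℝ≥0) • Measure.map h μH[2] := by
    ext s hs
    have hs' : s = (fun y => x + y) '' (r • (h ⁻¹' s)) := by
      ext y
      simp only [mem_image, mem_smul_set, mem_preimage, hh]
      constructor
      · intro hy
        refine ⟨_, ⟨r⁻¹ • (y - x), ?_, rfl⟩, ?_⟩ <;> simp [smul_smul, hr.ne', hy]
      · rintro ⟨_, ⟨z, hz, rfl⟩, rfl⟩; exact hz
    nth_rewrite 1 [hs']
    rw [(isometry_add_left x).hausdorffMeasure_image (.inl zero_le_two),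
      Measure.hausdorffMeasure_smul₀ zero_le_two hr.ne', Measure.smul_apply,
      Measure.map_apply h.measurable hs]
    norm_cast
  have h2 : h ⁻¹' Metric.sphere x r = Metric.sphere 0 1 := by
    ext y
    simp [hh, norm_smul, abs_of_pos hr, hr.ne']
  rw [sphInt, h1, Measure.restrict_smul, integral_smul_nnreal_measure,
    h.measurableEmbedding.setIntegral_map, h2, hκ, integral_smul_nnreal_measure]
  simp only [hh, NNReal.smul_def, smul_eq_mul]
  push_cast
  rw [Real.norm_of_nonneg hr.le]
  ring

/-- Archimedes' hat-box theorem. -/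
theorem map_inner_sphM {e : E3} (he : ‖e‖ = 1) :
    sphM.map (fun ω => inner ℝ ω e) =
      (sphM.real univ / 2).toNNReal • volume.restrict (Icc (-1 : ℝ) 1) := by
  have : IsFiniteMeasure (sphM.map (fun ω => inner ℝ ω e)) := inferInstance
  refine Measure.ext_of_charFun ?_
  ext s
  rw [charFun_apply_real, charFun_apply_real, integral_map (by fun_prop)
    (Continuous.aestronglyMeasurable (by fun_prop)), integral_smul_nnreal_measure]
  have h1 : ∫ ω, Complex.exp (s * (inner ℝ ω e : ℝ) * Complex.I) ∂sphM
      = charFun sphM (s • e) := by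
    rw [charFun_apply]; simp [inner_smul_right]
  rw [h1, isSphereInvariant_sphM.charFun_eq, integral_Icc_eq_integral_Ioc,
    ← intervalIntegral.integral_of_le (by norm_num), norm_smul, he, mul_one, NNReal.smul_def,
    Real.coe_toNNReal _ (by positivity), Complex.real_smul]
  have h2 : ∫ x in (-1 : ℝ)..1, Complex.exp (s * x * Complex.I) = 2 * (sinc ‖s‖ : ℝ) := by
    rcases eq_or_ne s 0 with rfl | hs
    · simp; norm_num
    have hs' : (s : ℂ) * Complex.I ≠ 0 := by simp [hs]
    have : ∀ x : ℝ, (s : ℂ) * x * Complex.I = (s * Complex.I) * x := fun x => by ring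
    simp_rw [this]
    rw [integral_exp_mul_complex hs', Real.norm_eq_abs]
    have h3 : sinc |s| = sinc s := by rcases abs_choice s with h | h <;> simp [h]
    rw [h3, sinc_of_ne_zero hs]
    push_cast
    rw [Complex.sin]
    have : (s : ℂ) ≠ 0 := Complex.ofReal_ne_zero.2 hs
    field_simp
    ring_nf
    simp only [Complex.I_sq]
    ring
  rw [h2]
  push_cast
  ring

theorem lintegral_inner_sphM {e : E3} (he : ‖e‖ = 1) {H : ℝ → ℝ≥0∞} (hH : Measurable H) :
    ∫⁻ ω, H (inner ℝ ω e) ∂sphM =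
      ENNReal.ofReal (sphM.real univ / 2) * ∫⁻ z in Ioo (-1 : ℝ) 1, H z := by
  rw [restrict_Ioo_eq_restrict_Icc, ← lintegral_map hH (by fun_prop), map_inner_sphM he, lintegral_smul_measure]
  rfl

theorem lintegral_law_of_cosines {r Z : ℝ} (hr : 0 < r) (hZ : 0 < Z) (g : ℝ → ℝ≥0∞) :
    ∫⁻ z in Ioo (-1 : ℝ) 1, ENNReal.ofReal r *
        (g √(r ^ 2 - 2 * r * Z * z + Z ^ 2) * (ENNReal.ofReal √(r ^ 2 - 2 * r * Z * z + Z ^ 2))⁻¹)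
      ≤ (ENNReal.ofReal Z)⁻¹ * ∫⁻ ρ in Icc (r - Z) (r + Z), g ρ := by
  set q : ℝ → ℝ := fun z => r ^ 2 - 2 * r * Z * z + Z ^ 2 with hq
  have hrZ := mul_pos hr hZ
  have hq0 {z : ℝ} (hz : z ∈ Ioo (-1 : ℝ) 1) : 0 < q z := by
    simp only [hq]; nlinarith [hz.2, sq_nonneg (r - Z)]
  have hd (z : ℝ) (hz : z ∈ Ioo (-1 : ℝ) 1) :
      HasDerivWithinAt (fun z => √(q z)) (-(2 * r * Z) / (2 * √(q z))) (Ioo (-1) 1) z := by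
    have h1 : HasDerivAt q (-(2 * r * Z)) z := by
      refine (((hasDerivAt_id z).const_mul (2 * r * Z)).const_sub (r ^ 2)).add_const (Z ^ 2)
        |>.congr_deriv (by ring)
    exact (h1.sqrt (hq0 hz).ne').hasDerivWithinAt
  have hinj : InjOn (fun z => √(q z)) (Ioo (-1) 1) := by
    intro a ha b hb hab
    have h := (sqrt_inj (hq0 ha).le (hq0 hb).le).1 hab
    simp only [hq] at h
    have : r * Z * (a - b) = 0 := by linarith
    rcases mul_eq_zero.1 this with h | h
    · exact absurd h hrZ.ne'
    · linarith
  have himg : (fun z => √(q z)) '' Ioo (-1) 1 ⊆ Icc (r - Z) (r + Z) := by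
    rintro _ ⟨z, hz, rfl⟩
    constructor
    · refine le_sqrt_of_sq_le ?_
      simp only [hq]; nlinarith [hz.2]
    · refine sqrt_le_iff.2 ⟨by positivity, ?_⟩
      simp only [hq]; nlinarith [hz.1]
  have hcv := lintegral_image_eq_lintegral_abs_deriv_mul measurableSet_Ioo hd hinj g
  have hZ0 : ENNReal.ofReal Z ≠ 0 := by simpa using hZ
  calc _ = ∫⁻ z in Ioo (-1 : ℝ) 1, (ENNReal.ofReal Z)⁻¹ *
        (ENNReal.ofReal |-(2 * r * Z) / (2 * √(q z))| * g √(q z)) := by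
        refine setLIntegral_congr_fun measurableSet_Ioo fun z hz => ?_
        have hs := sqrt_pos.2 (hq0 hz)
        have h1 : |-(2 * r * Z) / (2 * √(q z))| = Z * (r * (√(q z))⁻¹) := by
          rw [neg_div, abs_neg, abs_of_pos (by positivity)]; field_simp
        change _ * (g √(q z) * (ENNReal.ofReal √(q z))⁻¹) = _
        rw [h1, ENNReal.ofReal_mul hZ.le, ENNReal.ofReal_mul hr.le, ENNReal.ofReal_inv_of_pos hs]
        calc _ = ((ENNReal.ofReal Z)⁻¹ * ENNReal.ofReal Z) * (ENNReal.ofReal r *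
              (g √(q z) * (ENNReal.ofReal √(q z))⁻¹)) := by
              rw [ENNReal.inv_mul_cancel hZ0 ENNReal.ofReal_ne_top, one_mul]
          _ = _ := by ring
    _ = (ENNReal.ofReal Z)⁻¹ * ∫⁻ ρ in (fun z => √(q z)) '' Ioo (-1) 1, g ρ := by
        rw [lintegral_const_mul' _ _ (ENNReal.inv_ne_top.2 hZ0), hcv]
    _ ≤ _ := by gcongr

theorem lintegral_strip {Z : ℝ} (hZ : 0 < Z) {G : ℝ → ℝ≥0∞} (hG : Measurable G) (s : ℝ) :
    ∫⁻ r, ∫⁻ ρ in Icc (r - Z) (r + Z), G (s - r - ρ) = ENNReal.ofReal Z * ∫⁻ a, G a := by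
  have h1 (r : ℝ) : ∫⁻ ρ in Icc (r - Z) (r + Z), G (s - r - ρ) =
      ∫⁻ v in Icc (-Z) Z, G (s - 2 * r - v) := by
    rw [← (measurePreserving_add_left volume r).setLIntegral_comp_preimage measurableSet_Icc
      (by fun_prop)]
    have : (fun x => r + x) ⁻¹' Icc (r - Z) (r + Z) = Icc (-Z) Z := by
      ext v; simp only [mem_preimage, mem_Icc]
      constructor <;> rintro ⟨h, h'⟩ <;> constructor <;> linarith
    rw [this]
    congr 1; ext v; congr 1; ring
  have h2 (v : ℝ) : ∫⁻ r, G (s - 2 * r - v) = ENNReal.ofReal (1 / 2) * ∫⁻ a, G a := by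
    have h := lintegral_image_eq_lintegral_abs_deriv_mul (s := univ) (f := fun r : ℝ => s - 2 * r - v)
      (f' := fun _ => -2) MeasurableSet.univ
      (fun r _ => ((((hasDerivAt_id r).const_mul 2).const_sub s).sub_const v).congr_deriv
        (by ring) |>.hasDerivWithinAt) (fun a _ b _ h => by simp only at h; linarith) G
    have hi : (fun r : ℝ => s - 2 * r - v) '' univ = univ :=
      image_univ_of_surjective fun a => ⟨(s - v - a) / 2, by ring⟩
    rw [hi, setLIntegral_univ, setLIntegral_univ, lintegral_const_mul' _ _ ENNReal.ofReal_ne_top] at h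
    rw [h, ← mul_assoc, ← ENNReal.ofReal_mul (by norm_num)]
    norm_num
  simp_rw [h1]
  rw [lintegral_lintegral_swap (by fun_prop)]
  simp_rw [h2]
  rw [setLIntegral_const, Real.volume_Icc, mul_comm, ← mul_assoc,
    ← ENNReal.ofReal_mul (by linarith)]
  congr 2; ring

theorem lintegral_cone_kernel_le {G : ℝ → ℝ≥0∞} (hG : Measurable G) (s : ℝ) {ζ : E3} (hζ : ζ ≠ 0) :
    ∫⁻ ξ, G (s - ‖ξ‖ - ‖ζ - ξ‖) * ((ENNReal.ofReal ‖ξ‖)⁻¹ * (ENNReal.ofReal ‖ζ - ξ‖)⁻¹) ≤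
      ENNReal.ofReal (sphM.real univ / 2) * ∫⁻ a, G a := by
  have hZ := norm_pos_iff.2 hζ
  set Z := ‖ζ‖ with hZdef
  set e : E3 := Z⁻¹ • ζ with he
  have hen : ‖e‖ = 1 := by rw [he, norm_smul, norm_inv, norm_norm, inv_mul_cancel₀ hZ.ne']
  have hζe : ζ = Z • e := by rw [he, smul_smul, mul_inv_cancel₀ hZ.ne', one_smul]
  rw [lintegral_polar (by fun_prop)]
  calc _ = ∫⁻ r in Ioi (0 : ℝ), ENNReal.ofReal (sphM.real univ / 2) *
        ∫⁻ z in Ioo (-1 : ℝ) 1, ENNReal.ofReal r *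
        (G (s - r - √(r ^ 2 - 2 * r * Z * z + Z ^ 2)) *
          (ENNReal.ofReal √(r ^ 2 - 2 * r * Z * z + Z ^ 2))⁻¹) := by
        refine setLIntegral_congr_fun measurableSet_Ioi fun r (hr : 0 < r) => ?_
        have hr0 : ENNReal.ofReal r ≠ 0 := by simpa using hr
        rw [← lintegral_inner_sphM hen (H := fun z =>
          ENNReal.ofReal r * (G (s - r - √(r ^ 2 - 2 * r * Z * z + Z ^ 2)) *
          (ENNReal.ofReal √(r ^ 2 - 2 * r * Z * z + Z ^ 2))⁻¹)) (by fun_prop),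
          ← lintegral_const_mul' _ _ ENNReal.ofReal_ne_top]
        refine lintegral_congr_ae (isSphereInvariant_sphM.norm_eq_one.mono fun ω hω => ?_)
        have h1 : ‖r • ω‖ = r := by rw [norm_smul, hω, mul_one, norm_of_nonneg hr.le]
        have h2 : ‖ζ - r • ω‖ = √(r ^ 2 - 2 * r * Z * inner ℝ ω e + Z ^ 2) := by
          rw [← sqrt_sq (norm_nonneg (ζ - r • ω)), norm_sub_sq_real, ← hZdef, h1]
          congr 1
          rw [hζe, inner_smul_left, inner_smul_right, real_inner_comm]
          simp only [conj_trivial]; ring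
        simp only
        rw [h1, h2]
        generalize √(r ^ 2 - 2 * r * Z * inner ℝ ω e + Z ^ 2) = w
        rw [pow_two, ENNReal.ofReal_mul hr.le]
        calc _ = (ENNReal.ofReal r * (ENNReal.ofReal r)⁻¹) * (ENNReal.ofReal r *
              (G (s - r - w) * (ENNReal.ofReal w)⁻¹)) := by ring
          _ = _ := by rw [ENNReal.mul_inv_cancel hr0 ENNReal.ofReal_ne_top, one_mul]
    _ ≤ ∫⁻ r in Ioi (0 : ℝ), ENNReal.ofReal (sphM.real univ / 2) *
        ((ENNReal.ofReal Z)⁻¹ * ∫⁻ ρ in Icc (r - Z) (r + Z), G (s - r - ρ)) := by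
        refine setLIntegral_mono' measurableSet_Ioi fun r (hr : 0 < r) => ?_
        gcongr
        exact lintegral_law_of_cosines hr hZ (fun ρ => G (s - r - ρ))
    _ ≤ ∫⁻ r, ENNReal.ofReal (sphM.real univ / 2) *
        ((ENNReal.ofReal Z)⁻¹ * ∫⁻ ρ in Icc (r - Z) (r + Z), G (s - r - ρ)) :=
        setLIntegral_le_lintegral _ _
    _ = _ := by
        have hZ0 : ENNReal.ofReal Z ≠ 0 := by simpa using hZ
        rw [lintegral_const_mul' _ _ ENNReal.ofReal_ne_top,
          lintegral_const_mul' _ _ (ENNReal.inv_ne_top.2 hZ0), lintegral_strip hZ hG,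
          ← mul_assoc (ENNReal.ofReal Z)⁻¹, ENNReal.inv_mul_cancel hZ0 ENNReal.ofReal_ne_top, one_mul]

section Weighted

variable {X W : Type*} [MeasurableSpace X] [MeasurableSpace W]

theorem lintegral_weight_mul_sq_le {μ : Measure X} {ν : Measure W} [SFinite μ] [SFinite ν]
    {h : X → ℂ} (hh : Integrable h μ) {θ : X → W → ℂ} (hθ : Measurable (uncurry θ))
    (hθ1 : ∀ p w, ‖θ p w‖ ≤ 1) {g : W → ℝ} (hg : Integrable g ν) (hg0 : ∀ w, 0 ≤ g w) :
    ∫⁻ w, ENNReal.ofReal (g w) * ‖∫ p, θ p w * h p ∂μ‖ₑ ^ 2 ∂ν ≤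
      ∫⁻ q, ‖h q.1‖ₑ * ‖h q.2‖ₑ *
        ‖∫ w, (g w : ℂ) * (θ q.1 w * starRingEnd ℂ (θ q.2 w)) ∂ν‖ₑ ∂(μ.prod μ) := by
  set H : W → ℂ := fun w => ∫ p, θ p w * h p ∂μ with hH
  have hHm : AEStronglyMeasurable H ν := by
    have h1 : AEStronglyMeasurable (fun q : W × X => θ q.2 q.1 * h q.2) (ν.prod μ) :=
      (hθ.comp measurable_swap).aestronglyMeasurable.mul hh.1.comp_snd
    exact h1.integral_prod_right'
  have hHb (w : W) : ‖H w‖ ≤ ∫ p, ‖h p‖ ∂μ := by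
    refine norm_integral_le_of_norm_le hh.norm (.of_forall fun p => ?_)
    rw [norm_mul]; exact mul_le_of_le_one_left (norm_nonneg _) (hθ1 p w)
  have hfint : Integrable (fun w => g w * ‖H w‖ ^ 2) ν := by
    refine hg.mul_bdd (c := (∫ p, ‖h p‖ ∂μ) ^ 2) (hHm.norm.pow 2) (.of_forall fun w => ?_)
    rw [norm_pow, norm_norm]
    exact pow_le_pow_left₀ (norm_nonneg _) (hHb w) 2
  have hbig : Integrable (uncurry fun (w : W) (q : X × X) => (g w : ℂ) *
      (θ q.1 w * h q.1 * starRingEnd ℂ (θ q.2 w * h q.2))) (ν.prod (μ.prod μ)) := by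
    have h0 : Integrable (fun z : W × X × X => (g z.1 : ℂ) *
        (h z.2.1 * starRingEnd ℂ (h z.2.2))) (ν.prod (μ.prod μ)) :=
      hg.ofReal.mul_prod (hh.mul_prod (f := h) (g := fun p => starRingEnd ℂ (h p))
        ((Complex.conjLIE.integrable_comp_iff (φ := h)).2 hh))
    have h1 : Measurable fun z : W × X × X => θ z.2.1 z.1 * starRingEnd ℂ (θ z.2.2 z.1) :=
      (hθ.comp (by fun_prop : Measurable fun z : W × X × X => (z.2.1, z.1))).mul
        (Complex.continuous_conj.measurable.comp
          (hθ.comp (by fun_prop : Measurable fun z : W × X × X => (z.2.2, z.1))))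
    refine (h0.bdd_mul (c := 1) h1.aestronglyMeasurable (.of_forall fun z => ?_)).congr
      (.of_forall fun z => ?_)
    · rw [norm_mul, RCLike.norm_conj]
      exact mul_le_one₀ (hθ1 _ _) (norm_nonneg _) (hθ1 _ _)
    · simp only [uncurry, map_mul]; ring
  have hsw := integral_integral_swap hbig
  have e1 (w : W) : ∫ q, (g w : ℂ) * (θ q.1 w * h q.1 * starRingEnd ℂ (θ q.2 w * h q.2)) ∂(μ.prod μ)
      = (g w * ‖H w‖ ^ 2 : ℝ) := by
    rw [integral_const_mul, integral_prod_mul (fun p => θ p w * h p)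
      (fun p => starRingEnd ℂ (θ p w * h p)), integral_conj]
    have := Complex.mul_conj (H w)
    rw [Complex.normSq_eq_norm_sq] at this
    push_cast
    rw [hH] at this ⊢
    simp only at this ⊢
    rw [this]; push_cast; rfl
  simp_rw [e1] at hsw
  rw [integral_complex_ofReal] at hsw
  calc _ = ∫⁻ w, ENNReal.ofReal (g w * ‖H w‖ ^ 2) ∂ν := by
        congr 1; ext w
        rw [ENNReal.ofReal_mul (hg0 w), ENNReal.ofReal_pow (norm_nonneg _), ofReal_norm]
    _ = ENNReal.ofReal (∫ w, g w * ‖H w‖ ^ 2 ∂ν) := by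
        rw [ofReal_integral_eq_lintegral_ofReal hfint
          (.of_forall fun w => mul_nonneg (hg0 w) (by positivity))]
    _ ≤ ‖((∫ w, g w * ‖H w‖ ^ 2 ∂ν : ℝ) : ℂ)‖ₑ := by
        rw [← ofReal_norm, Complex.norm_real]
        exact ENNReal.ofReal_le_ofReal (le_abs_self _)
    _ ≤ _ := by
        rw [hsw]
        refine (enorm_integral_le_lintegral_enorm _).trans (lintegral_mono fun q => le_of_eq ?_)
        have : ∫ w, (g w : ℂ) * (θ q.1 w * h q.1 * starRingEnd ℂ (θ q.2 w * h q.2)) ∂ν =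
            (h q.1 * starRingEnd ℂ (h q.2)) *
              ∫ w, (g w : ℂ) * (θ q.1 w * starRingEnd ℂ (θ q.2 w)) ∂ν := by
          rw [← integral_const_mul]
          congr 1; ext w; rw [map_mul]; ring
        rw [this, enorm_mul, enorm_mul, RCLike.enorm_conj]

theorem ENNReal_mul_le_weighted (x y : ℝ≥0∞) {a b : ℝ≥0∞} (ha : a ≠ 0) (ha' : a ≠ ∞)
    (hb : b ≠ 0) (hb' : b ≠ ∞) : x * y ≤ x ^ 2 * a * b⁻¹ + y ^ 2 * b * a⁻¹ := by
  rcases le_total (x * a) (y * b) with h | h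
  · refine le_add_left ?_
    have : x ≤ y * b * a⁻¹ := by
      rw [← div_eq_mul_inv, ENNReal.le_div_iff_mul_le (.inl ha) (.inl ha')]; exact h
    calc x * y ≤ (y * b * a⁻¹) * y := by gcongr
      _ = _ := by ring
  · refine le_add_right ?_
    have : y ≤ x * a * b⁻¹ := by
      rw [← div_eq_mul_inv, ENNReal.le_div_iff_mul_le (.inl hb) (.inl hb')]; exact h
    calc x * y ≤ x * (x * a * b⁻¹) := by gcongr
      _ = _ := by ring

/-- Schur's test for a symmetric nonnegative kernel. -/
theorem lintegral_schur_le {μ : Measure X} [SFinite μ] {h a : X → ℝ≥0∞} (hh : AEMeasurable h μ)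
    (ha : Measurable a) (ha0 : ∀ᵐ p ∂μ, a p ≠ 0) (ha1 : ∀ p, a p ≠ ∞) {k : X → X → ℝ≥0∞}
    (hk : Measurable (uncurry k)) (hks : ∀ p q, k p q = k q p) {B : ℝ≥0∞}
    (hB : ∀ p, ∫⁻ q, k p q * (a q)⁻¹ ∂μ ≤ B) :
    ∫⁻ q, h q.1 * h q.2 * k q.1 q.2 ∂(μ.prod μ) ≤ 2 * B * ∫⁻ p, h p ^ 2 * a p ∂μ := by
  have m1 : AEMeasurable (fun q : X × X => h q.1 ^ 2 * a q.1 * (k q.1 q.2 * (a q.2)⁻¹)) (μ.prod μ) :=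
    ((hh.comp_fst.pow_const 2).mul (by fun_prop)).mul (hk.aemeasurable.mul (by fun_prop))
  have m2 : AEMeasurable (fun q : X × X => h q.2 ^ 2 * a q.2 * (k q.2 q.1 * (a q.1)⁻¹)) (μ.prod μ) :=
    ((hh.comp_snd.pow_const 2).mul (by fun_prop)).mul
      ((hk.comp measurable_swap).aemeasurable.mul (by fun_prop))
  have hle : ∫⁻ q, h q.1 * h q.2 * k q.1 q.2 ∂(μ.prod μ) ≤
      ∫⁻ q, (h q.1 ^ 2 * a q.1 * (k q.1 q.2 * (a q.2)⁻¹) +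
        h q.2 ^ 2 * a q.2 * (k q.2 q.1 * (a q.1)⁻¹)) ∂(μ.prod μ) := by
    have f1 : ∀ᵐ q ∂(μ.prod μ), a q.1 ≠ 0 := Measure.quasiMeasurePreserving_fst.ae ha0
    have f2 : ∀ᵐ q ∂(μ.prod μ), a q.2 ≠ 0 := Measure.quasiMeasurePreserving_snd.ae ha0
    refine lintegral_mono_ae ?_
    filter_upwards [f1, f2] with q h1 h2
    calc _ ≤ (h q.1 ^ 2 * a q.1 * (a q.2)⁻¹ + h q.2 ^ 2 * a q.2 * (a q.1)⁻¹) * k q.1 q.2 := by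
          gcongr; exact ENNReal_mul_le_weighted _ _ h1 (ha1 _) h2 (ha1 _)
      _ = _ := by rw [hks q.2 q.1]; ring
  have hone : ∫⁻ p, ∫⁻ q, h p ^ 2 * a p * (k p q * (a q)⁻¹) ∂μ ∂μ ≤ B * ∫⁻ p, h p ^ 2 * a p ∂μ := by
    calc _ ≤ ∫⁻ p, h p ^ 2 * a p * B ∂μ := by
          refine lintegral_mono fun p => ?_
          simp only
          rw [lintegral_const_mul (f := fun q => k p q * (a q)⁻¹) _ (hk.of_uncurry_left.mul ha.inv)]
          gcongr
          exact hB p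
      _ = _ := by
          rw [lintegral_mul_const'' (f := fun p => h p ^ 2 * a p) _ ((hh.pow_const 2).mul ha.aemeasurable), mul_comm]
  refine hle.trans ?_
  rw [lintegral_add_left' m1, lintegral_prod _ m1, lintegral_prod_symm _ m2, two_mul, add_mul]
  exact add_le_add hone hone

end Weighted

section Gaussian

/-- The Fourier transform of the Gaussian `exp (-b ‖v‖²)`. -/
def gaussK (V : Type*) [NormedAddCommGroup V] [InnerProductSpace ℝ V] (b : ℝ) (w : V) : ℝ :=
  (π / b) ^ (Module.finrank ℝ V / 2 : ℝ) * Real.exp (-(π ^ 2 / b) * ‖w‖ ^ 2)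

variable {V : Type*} [NormedAddCommGroup V] [InnerProductSpace ℝ V]

theorem continuous_gaussK (b : ℝ) : Continuous (gaussK V b) := by
  unfold gaussK; fun_prop

theorem gaussK_nonneg {b : ℝ} (hb : 0 < b) (w : V) : 0 ≤ gaussK V b w := by
  unfold gaussK; positivity

theorem gaussK_neg (b : ℝ) (w : V) : gaussK V b (-w) = gaussK V b w := by
  unfold gaussK; rw [norm_neg]

variable [FiniteDimensional ℝ V] [MeasurableSpace V] [BorelSpace V]

theorem integrable_gaussian {b : ℝ} (hb : 0 < b) : Integrable fun v : V => Real.exp (-b * ‖v‖ ^ 2) := by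
  have h := (GaussianFourier.integrable_cexp_neg_mul_sq_norm_add (b := b) (by simpa using hb) 0
    (0 : V)).re
  refine h.congr (.of_forall fun v => ?_)
  simp only [zero_mul, add_zero]
  have : (-(b : ℂ) * (‖v‖ : ℂ) ^ 2) = ((-b * ‖v‖ ^ 2 : ℝ) : ℂ) := by push_cast; ring
  rw [this]
  exact Complex.exp_ofReal_re _

theorem integral_gaussian_mul_cexp {b : ℝ} (hb : 0 < b) (w : V) :
    ∫ v : V, ((Real.exp (-b * ‖v‖ ^ 2) : ℝ) : ℂ) * Complex.exp (2 * π * Complex.I * (inner ℝ v w : ℝ))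
      = gaussK V b w := by
  have h := GaussianFourier.integral_cexp_neg_mul_sq_norm_add (V := V) (b := b) (by simpa using hb)
    (2 * π * Complex.I) w
  rw [gaussK]
  push_cast
  rw [Complex.ofReal_cpow (by positivity)]
  convert h using 2
  · ext v; rw [real_inner_comm, Complex.exp_add]
  · push_cast; rfl
  · congr 1
    rw [mul_pow, mul_pow, Complex.I_sq]
    have : (b : ℂ) ≠ 0 := Complex.ofReal_ne_zero.2 hb.ne'
    field_simp; ring

theorem lintegral_gaussK {b : ℝ} (hb : 0 < b) : ∫⁻ w : V, ENNReal.ofReal (gaussK V b w) = 1 := by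
  have hb' : 0 < π ^ 2 / b := by positivity
  rw [← ofReal_integral_eq_lintegral_ofReal (f := gaussK V b)
    ((integrable_gaussian hb').const_mul _) (.of_forall (gaussK_nonneg hb))]
  simp only [gaussK]
  rw [integral_const_mul, GaussianFourier.integral_rexp_neg_mul_sq_norm hb',
    ← Real.mul_rpow (by positivity) (by positivity)]
  have : π / b * (π / (π ^ 2 / b)) = 1 := by field_simp
  rw [this, Real.one_rpow, ENNReal.ofReal_one]

end Gaussian

/-- The half wave propagator applied to the function with Fourier transform `f`. -/
def halfWave (f : E3 → ℂ) (t : ℝ) (x : E3) : ℂ :=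
  ∫ ξ, Complex.exp (2 * π * Complex.I * (inner ℝ x ξ + t * ‖ξ‖ : ℝ)) * f ξ

theorem norm_cexp_two_pi_I_mul (s : ℝ) : ‖Complex.exp (2 * π * Complex.I * (s : ℝ))‖ = 1 := by
  have : (2 * π * Complex.I * (s : ℝ) : ℂ) = ((2 * π * s : ℝ) : ℂ) * Complex.I := by
    push_cast; ring
  rw [this, Complex.norm_exp_ofReal_mul_I]

theorem conj_cexp_two_pi_I_mul (s : ℝ) : starRingEnd ℂ (Complex.exp (2 * π * Complex.I * (s : ℝ))) =
    Complex.exp (2 * π * Complex.I * (-s : ℝ)) := by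
  rw [← Complex.exp_conj]
  have : (2 * π * Complex.I * (s : ℝ) : ℂ) = ((2 * π * s : ℝ) : ℂ) * Complex.I := by
    push_cast; ring
  rw [this, map_mul, Complex.conj_ofReal, Complex.conj_I]
  push_cast; ring_nf

theorem continuous_halfWave {f : E3 → ℂ} (hf : Integrable f) : Continuous (uncurry (halfWave f)) := by
  unfold halfWave uncurry
  refine continuous_of_dominated (bound := fun ξ => ‖f ξ‖) (fun w => ?_) (fun w => ?_) hf.norm
    (.of_forall fun ξ => by fun_prop)
  · exact (Continuous.aestronglyMeasurable (by fun_prop)).mul hf.1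
  · refine .of_forall fun ξ => ?_
    rw [norm_mul, norm_cexp_two_pi_I_mul, one_mul]

theorem enorm_halfWave_le (f : E3 → ℂ) (t : ℝ) (x : E3) : ‖halfWave f t x‖ₑ ≤ ∫⁻ ξ, ‖f ξ‖ₑ := by
  refine (enorm_integral_le_lintegral_enorm _).trans (lintegral_mono fun ξ => ?_)
  rw [enorm_mul, ← ofReal_norm, norm_cexp_two_pi_I_mul, ENNReal.ofReal_one, one_mul]

private theorem gaussian_phase {b : ℝ} (hb : 0 < b) (s : ℝ) (ζ : E3) :
    ∫ w : ℝ × E3, ((Real.exp (-b * ‖w.1‖ ^ 2) * Real.exp (-b * ‖w.2‖ ^ 2) : ℝ) : ℂ) *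
      Complex.exp (2 * π * Complex.I * (inner ℝ w.2 ζ + w.1 * s : ℝ)) =
    ((gaussK ℝ b s * gaussK E3 b ζ : ℝ) : ℂ) := by
  push_cast
  rw [← integral_gaussian_mul_cexp hb s, ← integral_gaussian_mul_cexp hb ζ,
    ← integral_prod_mul, Measure.volume_eq_prod]
  congr 1; ext w
  have : inner ℝ w.1 s = w.1 * s := by simp [mul_comm]
  rw [this, mul_add, Complex.exp_add]
  push_cast
  ring

private theorem kernel_bound {b : ℝ} (hb : 0 < b) (s : ℝ) (v : E3) :
    ∫⁻ q : E3 × E3, ENNReal.ofReal (gaussK ℝ b (s - (‖q.1‖ + ‖q.2‖))) *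
      ENNReal.ofReal (gaussK E3 b (v - (q.1 + q.2))) *
        (ENNReal.ofReal ‖q.1‖ * ENNReal.ofReal ‖q.2‖)⁻¹ ≤ ENNReal.ofReal (sphM.real univ / 2) := by
  have cR := (continuous_gaussK (V := ℝ) b).measurable
  have cE := (continuous_gaussK (V := E3) b).measurable
  rw [Measure.volume_eq_prod, lintegral_prod _ (by fun_prop)]
  have hinv (x y : E3) : (ENNReal.ofReal ‖x‖ * ENNReal.ofReal ‖y‖)⁻¹ =
      (ENNReal.ofReal ‖x‖)⁻¹ * (ENNReal.ofReal ‖y‖)⁻¹ :=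
    ENNReal.mul_inv (.inr ENNReal.ofReal_ne_top) (.inl ENNReal.ofReal_ne_top)
  have h1 (x : E3) : ∫⁻ y : E3, ENNReal.ofReal (gaussK ℝ b (s - (‖x‖ + ‖y‖))) *
      ENNReal.ofReal (gaussK E3 b (v - (x + y))) * (ENNReal.ofReal ‖x‖ * ENNReal.ofReal ‖y‖)⁻¹ =
      ∫⁻ ζ : E3, ENNReal.ofReal (gaussK E3 b (v - ζ)) *
        (ENNReal.ofReal (gaussK ℝ b (s - ‖x‖ - ‖ζ - x‖)) *
        ((ENNReal.ofReal ‖x‖)⁻¹ * (ENNReal.ofReal ‖ζ - x‖)⁻¹)) := by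
    rw [← lintegral_add_left_eq_self (fun ζ : E3 => ENNReal.ofReal (gaussK E3 b (v - ζ)) *
        (ENNReal.ofReal (gaussK ℝ b (s - ‖x‖ - ‖ζ - x‖)) *
        ((ENNReal.ofReal ‖x‖)⁻¹ * (ENNReal.ofReal ‖ζ - x‖)⁻¹))) x]
    congr 1; ext y
    rw [hinv, add_sub_cancel_left, sub_sub]
    ring
  simp only [h1]
  rw [lintegral_lintegral_swap (by fun_prop)]
  have h2 : ∫⁻ ζ : E3, ENNReal.ofReal (gaussK E3 b (v - ζ)) = 1 := by
    rw [lintegral_sub_left_eq_self (fun ζ => ENNReal.ofReal (gaussK E3 b ζ)), lintegral_gaussK hb]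
  calc _ ≤ ∫⁻ ζ : E3, ENNReal.ofReal (gaussK E3 b (v - ζ)) *
        ENNReal.ofReal (sphM.real univ / 2) := by
        refine lintegral_mono_ae ?_
        have : ∀ᵐ ζ : E3, ζ ≠ 0 := by simp [ae_iff]
        filter_upwards [this] with ζ hζ
        rw [lintegral_const_mul' _ _ ENNReal.ofReal_ne_top]
        gcongr
        refine (lintegral_cone_kernel_le (G := fun a => ENNReal.ofReal (gaussK ℝ b a))
          (by fun_prop) s hζ).trans ?_
        rw [lintegral_gaussK hb, mul_one]
    _ = _ := by rw [lintegral_mul_const' _ _ ENNReal.ofReal_ne_top, h2, one_mul]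

theorem lintegral_gaussian_mul_halfWave_le {f : E3 → ℂ} (hf : Integrable f) {b : ℝ} (hb : 0 < b) :
    ∫⁻ w : ℝ × E3, ENNReal.ofReal (Real.exp (-b * ‖w.1‖ ^ 2) * Real.exp (-b * ‖w.2‖ ^ 2)) *
      ‖halfWave f w.1 w.2‖ₑ ^ 4 ≤
    2 * ENNReal.ofReal (sphM.real univ / 2) * (∫⁻ ξ, ‖f ξ‖ₑ ^ 2 * ENNReal.ofReal ‖ξ‖) ^ 2 := by
  have cR := (continuous_gaussK (V := ℝ) b).measurable
  have cE := (continuous_gaussK (V := E3) b).measurable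
  set θ : E3 × E3 → ℝ × E3 → ℂ := fun p w =>
    Complex.exp (2 * π * Complex.I * (inner ℝ w.2 (p.1 + p.2) + w.1 * (‖p.1‖ + ‖p.2‖) : ℝ)) with hθ
  set h : E3 × E3 → ℂ := fun p => f p.1 * f p.2 with hh
  have hhi : Integrable h := hf.mul_prod hf
  have hsq (w : ℝ × E3) : ‖halfWave f w.1 w.2‖ₑ ^ 4 = ‖∫ p, θ p w * h p‖ₑ ^ 2 := by
    have : ∫ p, θ p w * h p = halfWave f w.1 w.2 * halfWave f w.1 w.2 := by
      rw [halfWave, ← integral_prod_mul, Measure.volume_eq_prod]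
      congr 1; ext p
      simp only [hθ, hh]
      rw [mul_mul_mul_comm, ← Complex.exp_add, inner_add_right]
      congr 2
      push_cast; ring
    rw [this, enorm_mul]; ring
  simp only [hsq]
  have hg : Integrable fun w : ℝ × E3 => Real.exp (-b * ‖w.1‖ ^ 2) * Real.exp (-b * ‖w.2‖ ^ 2) :=
    (integrable_gaussian (V := ℝ) hb).mul_prod (integrable_gaussian (V := E3) hb)
  refine (lintegral_weight_mul_sq_le hhi (θ := θ) ?_ ?_ hg (fun w => by positivity)).trans ?_
  · refine Continuous.measurable ?_
    simp only [hθ, uncurry_def]; fun_prop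
  · exact fun p w => (norm_cexp_two_pi_I_mul _).le
  set k : E3 × E3 → E3 × E3 → ℝ≥0∞ := fun p q =>
    ENNReal.ofReal (gaussK ℝ b ((‖p.1‖ + ‖p.2‖) - (‖q.1‖ + ‖q.2‖))) *
      ENNReal.ofReal (gaussK E3 b ((p.1 + p.2) - (q.1 + q.2))) with hk
  have hker (q : (E3 × E3) × (E3 × E3)) :
      ‖∫ w : ℝ × E3, ((Real.exp (-b * ‖w.1‖ ^ 2) * Real.exp (-b * ‖w.2‖ ^ 2) : ℝ) : ℂ) *
        (θ q.1 w * starRingEnd ℂ (θ q.2 w))‖ₑ = k q.1 q.2 := by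
    have := gaussian_phase hb ((‖q.1.1‖ + ‖q.1.2‖) - (‖q.2.1‖ + ‖q.2.2‖))
      ((q.1.1 + q.1.2) - (q.2.1 + q.2.2))
    rw [hk]
    simp only
    rw [← ENNReal.ofReal_mul (gaussK_nonneg hb _), ← norm_of_nonneg
      (mul_nonneg (gaussK_nonneg hb _) (gaussK_nonneg hb _)), ← Complex.norm_real, ofReal_norm,
      ← this]
    congr 2; ext w
    congr 1
    simp only [hθ]
    rw [conj_cexp_two_pi_I_mul, ← Complex.exp_add, inner_sub_right]
    congr 1
    push_cast; ring
  simp only [hker]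
  refine (lintegral_schur_le (h := fun p => ‖h p‖ₑ) hhi.1.enorm
    (a := fun p : E3 × E3 => ENNReal.ofReal ‖p.1‖ * ENNReal.ofReal ‖p.2‖) (by fun_prop) ?_
    (fun p => ENNReal.mul_ne_top ENNReal.ofReal_ne_top ENNReal.ofReal_ne_top)
    (k := k) (by simp only [hk, uncurry_def]; fun_prop) ?_
    (fun p => kernel_bound hb (‖p.1‖ + ‖p.2‖) (p.1 + p.2))).trans ?_
  · have h0 : ∀ᵐ ζ : E3, ENNReal.ofReal ‖ζ‖ ≠ 0 := by simp [ae_iff]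
    have h1 : ∀ᵐ q : E3 × E3, ENNReal.ofReal ‖q.1‖ ≠ 0 := Measure.quasiMeasurePreserving_fst.ae h0
    have h2 : ∀ᵐ q : E3 × E3, ENNReal.ofReal ‖q.2‖ ≠ 0 := Measure.quasiMeasurePreserving_snd.ae h0
    filter_upwards [h1, h2] with q h1 h2
    exact mul_ne_zero h1 h2
  · intro p q
    simp only [hk]
    rw [← gaussK_neg b ((p.1 + p.2) - (q.1 + q.2)), neg_sub,
      ← gaussK_neg b ((‖p.1‖ + ‖p.2‖) - (‖q.1‖ + ‖q.2‖)), neg_sub]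
  · refine le_of_eq ?_
    congr 1
    have hm : AEMeasurable (fun ξ => ‖f ξ‖ₑ ^ 2 * ENNReal.ofReal ‖ξ‖) :=
      (hf.1.enorm.pow_const 2).mul (by fun_prop)
    rw [sq, ← lintegral_prod_mul hm hm, Measure.volume_eq_prod]
    congr 1; ext p
    simp only [hh, enorm_mul]; ring

/-- The `L⁴` Strichartz estimate for the half wave propagator. -/
theorem lintegral_halfWave_pow_four_le {f : E3 → ℂ} (hf : Integrable f) :
    ∫⁻ w : ℝ × E3, ‖halfWave f w.1 w.2‖ₑ ^ 4 ≤
    2 * ENNReal.ofReal (sphM.real univ / 2) * (∫⁻ ξ, ‖f ξ‖ₑ ^ 2 * ENNReal.ofReal ‖ξ‖) ^ 2 := by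
  have hc := (continuous_halfWave hf).measurable
  have hb (n : ℕ) : 0 < 1 / ((n : ℝ) + 1) := by positivity
  have hlim (w : ℝ × E3) : Filter.Tendsto (fun n : ℕ => ENNReal.ofReal
      (Real.exp (-(1 / ((n : ℝ) + 1)) * ‖w.1‖ ^ 2) * Real.exp (-(1 / ((n : ℝ) + 1)) * ‖w.2‖ ^ 2)) *
      ‖halfWave f w.1 w.2‖ₑ ^ 4) Filter.atTop (nhds (‖halfWave f w.1 w.2‖ₑ ^ 4)) := by
    have h0 : Filter.Tendsto (fun n : ℕ => 1 / ((n : ℝ) + 1)) Filter.atTop (nhds 0) :=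
      tendsto_one_div_add_atTop_nhds_zero_nat
    have h1 : Continuous fun b : ℝ => Real.exp (-b * ‖w.1‖ ^ 2) * Real.exp (-b * ‖w.2‖ ^ 2) := by
      fun_prop
    have h2 := ENNReal.tendsto_ofReal ((h1.tendsto 0).comp h0)
    have h3 := ENNReal.Tendsto.mul_const (b := ‖halfWave f w.1 w.2‖ₑ ^ 4) h2 (.inl (by simp))
    simpa using h3
  calc _ = ∫⁻ w : ℝ × E3, Filter.liminf (fun n : ℕ => ENNReal.ofReal
      (Real.exp (-(1 / ((n : ℝ) + 1)) * ‖w.1‖ ^ 2) * Real.exp (-(1 / ((n : ℝ) + 1)) * ‖w.2‖ ^ 2)) *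
      ‖halfWave f w.1 w.2‖ₑ ^ 4) Filter.atTop := by
        congr 1; ext w; exact (hlim w).liminf_eq.symm
    _ ≤ _ := lintegral_liminf_le fun n => by
        refine Measurable.mul (by fun_prop) (Measurable.pow_const (Measurable.enorm ?_) 4)
        exact hc
    _ ≤ _ := Filter.liminf_le_of_frequently_le'
        (Filter.Frequently.of_forall fun n => lintegral_gaussian_mul_halfWave_le hf (hb n))

section Darboux

open scoped SchwartzMap LineDeriv Laplacian

/-- A real-valued Schwartz function, as a complex-valued `SchwartzMap`. -/
def IsSchwartz.toSchwartzMap {g : E3 → ℝ} (hg : IsSchwartz g) : 𝓢(E3, ℂ) where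
  toFun x := (g x : ℂ)
  smooth' := Complex.ofRealCLM.contDiff.comp hg.1
  decay' k n := by
    obtain ⟨C, hC⟩ := hg.2 k n
    refine ⟨C, fun x => ?_⟩
    have := Complex.ofRealLI.norm_iteratedFDeriv_comp_left (x := x) (n := (⊤ : ℕ∞)) (i := n)
      (hg.1.contDiffAt) (by exact_mod_cast le_top)
    have h2 : (fun x => (g x : ℂ)) = Complex.ofRealLI ∘ g := rfl
    rw [h2, this]
    exact hC x

@[simp]
theorem IsSchwartz.toSchwartzMap_apply {g : E3 → ℝ} (hg : IsSchwartz g) (x : E3) :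
    hg.toSchwartzMap x = (g x : ℂ) := rfl

theorem IsSchwartz.laplacian_toSchwartzMap {g : E3 → ℝ} (hg : IsSchwartz g) (x : E3) :
    (Δ hg.toSchwartzMap) x = (lap g x : ℂ) := by
  rw [SchwartzMap.laplacian_apply, InnerProductSpace.laplacian_eq_iteratedFDeriv_orthonormalBasis
    _ (EuclideanSpace.basisFun (Fin 3) ℝ), lap]
  have h : ((hg.toSchwartzMap : 𝓢(E3, ℂ)) : E3 → ℂ) = Complex.ofRealCLM ∘ g := rfl
  rw [h]
  beta_reduce
  rw [Complex.ofRealCLM.iteratedFDeriv_comp_left (hg.1.contDiffAt)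
    (n := (⊤ : ℕ∞)) (i := 2) (WithTop.coe_le_coe.2 le_top)]
  push_cast
  refine Finset.sum_congr rfl fun i _ => ?_
  simp [EuclideanSpace.basisFun_apply]

theorem SchwartzMap.fourier_laplacian_apply (φ : 𝓢(E3, ℂ)) (ξ : E3) :
    𝓕 (Δ φ) ξ = -(4 * π ^ 2 * ‖ξ‖ ^ 2 : ℝ) * 𝓕 φ ξ := by
  rw [SchwartzMap.laplacian_eq_fourierMultiplierCLM, SchwartzMap.fourierMultiplierCLM_apply]
  have h : (fun x : E3 => ‖x‖ ^ 2).HasTemperateGrowth := hasTemperateGrowth_norm_sq E3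
  have : ∀ (a : ℝ) (ψ : 𝓢(E3, ℂ)), 𝓕 (a • ψ) = a • 𝓕 ψ := fun a ψ => by
    simp [FourierTransform.fourier_smul]
  rw [this, FourierTransform.fourier_fourierInv_eq]
  simp [SchwartzMap.smulLeftCLM_apply_apply h]
  ring

theorem SchwartzMap.eq_integral_fourier (φ : 𝓢(E3, ℂ)) (x : E3) :
    φ x = ∫ ξ, 𝓕 φ ξ * Complex.exp (2 * π * Complex.I * (inner ℝ x ξ : ℝ)) := by
  have h : φ = 𝓕⁻ (𝓕 φ) := (FourierTransform.fourierInv_fourier_eq φ).symm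
  conv_lhs => rw [h, SchwartzMap.fourierInv_coe, Real.fourierInv_eq']
  refine integral_congr_ae (.of_forall fun ξ => ?_)
  simp only [smul_eq_mul]
  rw [mul_comm, real_inner_comm]
  push_cast
  ring_nf

/-- The mean over the unit sphere of `φ (x + r ω)`, up to normalization. -/
def sphMean (φ : E3 → ℂ) (r : ℝ) (x : E3) : ℂ := ∫ ω, φ (x + r • ω) ∂sphM

theorem sphMean_eq (φ : 𝓢(E3, ℂ)) (r : ℝ) (x : E3) : sphMean φ r x =
    sphM.real univ * ∫ ξ, 𝓕 φ ξ * Complex.exp (2 * π * Complex.I * (inner ℝ x ξ : ℝ)) *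
      (sinc (2 * π * r * ‖ξ‖) : ℝ) := by
  have hφ : Integrable (fun ξ => 𝓕 φ ξ) := (𝓕 φ).integrable
  have h1 : ∀ ω, φ (x + r • ω) = ∫ ξ, 𝓕 φ ξ *
      Complex.exp (2 * π * Complex.I * (inner ℝ (x + r • ω) ξ : ℝ)) := fun ω =>
    φ.eq_integral_fourier _
  simp_rw [sphMean, h1]
  rw [integral_integral_swap]
  · rw [← integral_const_mul]
    refine integral_congr_ae (.of_forall fun ξ => ?_)
    have h2 := isSphereInvariant_sphM.charFun_eq ((2 * π * r) • ξ)
    rw [charFun_apply] at h2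
    have h3 : ∀ ω : E3, 𝓕 φ ξ * Complex.exp (2 * π * Complex.I * (inner ℝ (x + r • ω) ξ : ℝ)) =
        𝓕 φ ξ * Complex.exp (2 * π * Complex.I * (inner ℝ x ξ : ℝ)) *
          Complex.exp ((inner ℝ ω ((2 * π * r) • ξ) : ℝ) * Complex.I) := fun ω => by
      rw [mul_assoc (𝓕 φ ξ), ← Complex.exp_add]
      congr 2
      simp only [inner_add_left, inner_smul_left, inner_smul_right]
      push_cast
      simp
      ring
    simp only [h3]
    rw [integral_const_mul, h2, norm_smul, Real.norm_eq_abs]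
    have h4 : sinc (|2 * π * r| * ‖ξ‖) = sinc (2 * π * r * ‖ξ‖) := by
      rcases abs_choice (2 * π * r) with h | h <;> simp [h]
    rw [h4]
    ring
  · have h5 : Integrable (fun p : E3 × E3 => 𝓕 φ p.2) (sphM.prod volume) := hφ.comp_snd sphM
    refine h5.norm.mono' ?_ (.of_forall fun p => ?_)
    · exact Continuous.aestronglyMeasurable (by
        have := (𝓕 φ).continuous
        simp only [uncurry_def]
        fun_prop)
    · simp only [uncurry_def, norm_mul]
      have := norm_cexp_two_pi_I_mul (inner ℝ (x + r • p.1) p.2)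
      rw [this, mul_one]

theorem hasDerivAt_mul_sinc (z r : ℝ) :
    HasDerivAt (fun r => r * sinc (2 * π * r * z)) (cos (2 * π * r * z)) r := by
  rcases eq_or_ne z 0 with rfl | hz
  · simpa using hasDerivAt_id' r
  have h1 : (fun r => r * sinc (2 * π * r * z)) = fun r => (2 * π * z)⁻¹ * sin (2 * π * z * r) := by
    ext r
    rcases eq_or_ne r 0 with rfl | hr
    · simp
    have hp := pi_ne_zero
    rw [sinc_of_ne_zero (by positivity)]
    field_simp
  rw [h1]
  have hp := pi_ne_zero
  refine (((hasDerivAt_id r).const_mul (2 * π * z)).sin.const_mul (2 * π * z)⁻¹).congr_deriv ?_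
  simp only [id]
  field_simp

theorem hasDerivAt_cos_mul (z r : ℝ) :
    HasDerivAt (fun r => cos (2 * π * r * z)) (-(4 * π ^ 2 * z ^ 2) * (r * sinc (2 * π * r * z))) r := by
  refine (((hasDerivAt_id r).const_mul (2 * π)).mul_const z).cos.congr_deriv ?_
  simp only [id]
  rcases eq_or_ne (2 * π * r * z) 0 with h | h
  · rcases mul_eq_zero.1 h with h' | rfl
    · rcases mul_eq_zero.1 h' with h'' | rfl
      · exact absurd h'' (by positivity)
      · simp
    · simp
  · rw [sinc_of_ne_zero h]
    have h1 : r ≠ 0 := by rintro rfl; simp at h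
    have h2 : z ≠ 0 := by rintro rfl; simp at h
    have hp := pi_ne_zero
    field_simp
    ring

/-- The `r`-derivative of `r * sphMean φ r x`. -/
def cosMean (φ : 𝓢(E3, ℂ)) (r : ℝ) (x : E3) : ℂ :=
  sphM.real univ * ∫ ξ, 𝓕 φ ξ * Complex.exp (2 * π * Complex.I * (inner ℝ x ξ : ℝ)) *
    (cos (2 * π * r * ‖ξ‖) : ℝ)

private theorem integrable_fourier_norm (φ : 𝓢(E3, ℂ)) :
    Integrable (fun ξ => ‖ξ‖ * ‖(𝓕 φ : 𝓢(E3, ℂ)) ξ‖) := by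
  simpa only [pow_one] using (𝓕 φ : 𝓢(E3, ℂ)).integrable_pow_mul volume 1

private theorem continuous_sinc_aux (r : ℝ) : Continuous fun ξ : E3 => sinc (2 * π * r * ‖ξ‖) :=
  continuous_sinc.comp (by fun_prop)

theorem hasDerivAt_mul_sphMean (φ : 𝓢(E3, ℂ)) (r : ℝ) (x : E3) :
    HasDerivAt (fun r : ℝ => (r : ℂ) * sphMean φ r x) (cosMean φ r x) r := by
  have h0 : (fun r : ℝ => (r : ℂ) * sphMean φ r x) = fun r : ℝ => (sphM.real univ : ℂ) *
      ∫ ξ, 𝓕 φ ξ * Complex.exp (2 * π * Complex.I * (inner ℝ x ξ : ℝ)) *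
      (r * sinc (2 * π * r * ‖ξ‖) : ℝ) := by
    ext r
    rw [sphMean_eq, mul_left_comm, ← integral_const_mul]
    congr 2 with ξ
    push_cast; ring
  rw [h0, cosMean]
  refine HasDerivAt.const_mul _ ?_
  have hc := (𝓕 φ).continuous
  refine (hasDerivAt_integral_of_dominated_loc_of_deriv_le (bound := fun ξ => ‖𝓕 φ ξ‖)
    (F := fun (r : ℝ) ξ => 𝓕 φ ξ * Complex.exp (2 * π * Complex.I * (inner ℝ x ξ : ℝ)) *
      (r * sinc (2 * π * r * ‖ξ‖) : ℝ))
    (F' := fun (r : ℝ) ξ => 𝓕 φ ξ * Complex.exp (2 * π * Complex.I * (inner ℝ x ξ : ℝ)) *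
      (cos (2 * π * r * ‖ξ‖) : ℝ)) Filter.univ_mem (.of_forall fun s => ?_) ?_ ?_ (.of_forall
      fun ξ s _ => ?_) (𝓕 φ).integrable.norm
      (.of_forall fun ξ s _ => (hasDerivAt_mul_sinc ‖ξ‖ s).ofReal_comp.const_mul _)).2
  · have := continuous_sinc_aux s
    exact Continuous.aestronglyMeasurable (by fun_prop)
  · have := continuous_sinc_aux r
    refine ((𝓕 φ).integrable.norm.mul_const |r|).mono'
      (Continuous.aestronglyMeasurable (by fun_prop)) (.of_forall fun ξ => ?_)
    rw [norm_mul, norm_mul, norm_cexp_two_pi_I_mul, mul_one, Complex.norm_real, norm_mul]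
    gcongr
    rw [Real.norm_eq_abs, Real.norm_eq_abs]
    exact mul_le_of_le_one_right (abs_nonneg _) (abs_sinc_le_one _)
  · exact Continuous.aestronglyMeasurable (by fun_prop)
  · rw [norm_mul, norm_mul, norm_cexp_two_pi_I_mul, mul_one, Complex.norm_real]
    exact mul_le_of_le_one_right (norm_nonneg _) (abs_cos_le_one _)

theorem hasDerivAt_cosMean (φ : 𝓢(E3, ℂ)) (r : ℝ) (x : E3) :
    HasDerivAt (fun r : ℝ => cosMean φ r x) (r * sphMean (Δ φ : 𝓢(E3, ℂ)) r x) r := by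
  rw [sphMean_eq, mul_left_comm, ← integral_const_mul]
  refine HasDerivAt.const_mul _ ?_
  have hc := (𝓕 φ).continuous
  refine ((hasDerivAt_integral_of_dominated_loc_of_deriv_le
    (bound := fun ξ => 2 * π * (‖ξ‖ * ‖𝓕 φ ξ‖))
    (F := fun (r : ℝ) ξ => 𝓕 φ ξ * Complex.exp (2 * π * Complex.I * (inner ℝ x ξ : ℝ)) *
      (cos (2 * π * r * ‖ξ‖) : ℝ))
    (F' := fun (r : ℝ) ξ => 𝓕 φ ξ * Complex.exp (2 * π * Complex.I * (inner ℝ x ξ : ℝ)) *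
      (-(4 * π ^ 2 * ‖ξ‖ ^ 2) * (r * sinc (2 * π * r * ‖ξ‖)) : ℝ)) Filter.univ_mem
      (.of_forall fun s => ?_) ?_ ?_ (.of_forall
      fun ξ s _ => ?_) ((integrable_fourier_norm φ).const_mul _)
      (.of_forall fun ξ s _ => (hasDerivAt_cos_mul ‖ξ‖ s).ofReal_comp.const_mul _)).2).congr_deriv ?_
  · exact Continuous.aestronglyMeasurable (by fun_prop)
  · refine ((𝓕 φ).integrable.norm).mono'
      (Continuous.aestronglyMeasurable (by fun_prop)) (.of_forall fun ξ => ?_)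
    rw [norm_mul, norm_mul, norm_cexp_two_pi_I_mul, mul_one, Complex.norm_real]
    exact mul_le_of_le_one_right (norm_nonneg _) (abs_cos_le_one _)
  · have := continuous_sinc_aux r
    exact Continuous.aestronglyMeasurable (by fun_prop)
  · rw [norm_mul, norm_mul, norm_cexp_two_pi_I_mul, mul_one, Complex.norm_real]
    have h1 : -(4 * π ^ 2 * ‖ξ‖ ^ 2) * (s * sinc (2 * π * s * ‖ξ‖)) =
        -(2 * π * ‖ξ‖ * sin (2 * π * s * ‖ξ‖)) := by
      have h2 := (hasDerivAt_cos_mul ‖ξ‖ s).unique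
        (((hasDerivAt_id s).const_mul (2 * π)).mul_const ‖ξ‖).cos
      rw [h2]; simp only [id]; ring
    rw [h1, norm_neg, norm_mul, Real.norm_of_nonneg (by positivity : 0 ≤ 2 * π * ‖ξ‖)]
    have := abs_sin_le_one (2 * π * s * ‖ξ‖)
    calc ‖𝓕 φ ξ‖ * (2 * π * ‖ξ‖ * ‖sin (2 * π * s * ‖ξ‖)‖)
        ≤ ‖𝓕 φ ξ‖ * (2 * π * ‖ξ‖ * 1) := by gcongr; exact this
      _ = _ := by ring
  · refine integral_congr_ae (.of_forall fun ξ => ?_)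
    simp only [SchwartzMap.fourier_laplacian_apply]
    push_cast; ring

/-- The components of the free wave with Cauchy data `φ, ψ`. -/
def waveProfile (σ : ℝ) (φ ψ : 𝓢(E3, ℂ)) (ξ : E3) : ℂ :=
  2⁻¹ * 𝓕 φ ξ + σ * (4 * π * Complex.I * ‖ξ‖)⁻¹ * 𝓕 ψ ξ

theorem cosMean_add_mul_sphMean {φ ψ : 𝓢(E3, ℂ)} (hp : Integrable (waveProfile 1 φ ψ))
    (hm : Integrable (waveProfile (-1) φ ψ)) (r : ℝ) (x : E3) :
    cosMean φ r x + r * sphMean ψ r x = sphM.real univ *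
      (halfWave (waveProfile 1 φ ψ) r x + halfWave (waveProfile (-1) φ ψ) (-r) x) := by
  have hφ : Integrable (𝓕 φ : 𝓢(E3, ℂ)) := (𝓕 φ : 𝓢(E3, ℂ)).integrable
  have hψ : Integrable (𝓕 ψ : 𝓢(E3, ℂ)) := (𝓕 ψ : 𝓢(E3, ℂ)).integrable
  have hcφ := (𝓕 φ : 𝓢(E3, ℂ)).continuous
  have hcψ := (𝓕 ψ : 𝓢(E3, ℂ)).continuous
  have key {f : E3 → ℂ} (hf : Integrable f) (s : ℝ) :
      Integrable fun ξ => Complex.exp (2 * π * Complex.I * (inner ℝ x ξ + s * ‖ξ‖ : ℝ)) * f ξ := by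
    refine hf.norm.mono' (Continuous.aestronglyMeasurable (by fun_prop) |>.mul
      hf.aestronglyMeasurable) (.of_forall fun ξ => ?_)
    rw [norm_mul, norm_cexp_two_pi_I_mul, one_mul]
  rw [sphMean_eq, cosMean, mul_left_comm, ← mul_add, halfWave, halfWave,
    ← integral_add (key hp _) (key hm _), ← integral_const_mul, ← integral_add]
  · congr 1
    have h0 : ∀ᵐ ξ : E3, ξ ≠ 0 := by simp [ae_iff]
    refine integral_congr_ae (h0.mono fun ξ hξ => ?_)
    have hξ' : (‖ξ‖ : ℂ) ≠ 0 := by simpa using hξ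
    have hπ : (π : ℂ) ≠ 0 := by exact_mod_cast pi_ne_zero
    have h1 : Complex.exp (2 * π * Complex.I * (inner ℝ x ξ + r * ‖ξ‖ : ℝ)) =
        Complex.exp (2 * π * Complex.I * (inner ℝ x ξ : ℝ)) *
          (Complex.cos (2 * π * r * ‖ξ‖) + Complex.sin (2 * π * r * ‖ξ‖) * Complex.I) := by
      rw [← Complex.exp_mul_I, ← Complex.exp_add]
      push_cast; ring_nf
    have h2 : Complex.exp (2 * π * Complex.I * (inner ℝ x ξ + (-r) * ‖ξ‖ : ℝ)) =
        Complex.exp (2 * π * Complex.I * (inner ℝ x ξ : ℝ)) *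
          (Complex.cos (2 * π * r * ‖ξ‖) - Complex.sin (2 * π * r * ‖ξ‖) * Complex.I) := by
      have := Complex.exp_mul_I (-(2 * π * r * ‖ξ‖))
      rw [Complex.cos_neg, Complex.sin_neg, neg_mul (Complex.sin _), ← sub_eq_add_neg] at this
      rw [← this, ← Complex.exp_add]
      push_cast; ring_nf
    have h3 : (r : ℂ) * (sinc (2 * π * r * ‖ξ‖) : ℝ) =
        (2 * π * ‖ξ‖)⁻¹ * Complex.sin (2 * π * r * ‖ξ‖) := by
      rcases eq_or_ne r 0 with rfl | hr
      · simp
      have : (r : ℂ) ≠ 0 := by exact_mod_cast hr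
      have hn : ‖ξ‖ ≠ 0 := by simpa using hξ
      have := pi_ne_zero
      rw [sinc_of_ne_zero (by positivity)]
      push_cast
      field_simp
    simp only [h1, h2, waveProfile]
    rw [mul_left_comm, h3]
    push_cast
    have hI := Complex.I_ne_zero
    field_simp
    ring
  · refine hφ.norm.mono' (Continuous.aestronglyMeasurable (by fun_prop)) (.of_forall fun ξ => ?_)
    rw [norm_mul, norm_mul, norm_cexp_two_pi_I_mul, mul_one, Complex.norm_real]
    exact mul_le_of_le_one_right (norm_nonneg _) (abs_cos_le_one _)
  · refine Integrable.const_mul (hψ.norm.mono' ?_ (.of_forall fun ξ => ?_)) _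
    · have := continuous_sinc_aux r
      exact Continuous.aestronglyMeasurable (by fun_prop)
    · rw [norm_mul, norm_mul, norm_cexp_two_pi_I_mul, mul_one, Complex.norm_real]
      exact mul_le_of_le_one_right (norm_nonneg _) (abs_sinc_le_one _)

end Darboux

theorem IsNLW.contDiff {u : ℝ → E3 → ℝ} (hu : IsNLW u) : ContDiff ℝ (⊤ : ℕ∞) (uncurry u) := by
  have := hu.1
  rwa [univ_prod_univ, contDiffOn_univ] at this

section Cone

variable {U : ℝ × E3 → ℝ}

private theorem integrable_sphM {f : E3 → ℝ} (hf : Continuous f) : Integrable f sphM :=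
  integrable_of_continuous_of_compact (isCompact_sphere 0 1)
    isSphereInvariant_sphM.mem_sphere hf

private theorem hasDerivAt_integral_sphM {F F' : ℝ → E3 → ℝ}
    (hF : Continuous (uncurry F)) (hF' : Continuous (uncurry F'))
    (h : ∀ τ ω, HasDerivAt (fun s => F s ω) (F' τ ω) τ) (τ : ℝ) :
    HasDerivAt (fun s => ∫ ω, F s ω ∂sphM) (∫ ω, F' τ ω ∂sphM) τ :=
  hasDerivAt_integral_of_compact (isCompact_sphere 0 1)
    isSphereInvariant_sphM.mem_sphere hF hF' h τ

theorem ContDiff.continuous_fderiv_top (hU : ContDiff ℝ (⊤ : ℕ∞) U) : Continuous (fderiv ℝ U) :=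
  hU.continuous_fderiv (by simp)

theorem ContDiff.contDiff_fderiv_top (hU : ContDiff ℝ (⊤ : ℕ∞) U) :
    ContDiff ℝ (⊤ : ℕ∞) (fderiv ℝ U) :=
  hU.fderiv_right (by simp)

theorem ContDiff.continuous_fderiv_fderiv_top (hU : ContDiff ℝ (⊤ : ℕ∞) U) :
    Continuous (fderiv ℝ (fderiv ℝ U)) :=
  hU.contDiff_fderiv_top.continuous_fderiv (by simp)

theorem ContDiff.hasDerivAt_comp_curve (hU : ContDiff ℝ (⊤ : ℕ∞) U) {γ : ℝ → ℝ × E3}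
    {γ' : ℝ × E3} {s : ℝ} (hγ : HasDerivAt γ γ' s) :
    HasDerivAt (fun s => U (γ s)) (fderiv ℝ U (γ s) γ') s :=
  ((hU.differentiable (by simp)).differentiableAt.hasFDerivAt).comp_hasDerivAt s hγ

theorem ContDiff.hasDerivAt_fderiv_comp_curve (hU : ContDiff ℝ (⊤ : ℕ∞) U) {γ : ℝ → ℝ × E3}
    {γ' : ℝ × E3} {s : ℝ} (hγ : HasDerivAt γ γ' s) (v : ℝ × E3) :
    HasDerivAt (fun s => fderiv ℝ U (γ s) v) (fderiv ℝ (fderiv ℝ U) (γ s) γ' v) s := by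
  have h := ((hU.contDiff_fderiv_top.differentiable (by simp)).differentiableAt
    (x := γ s)).hasFDerivAt.comp_hasDerivAt s hγ
  exact (((ContinuousLinearMap.apply ℝ ℝ v).hasFDerivAt).comp_hasDerivAt s h)

private theorem hasDerivAt_sphere_curve (τ : ℝ) (x ω : E3) (r : ℝ) :
    HasDerivAt (fun r : ℝ => (τ, x + r • ω)) (0, ω) r := by
  have := (hasDerivAt_const r τ).prodMk (((hasDerivAt_id r).smul_const ω).const_add x)
  simpa using this

private theorem hasDerivAt_cone_curve (t : ℝ) (x ω : E3) (τ : ℝ) :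
    HasDerivAt (fun τ : ℝ => (τ, x + (t - τ) • ω)) (1, -ω) τ := by
  have := (hasDerivAt_id τ).prodMk ((((hasDerivAt_id τ).const_sub t).smul_const ω).const_add x)
  simpa using this

theorem hasDerivAt_integral_sphere (hU : ContDiff ℝ (⊤ : ℕ∞) U) (τ : ℝ) (x : E3) (r : ℝ) :
    HasDerivAt (fun r => ∫ ω, r * U (τ, x + r • ω) ∂sphM)
      (∫ ω, (U (τ, x + r • ω) + r * fderiv ℝ U (τ, x + r • ω) (0, ω)) ∂sphM) r := by
  have h0 := hU.continuous
  have h1 := hU.continuous_fderiv_top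
  refine hasDerivAt_integral_sphM (F := fun r ω => r * U (τ, x + r • ω))
    (F' := fun r ω => U (τ, x + r • ω) + r * fderiv ℝ U (τ, x + r • ω) (0, ω)) ?_ ?_
    (fun r ω => ?_) r
  · simp only [uncurry_def]; fun_prop
  · simp only [uncurry_def]; fun_prop
  · refine ((hasDerivAt_id r).mul
      (hU.hasDerivAt_comp_curve (hasDerivAt_sphere_curve τ x ω r))).congr_deriv ?_
    simp

theorem hasDerivAt_integral_sphere' (hU : ContDiff ℝ (⊤ : ℕ∞) U) (τ : ℝ) (x : E3) (r : ℝ) :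
    HasDerivAt (fun r => ∫ ω, (U (τ, x + r • ω) + r * fderiv ℝ U (τ, x + r • ω) (0, ω)) ∂sphM)
      (∫ ω, (2 * fderiv ℝ U (τ, x + r • ω) (0, ω) +
        r * fderiv ℝ (fderiv ℝ U) (τ, x + r • ω) (0, ω) (0, ω)) ∂sphM) r := by
  have h0 := hU.continuous
  have h1 := hU.continuous_fderiv_top
  have h2 := hU.continuous_fderiv_fderiv_top
  refine hasDerivAt_integral_sphM
    (F := fun r ω => U (τ, x + r • ω) + r * fderiv ℝ U (τ, x + r • ω) (0, ω))
    (F' := fun r ω => 2 * fderiv ℝ U (τ, x + r • ω) (0, ω) +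
        r * fderiv ℝ (fderiv ℝ U) (τ, x + r • ω) (0, ω) (0, ω)) ?_ ?_
    (fun r ω => ?_) r
  · simp only [uncurry_def]; fun_prop
  · simp only [uncurry_def]; fun_prop
  · have hγ := hasDerivAt_sphere_curve τ x ω r
    refine ((hU.hasDerivAt_comp_curve hγ).add ((hasDerivAt_id r).mul
      (hU.hasDerivAt_fderiv_comp_curve hγ (0, ω)))).congr_deriv ?_
    simp
    ring

/-- The integral over the sphere of radius `t - τ` about `x` of the flux in Kirchhoff's formula. -/
def coneFlux (U : ℝ × E3 → ℝ) (t : ℝ) (x : E3) (τ : ℝ) : ℝ :=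
  ∫ ω, ((t - τ) * fderiv ℝ U (τ, x + (t - τ) • ω) (1, 0) + (U (τ, x + (t - τ) • ω) +
    (t - τ) * fderiv ℝ U (τ, x + (t - τ) • ω) (0, ω))) ∂sphM

theorem hasDerivAt_coneFlux (hU : ContDiff ℝ (⊤ : ℕ∞) U) (t : ℝ) (x : E3) (τ : ℝ) :
    HasDerivAt (coneFlux U t x)
      (∫ ω, ((t - τ) * fderiv ℝ (fderiv ℝ U) (τ, x + (t - τ) • ω) (1, 0) (1, 0) -
        (2 * fderiv ℝ U (τ, x + (t - τ) • ω) (0, ω) +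
        (t - τ) * fderiv ℝ (fderiv ℝ U) (τ, x + (t - τ) • ω) (0, ω) (0, ω))) ∂sphM) τ := by
  have h0 := hU.continuous
  have h1 := hU.continuous_fderiv_top
  have h2 := hU.continuous_fderiv_fderiv_top
  refine hasDerivAt_integral_sphM
    (F := fun τ ω => (t - τ) * fderiv ℝ U (τ, x + (t - τ) • ω) (1, 0) +
      (U (τ, x + (t - τ) • ω) + (t - τ) * fderiv ℝ U (τ, x + (t - τ) • ω) (0, ω)))
    (F' := fun τ ω => (t - τ) * fderiv ℝ (fderiv ℝ U) (τ, x + (t - τ) • ω) (1, 0) (1, 0) -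
        (2 * fderiv ℝ U (τ, x + (t - τ) • ω) (0, ω) +
        (t - τ) * fderiv ℝ (fderiv ℝ U) (τ, x + (t - τ) • ω) (0, ω) (0, ω))) ?_ ?_
    (fun τ ω => ?_) τ
  · simp only [uncurry_def]; fun_prop
  · simp only [uncurry_def]; fun_prop
  · have hγ := hasDerivAt_cone_curve t x ω τ
    have hr := (hasDerivAt_id τ).const_sub t
    refine ((hr.mul (hU.hasDerivAt_fderiv_comp_curve hγ (1, 0))).add
      ((hU.hasDerivAt_comp_curve hγ).add (hr.mul
      (hU.hasDerivAt_fderiv_comp_curve hγ (0, ω))))).congr_deriv ?_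
    have hs : IsSymmSndFDerivAt ℝ U (τ, x + (t - τ) • ω) :=
      hU.contDiffAt.isSymmSndFDerivAt (by simpa using WithTop.coe_le_coe.2 (le_top (a := (2 : ℕ∞))))
    have e1 : ((1 : ℝ), -ω) = (1, 0) - (0, ω) := by simp
    have e2 := hs.eq (0, ω) (1, 0)
    simp only [e1, map_sub, sub_apply, id]
    rw [e2]
    ring

end Cone

section NLW

variable {u : ℝ → E3 → ℝ}

theorem IsNLW.tderiv_eq (hu : IsNLW u) (s : ℝ) (x : E3) :
    tderiv u s x = fderiv ℝ (uncurry u) (s, x) (1, 0) :=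
  (hu.contDiff.hasDerivAt_comp_curve ((hasDerivAt_id s).prodMk (hasDerivAt_const s x))).deriv

theorem IsNLW.tderiv2_eq (hu : IsNLW u) (s : ℝ) (x : E3) :
    tderiv2 u s x = fderiv ℝ (fderiv ℝ (uncurry u)) (s, x) (1, 0) (1, 0) := by
  simp_rw [tderiv2, hu.tderiv_eq]
  exact (hu.contDiff.hasDerivAt_fderiv_comp_curve
    ((hasDerivAt_id s).prodMk (hasDerivAt_const s x)) (1, 0)).deriv

theorem IsNLW.isSchwartz (hu : IsNLW u) (s : ℝ) : IsSchwartz (u s) := (hu.2.1 s trivial).1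

theorem IsNLW.isSchwartz_tderiv (hu : IsNLW u) (s : ℝ) : IsSchwartz (tderiv u s) :=
  (hu.2.1 s trivial).2

private theorem mul_sphMean_eq {g : E3 → ℝ} (hg : IsSchwartz g) (x : E3) (r : ℝ) :
    (r : ℂ) * sphMean hg.toSchwartzMap r x = ((∫ ω, r * g (x + r • ω) ∂sphM : ℝ) : ℂ) := by
  rw [integral_const_mul, sphMean]
  simp only [IsSchwartz.toSchwartzMap_apply]
  rw [integral_complex_ofReal]
  push_cast; rfl

theorem IsNLW.cosMean_eq (hu : IsNLW u) (τ : ℝ) (x : E3) (r : ℝ) :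
    cosMean (hu.isSchwartz τ).toSchwartzMap r x =
      ((∫ ω, (u τ (x + r • ω) + r * fderiv ℝ (uncurry u) (τ, x + r • ω) (0, ω)) ∂sphM : ℝ) : ℂ) := by
  have h1 := hasDerivAt_mul_sphMean (hu.isSchwartz τ).toSchwartzMap r x
  have h2 := (hasDerivAt_integral_sphere hu.contDiff τ x r).ofReal_comp
  simp only [mul_sphMean_eq] at h1
  exact h1.unique h2

theorem IsNLW.integral_lap_eq (hu : IsNLW u) (τ : ℝ) (x : E3) (r : ℝ) :
    ∫ ω, (2 * fderiv ℝ (uncurry u) (τ, x + r • ω) (0, ω) +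
        r * fderiv ℝ (fderiv ℝ (uncurry u)) (τ, x + r • ω) (0, ω) (0, ω)) ∂sphM =
      ∫ ω, r * lap (u τ) (x + r • ω) ∂sphM := by
  have h1 := hasDerivAt_cosMean (hu.isSchwartz τ).toSchwartzMap r x
  have h2 := (hasDerivAt_integral_sphere' hu.contDiff τ x r).ofReal_comp
  simp only [hu.cosMean_eq] at h1
  have h3 := h2.unique h1
  rw [sphMean] at h3
  simp only [IsSchwartz.laplacian_toSchwartzMap] at h3
  rw [integral_complex_ofReal] at h3
  rw [integral_const_mul]
  exact_mod_cast h3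

theorem IsNLW.continuous_lap (hu : IsNLW u) (τ : ℝ) : Continuous (lap (u τ)) := by
  have h : ∀ x, lap (u τ) x = fderiv ℝ (fderiv ℝ (uncurry u)) (τ, x) (1, 0) (1, 0) + u τ x ^ 5 :=
    fun x => by
      have := hu.2.2 τ trivial x
      rw [hu.tderiv2_eq] at this
      linarith
  have h0 := hu.contDiff.continuous
  have h2 := hu.contDiff.continuous_fderiv_fderiv_top
  rw [show lap (u τ) = _ from funext h]
  exact (by fun_prop : Continuous fun x => fderiv ℝ (fderiv ℝ (uncurry u)) (τ, x) (1, 0) (1, 0)).add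
    ((h0.comp (by fun_prop : Continuous fun x : E3 => (τ, x))).pow 5)

theorem IsNLW.hasDerivAt_coneFlux (hu : IsNLW u) (t : ℝ) (x : E3) (τ : ℝ) :
    HasDerivAt (coneFlux (uncurry u) t x)
      (-((t - τ) * ∫ ω, u τ (x + (t - τ) • ω) ^ 5 ∂sphM)) τ := by
  have h0 := hu.contDiff.continuous
  have h1 := hu.contDiff.continuous_fderiv_top
  have h2 := hu.contDiff.continuous_fderiv_fderiv_top
  have h3 := hu.continuous_lap τ
  refine (_root_.hasDerivAt_coneFlux hu.contDiff t x τ).congr_deriv ?_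
  rw [integral_sub (integrable_sphM (by fun_prop)) (integrable_sphM (by fun_prop)),
    hu.integral_lap_eq, ← integral_sub (integrable_sphM (by fun_prop))
    (integrable_sphM (by fun_prop)), ← integral_const_mul, ← integral_neg]
  refine integral_congr_ae (.of_forall fun ω => ?_)
  have := hu.2.2 τ trivial (x + (t - τ) • ω)
  rw [hu.tderiv2_eq] at this
  dsimp only
  linear_combination (t - τ) * this

theorem IsNLW.coneFlux_eq (hu : IsNLW u) (t : ℝ) (x : E3) (τ : ℝ) :
    (coneFlux (uncurry u) t x τ : ℂ) = cosMean (hu.isSchwartz τ).toSchwartzMap (t - τ) x +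
      ((t - τ : ℝ) : ℂ) * sphMean (hu.isSchwartz_tderiv τ).toSchwartzMap (t - τ) x := by
  have h0 := hu.contDiff.continuous
  have h1 := hu.contDiff.continuous_fderiv_top
  rw [mul_sphMean_eq, hu.cosMean_eq, ← Complex.ofReal_add, coneFlux, add_comm,
    ← integral_add]
  · simp_rw [hu.tderiv_eq]
    congr 2
  · simp_rw [hu.tderiv_eq]
    exact integrable_sphM (by fun_prop)
  · have h4 : Continuous fun ω : E3 => u τ (x + (t - τ) • ω) :=
      h0.comp (by fun_prop : Continuous fun ω : E3 => (τ, x + (t - τ) • ω))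
    exact integrable_sphM (h4.add (by fun_prop))

/-- The flux of `u ^ 5` through the sphere of radius `t - τ`. -/
theorem continuous_cone_integral {U : ℝ × E3 → ℝ} (hU : ContDiff ℝ (⊤ : ℕ∞) U) (t : ℝ) (x : E3) :
    Continuous fun τ => ∫ ω, U (τ, x + (t - τ) • ω) ∂sphM := by
  have h0 := hU.continuous
  have h1 := hU.continuous_fderiv_top
  refine continuous_iff_continuousAt.2 fun τ =>
    (hasDerivAt_integral_sphM (F := fun τ ω => U (τ, x + (t - τ) • ω))
    (F' := fun τ ω => fderiv ℝ U (τ, x + (t - τ) • ω) (1, -ω)) ?_ ?_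
    (fun τ ω => hU.hasDerivAt_comp_curve (hasDerivAt_cone_curve t x ω τ)) τ).continuousAt
  · simp only [uncurry_def]; fun_prop
  · simp only [uncurry_def]; fun_prop

theorem IsNLW.continuous_cone_integral_pow (hu : IsNLW u) (n : ℕ) (t : ℝ) (x : E3) :
    Continuous fun τ => ∫ ω, u τ (x + (t - τ) • ω) ^ n ∂sphM :=
  continuous_cone_integral (hu.contDiff.pow n) t x

theorem duh_eq_integral (u : ℝ → E3 → ℝ) {κ : ℝ}
    (hκ : ∀ (x : E3) (r : ℝ) (f : E3 → ℝ), 0 < r →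
    sphInt x r f = κ * r ^ 2 * ∫ ω, f (x + r • ω) ∂sphM) {s₁ s₂ t : ℝ} (hs : s₁ ≤ s₂) (ht : s₂ < t)
    (x : E3) : duh u s₁ s₂ t x =
      κ / (4 * π) * ∫ τ in s₁..s₂, (t - τ) * ∫ ω, u τ (x + (t - τ) • ω) ^ 5 ∂sphM := by
  rw [duh, ← intervalIntegral.integral_const_mul]
  refine intervalIntegral.integral_congr fun τ hτ => ?_
  rw [uIcc_of_le hs] at hτ
  have hr : 0 < t - τ := by linarith [hτ.2]
  have := pi_pos
  rw [hκ x _ _ hr]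
  field_simp

theorem IsNLW.duh_eq_coneFlux (hu : IsNLW u) {κ : ℝ}
    (hκ : ∀ (x : E3) (r : ℝ) (f : E3 → ℝ), 0 < r →
    sphInt x r f = κ * r ^ 2 * ∫ ω, f (x + r • ω) ∂sphM) {s₁ s₂ t : ℝ} (hs : s₁ ≤ s₂) (ht : s₂ < t)
    (x : E3) : duh u s₁ s₂ t x =
      κ / (4 * π) * (coneFlux (uncurry u) t x s₁ - coneFlux (uncurry u) t x s₂) := by
  rw [duh_eq_integral u hκ hs ht]
  congr 1
  have h := intervalIntegral.integral_eq_sub_of_hasDerivAt (a := s₁) (b := s₂)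
    (fun τ _ => hu.hasDerivAt_coneFlux t x τ) (Continuous.intervalIntegrable
      (((continuous_const.sub continuous_id).mul (hu.continuous_cone_integral_pow 5 t x)).neg) _ _)
  rw [intervalIntegral.integral_neg] at h
  linarith

end NLW

section EnergyFlux

/-- The energy density. -/
def energyDensity (U : ℝ × E3 → ℝ) (p : ℝ × E3) : ℝ :=
  1 / 2 * fderiv ℝ U p (1, 0) ^ 2 +
    1 / 2 * ∑ i : Fin 3, fderiv ℝ U p (0, EuclideanSpace.single i 1) ^ 2 + 1 / 6 * U p ^ 6

/-- The time derivative of the energy density. -/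
def energyDensityDeriv (U : ℝ × E3 → ℝ) (p : ℝ × E3) : ℝ :=
  fderiv ℝ U p (1, 0) * fderiv ℝ (fderiv ℝ U) p (1, 0) (1, 0) +
    ∑ i : Fin 3, fderiv ℝ U p (0, EuclideanSpace.single i 1) *
      fderiv ℝ (fderiv ℝ U) p (1, 0) (0, EuclideanSpace.single i 1) +
    U p ^ 5 * fderiv ℝ U p (1, 0)

variable {U : ℝ × E3 → ℝ}

theorem continuous_energyDensity (hU : ContDiff ℝ (⊤ : ℕ∞) U) : Continuous (energyDensity U) := by
  have h0 := hU.continuous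
  have h1 := hU.continuous_fderiv_top
  unfold energyDensity
  fun_prop

theorem continuous_energyDensityDeriv (hU : ContDiff ℝ (⊤ : ℕ∞) U) :
    Continuous (energyDensityDeriv U) := by
  have h0 := hU.continuous
  have h1 := hU.continuous_fderiv_top
  have h2 := hU.continuous_fderiv_fderiv_top
  unfold energyDensityDeriv
  fun_prop

theorem energyDensity_nonneg (U : ℝ × E3 → ℝ) (p : ℝ × E3) : 0 ≤ energyDensity U p := by
  unfold energyDensity
  have := Finset.sum_nonneg fun (i : Fin 3) (_ : i ∈ Finset.univ) =>
    sq_nonneg (fderiv ℝ U p (0, EuclideanSpace.single i 1))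
  positivity

theorem hasDerivAt_energyDensity (hU : ContDiff ℝ (⊤ : ℕ∞) U) (y : E3) (τ : ℝ) :
    HasDerivAt (fun τ => energyDensity U (τ, y)) (energyDensityDeriv U (τ, y)) τ := by
  have hγ : HasDerivAt (fun τ : ℝ => (τ, y)) (1, 0) τ :=
    (hasDerivAt_id τ).prodMk (hasDerivAt_const τ y)
  refine ((((hU.hasDerivAt_fderiv_comp_curve hγ (1, 0)).pow 2).const_mul (1 / 2)).add
    ((HasDerivAt.fun_sum fun (i : Fin 3) (_ : i ∈ Finset.univ) =>
      (hU.hasDerivAt_fderiv_comp_curve hγ (0, EuclideanSpace.single i 1)).pow 2).const_mul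
        (1 / 2))).add
    (((hU.hasDerivAt_comp_curve hγ).pow 6).const_mul (1 / 6)) |>.congr_deriv ?_
  simp only [energyDensityDeriv, Finset.mul_sum]
  congr 1
  · congr 1
    · push_cast; ring
    · refine Finset.sum_congr rfl fun i _ => ?_
      push_cast; ring
  · push_cast; ring

theorem hasFDerivAt_slice (hU : ContDiff ℝ (⊤ : ℕ∞) U) (τ : ℝ) (y : E3) :
    HasFDerivAt (fun y => U (τ, y)) ((fderiv ℝ U (τ, y)).comp (.inr ℝ ℝ E3)) y :=
  ((hU.differentiable (by simp)).differentiableAt.hasFDerivAt).comp y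
    (hasFDerivAt_prodMk_right τ y)

theorem hasFDerivAt_fderiv_slice (hU : ContDiff ℝ (⊤ : ℕ∞) U) (τ : ℝ) (y : E3) (v : ℝ × E3) :
    HasFDerivAt (fun y => fderiv ℝ U (τ, y) v)
      ((ContinuousLinearMap.apply ℝ ℝ v).comp
        ((fderiv ℝ (fderiv ℝ U) (τ, y)).comp (.inr ℝ ℝ E3))) y :=
  ((ContinuousLinearMap.apply ℝ ℝ v).hasFDerivAt).comp y
    ((hU.contDiff_fderiv_top.differentiable (by simp)).differentiableAt.hasFDerivAt.comp y
    (hasFDerivAt_prodMk_right τ y))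

private theorem integrable_mul_of_zero {χ w : E3 → ℝ} (hχ : Continuous χ) {x : E3} {b : ℝ}
    (h0 : ∀ y, y ∉ Metric.closedBall x b → χ y = 0) (hw : Continuous w) :
    Integrable fun y => χ y * w y :=
  (hχ.mul hw).integrable_of_hasCompactSupport
    (HasCompactSupport.intro (isCompact_closedBall x b) fun y hy => by simp [h0 y hy])

theorem integral_mul_fderiv_slice {χ σ w : E3 → ℝ}
    (hχ : Differentiable ℝ χ) (hσ : Continuous σ) {x : E3} {b : ℝ}
    (h0 : ∀ y, y ∉ Metric.closedBall x b → χ y = 0)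
    (h1 : ∀ y, y ∉ Metric.closedBall x b → σ y = 0)
    (h : ∀ y, ‖fderiv ℝ χ y‖ ≤ σ y) (hw : ContDiff ℝ 1 w) (v : E3) :
    Integrable (fun y => fderiv ℝ χ y v * w y) ∧
    ∫ y, χ y * fderiv ℝ w y v = -∫ y, fderiv ℝ χ y v * w y := by
  have hw1 : Continuous fun y => fderiv ℝ w y v :=
    (hw.continuous_fderiv (by simp)).clm_apply continuous_const
  have hi : Integrable (fun y => fderiv ℝ χ y v * w y) := by
    refine (integrable_mul_of_zero hσ h1 (w := fun y => ‖v‖ * ‖w y‖)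
      (continuous_const.mul hw.continuous.norm)).mono'
      ((measurable_fderiv_apply_const ℝ χ v).aestronglyMeasurable.mul
        hw.continuous.aestronglyMeasurable) (.of_forall fun y => ?_)
    rw [norm_mul]
    calc ‖fderiv ℝ χ y v‖ * ‖w y‖ ≤ (‖fderiv ℝ χ y‖ * ‖v‖) * ‖w y‖ := by
          gcongr; exact (fderiv ℝ χ y).le_opNorm v
      _ ≤ (σ y * ‖v‖) * ‖w y‖ := by gcongr; exact h y
      _ = _ := by ring
  exact ⟨hi, integral_mul_fderiv_eq_neg_fderiv_mul_of_integrable hi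
    (integrable_mul_of_zero hχ.continuous h0 hw1)
    (integrable_mul_of_zero hχ.continuous h0 hw.continuous) (fun y _ => hχ y)
    (fun y _ => hw.differentiable (by simp) y)⟩

variable {u : ℝ → E3 → ℝ}

theorem IsNLW.fderiv_eq (hu : IsNLW u) (τ : ℝ) (y v : E3) :
    fderiv ℝ (u τ) y v = fderiv ℝ (uncurry u) (τ, y) (0, v) := by
  have := (hasFDerivAt_slice hu.contDiff τ y).fderiv
  change fderiv ℝ (u τ) y = _ at this
  rw [this]; simp

theorem IsNLW.lap_eq (hu : IsNLW u) (τ : ℝ) (y : E3) :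
    lap (u τ) y = ∑ i : Fin 3, fderiv ℝ (fderiv ℝ (uncurry u)) (τ, y)
      (0, EuclideanSpace.single i 1) (0, EuclideanSpace.single i 1) := by
  refine Finset.sum_congr rfl fun i _ => ?_
  set e : E3 := EuclideanSpace.single i 1
  rw [iteratedFDeriv_two_apply]
  simp only [Matrix.cons_val_zero, Matrix.cons_val_one]
  have h1 : (fun y => fderiv ℝ (u τ) y e) = fun y => fderiv ℝ (uncurry u) (τ, y) (0, e) :=
    funext fun y => hu.fderiv_eq τ y e
  have h2 := (hasFDerivAt_fderiv_slice hu.contDiff τ y (0, e)).fderiv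
  have h3 : DifferentiableAt ℝ (fderiv ℝ (u τ)) y :=
    ((hu.isSchwartz τ).1.fderiv_right (m := (⊤ : ℕ∞)) (by simp)).differentiable (by simp) y
  have h4 := (((ContinuousLinearMap.apply ℝ ℝ e).hasFDerivAt).comp y h3.hasFDerivAt).fderiv
  have h5 : (ContinuousLinearMap.apply ℝ ℝ e) ∘ (fderiv ℝ (u τ)) =
      fun y => fderiv ℝ (u τ) y e := rfl
  rw [h5, h1, h2] at h4
  have := DFunLike.congr_fun h4 e
  simpa using this.symm

theorem IsNLW.energyDensityDeriv_eq (hu : IsNLW u) (τ : ℝ) (y : E3) :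
    energyDensityDeriv (uncurry u) (τ, y) = ∑ i : Fin 3,
      fderiv ℝ (fun y => fderiv ℝ (uncurry u) (τ, y) (1, 0) *
        fderiv ℝ (uncurry u) (τ, y) (0, EuclideanSpace.single i 1)) y
          (EuclideanSpace.single i 1) := by
  have h0 := hu.2.2 τ trivial y
  rw [hu.tderiv2_eq, hu.lap_eq] at h0
  have h1 (i : Fin 3) := ((hasFDerivAt_fderiv_slice hu.contDiff τ y (1, 0)).mul
    (hasFDerivAt_fderiv_slice hu.contDiff τ y (0, EuclideanSpace.single i 1))).fderiv
  have hs : IsSymmSndFDerivAt ℝ (uncurry u) (τ, y) :=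
    hu.contDiff.contDiffAt.isSymmSndFDerivAt
      (by simpa using WithTop.coe_le_coe.2 (le_top (a := (2 : ℕ∞))))
  have h2 (i : Fin 3) := hs.eq (0, EuclideanSpace.single i 1) (1, 0)
  have h3 (i : Fin 3) := DFunLike.congr_fun (h1 i) (EuclideanSpace.single i 1)
  simp only [Pi.mul_def] at h3
  simp only [h3]
  simp only [add_apply, smul_apply, ContinuousLinearMap.comp_apply, ContinuousLinearMap.inr_apply,
    ContinuousLinearMap.apply_apply, h2, smul_eq_mul, energyDensityDeriv]
  rw [Finset.sum_add_distrib, ← Finset.mul_sum]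
  simp only [uncurry_apply_pair]
  linear_combination (fderiv ℝ (uncurry u) (τ, y) (1, 0)) * h0

theorem IsNLW.integral_energyDensityDeriv_le (hu : IsNLW u) (τ : ℝ) {χ σ : E3 → ℝ}
    (hχ : Differentiable ℝ χ) (hσ : Continuous σ) {x : E3} {b : ℝ}
    (h0 : ∀ y, y ∉ Metric.closedBall x b → χ y = 0)
    (h1 : ∀ y, y ∉ Metric.closedBall x b → σ y = 0)
    (h : ∀ y, ‖fderiv ℝ χ y‖ ≤ σ y) :
    ∫ y, χ y * energyDensityDeriv (uncurry u) (τ, y) ≤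
      ∫ y, σ y * (energyDensity (uncurry u) (τ, y) - 1 / 6 * u τ y ^ 6) := by
  set DU := fderiv ℝ (uncurry u) with hDU
  set e : Fin 3 → E3 := fun i => EuclideanSpace.single i 1 with he
  have hUd : Continuous DU := hu.contDiff.continuous_fderiv_top
  have hw (i : Fin 3) : ContDiff ℝ 1 fun y => DU (τ, y) (1, 0) * DU (τ, y) (0, e i) := by
    have hD : ContDiff ℝ 1 fun y => DU (τ, y) :=
      (hu.contDiff.contDiff_fderiv_top.of_le (by exact_mod_cast le_top)).comp (by fun_prop)
    exact (hD.clm_apply contDiff_const).mul (hD.clm_apply contDiff_const)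
  have hk (i : Fin 3) := integral_mul_fderiv_slice hχ hσ h0 h1 h (hw i) (e i)
  have hi (i : Fin 3) : Integrable fun y => χ y *
      fderiv ℝ (fun y => DU (τ, y) (1, 0) * DU (τ, y) (0, e i)) y (e i) :=
    integrable_mul_of_zero hχ.continuous h0
      (((hw i).continuous_fderiv (by simp)).clm_apply continuous_const)
  have hn (i : Fin 3) : Integrable fun y =>
      -(fderiv ℝ χ y (e i) * (DU (τ, y) (1, 0) * DU (τ, y) (0, e i))) := (hk i).1.neg
  have e1 : ∫ y, χ y * energyDensityDeriv (uncurry u) (τ, y) =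
      ∫ y, ∑ i, -(fderiv ℝ χ y (e i) * (DU (τ, y) (1, 0) * DU (τ, y) (0, e i))) := by
    rw [integral_finsetSum _ fun i _ => hn i]
    simp_rw [hu.energyDensityDeriv_eq, Finset.mul_sum]
    rw [integral_finsetSum _ fun i _ => hi i]
    refine Finset.sum_congr rfl fun i _ => ?_
    rw [integral_neg]
    exact (hk i).2
  rw [e1]
  have hcd : Continuous fun y => energyDensity (uncurry u) (τ, y) - 1 / 6 * u τ y ^ 6 := by
    refine ((continuous_energyDensity hu.contDiff).comp (by fun_prop)).sub
      (continuous_const.mul ((hu.contDiff.continuous.comp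
      (by fun_prop : Continuous fun y : E3 => (τ, y))).pow 6))
  refine integral_mono (integrable_finsetSum _ fun i _ => hn i)
    (integrable_mul_of_zero hσ h1 hcd) fun y => ?_
  dsimp only
  have hσ0 : 0 ≤ σ y := (norm_nonneg _).trans (h y)
  set V : E3 := ∑ i, DU (τ, y) (0, e i) • e i with hV
  have hVn : ‖V‖ ^ 2 = ∑ i, DU (τ, y) (0, e i) ^ 2 := by
    rw [EuclideanSpace.norm_sq_eq]
    refine Finset.sum_congr rfl fun i _ => ?_
    rw [Real.norm_eq_abs, sq_abs]
    congr 1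
    simp [hV, he, Finset.sum_apply, Pi.single_apply]
  have e2 : ∑ i, -(fderiv ℝ χ y (e i) * (DU (τ, y) (1, 0) * DU (τ, y) (0, e i))) =
      -(DU (τ, y) (1, 0) * fderiv ℝ χ y V) := by
    rw [hV, map_sum, Finset.mul_sum, ← Finset.sum_neg_distrib]
    refine Finset.sum_congr rfl fun i _ => ?_
    rw [map_smul, smul_eq_mul]; ring
  have e3 : energyDensity (uncurry u) (τ, y) - 1 / 6 * u τ y ^ 6 =
      1 / 2 * DU (τ, y) (1, 0) ^ 2 + 1 / 2 * ‖V‖ ^ 2 := by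
    rw [hVn, energyDensity]; simp [hDU, he]
  rw [e2, e3]
  calc -(DU (τ, y) (1, 0) * fderiv ℝ χ y V) ≤ |DU (τ, y) (1, 0) * fderiv ℝ χ y V| :=
        neg_le_abs _
    _ = |DU (τ, y) (1, 0)| * ‖fderiv ℝ χ y V‖ := by rw [abs_mul]; rfl
    _ ≤ |DU (τ, y) (1, 0)| * (‖fderiv ℝ χ y‖ * ‖V‖) := by
        gcongr; exact (fderiv ℝ χ y).le_opNorm V
    _ ≤ |DU (τ, y) (1, 0)| * (σ y * ‖V‖) := by gcongr; exact h y
    _ = σ y * (|DU (τ, y) (1, 0)| * ‖V‖) := by ring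
    _ ≤ _ := by
        gcongr
        have := two_mul_le_add_sq |DU (τ, y) (1, 0)| ‖V‖
        rw [sq_abs] at this
        linarith

end EnergyFlux

section Energy

open scoped SchwartzMap LineDeriv

theorem IsSchwartz.integrable_pow {g : E3 → ℝ} (hg : IsSchwartz g) {n : ℕ} (hn : n ≠ 0) :
    Integrable fun x => g x ^ n := by
  have h := (hg.toSchwartzMap.memLp (n : ℝ≥0∞) volume).integrable_norm_pow hn
  refine h.mono' (hg.1.continuous.pow n).aestronglyMeasurable (.of_forall fun x => ?_)
  simp

theorem IsSchwartz.fderiv_apply {g : E3 → ℝ} (hg : IsSchwartz g) (v : E3) :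
    IsSchwartz fun x => fderiv ℝ g x v := by
  let φ : 𝓢(E3, ℝ) := ⟨g, hg.1, hg.2⟩
  have h : ((∂_{v} φ : 𝓢(E3, ℝ)) : E3 → ℝ) = fun x => fderiv ℝ g x v :=
    funext fun x => SchwartzMap.lineDerivOp_apply_eq_fderiv v φ x
  rw [← h]
  exact ⟨(∂_{v} φ).smooth', (∂_{v} φ).decay'⟩

theorem norm_gradient_sq (f : E3 → ℝ) (x : E3) :
    ‖gradient f x‖ ^ 2 = ∑ i : Fin 3, fderiv ℝ f x (EuclideanSpace.single i 1) ^ 2 := by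
  rw [EuclideanSpace.norm_sq_eq]
  refine Finset.sum_congr rfl fun i _ => ?_
  rw [Real.norm_eq_abs, sq_abs]
  congr 1
  have h : inner ℝ (gradient f x) (EuclideanSpace.single i 1) =
      fderiv ℝ f x (EuclideanSpace.single i 1) := by
    rw [gradient, InnerProductSpace.toDual_symm_apply]
  rw [← h, EuclideanSpace.inner_single_right]
  simp

variable {u : ℝ → E3 → ℝ}

theorem IsNLW.energyDensity_eq (hu : IsNLW u) (τ : ℝ) (y : E3) :
    energyDensity (uncurry u) (τ, y) = 1 / 2 * tderiv u τ y ^ 2 +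
      1 / 2 * ∑ i : Fin 3, fderiv ℝ (u τ) y (EuclideanSpace.single i 1) ^ 2 +
      1 / 6 * u τ y ^ 6 := by
  simp only [energyDensity, hu.tderiv_eq, hu.fderiv_eq, uncurry_apply_pair]

theorem IsNLW.energy_eq (hu : IsNLW u) (τ : ℝ) :
    energy u τ = ∫ y, energyDensity (uncurry u) (τ, y) := by
  simp only [energy, hu.energyDensity_eq, norm_gradient_sq]

theorem IsNLW.integrable_energyDensity (hu : IsNLW u) (τ : ℝ) :
    Integrable fun y => energyDensity (uncurry u) (τ, y) := by
  simp only [hu.energyDensity_eq]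
  refine ((((hu.isSchwartz_tderiv τ).integrable_pow two_ne_zero).const_mul _).add
    ((integrable_finsetSum _ fun i _ =>
      (((hu.isSchwartz τ).fderiv_apply _).integrable_pow two_ne_zero)).const_mul _)).add
    (((hu.isSchwartz τ).integrable_pow (by norm_num)).const_mul _)

theorem IsNLW.integral_tderiv_sq_le (hu : IsNLW u) (τ : ℝ) :
    ∫ y, tderiv u τ y ^ 2 ≤ 2 * energy u τ := by
  rw [hu.energy_eq, ← integral_const_mul]
  refine integral_mono ((hu.isSchwartz_tderiv τ).integrable_pow two_ne_zero)
    ((hu.integrable_energyDensity τ).const_mul 2) fun y => ?_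
  dsimp only
  rw [hu.energyDensity_eq]
  have := Finset.sum_nonneg fun (i : Fin 3) (_ : i ∈ Finset.univ) =>
    sq_nonneg (fderiv ℝ (u τ) y (EuclideanSpace.single i 1))
  have : 0 ≤ u τ y ^ 6 := by positivity
  linarith

theorem IsNLW.sum_integral_fderiv_sq_le (hu : IsNLW u) (τ : ℝ) :
    ∑ i : Fin 3, ∫ y, fderiv ℝ (u τ) y (EuclideanSpace.single i 1) ^ 2 ≤ 2 * energy u τ := by
  have hi (i : Fin 3) : Integrable fun y => fderiv ℝ (u τ) y (EuclideanSpace.single i 1) ^ 2 :=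
    ((hu.isSchwartz τ).fderiv_apply _).integrable_pow two_ne_zero
  rw [hu.energy_eq, ← integral_const_mul, ← integral_finsetSum _ fun i _ => hi i]
  refine integral_mono (integrable_finsetSum _ fun i _ => hi i)
    ((hu.integrable_energyDensity τ).const_mul 2) fun y => ?_
  dsimp only
  rw [hu.energyDensity_eq]
  have : 0 ≤ u τ y ^ 6 := by positivity
  have := sq_nonneg (tderiv u τ y)
  linarith

end Energy

section Flux

theorem exists_smooth_cutoff (t : ℝ) {δ : ℝ} (hδ : 0 < δ) :
    ∃ ρ R : ℝ → ℝ, Continuous ρ ∧ (∀ a, 0 ≤ ρ a) ∧ ∫⁻ a, ENNReal.ofReal (ρ a) = 1 ∧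
      (∀ a, δ ≤ |a - t| → ρ a = 0) ∧ (∀ a, HasDerivAt R (-ρ a) a) ∧ (∀ a, 0 ≤ R a) ∧
      (∀ a, R a ≤ 1) ∧ (∀ a, t + δ ≤ a → R a = 0) ∧ (∀ a, a ≤ t - δ → R a = 1) := by
  let f : ContDiffBump t := ⟨δ / 2, δ, by linarith, by linarith⟩
  set ρ : ℝ → ℝ := f.normed volume with hρ
  have hc : Continuous ρ := f.continuous_normed
  have h0 (a : ℝ) : 0 ≤ ρ a := f.nonneg_normed a
  have hi : ∫ a, ρ a = 1 := f.integral_normed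
  have hfint : Integrable ρ := f.integrable_normed
  have hs (a : ℝ) (ha : δ ≤ |a - t|) : ρ a = 0 := by
    have : a ∉ support ρ := by
      rw [hρ, f.support_normed_eq]
      simpa [Real.dist_eq] using ha
    simpa using this
  have hR1 (a : ℝ) (ha : a ≤ t - δ) : ∫ r in a..(t + δ), ρ r = 1 := by
    rw [intervalIntegral.integral_of_le (by linarith), ← hi]
    refine setIntegral_eq_integral_of_forall_compl_eq_zero fun r hr => hs r ?_
    by_contra hcon
    rw [not_le, abs_lt] at hcon
    exact hr ⟨by linarith, by linarith⟩
  have hR0 (a : ℝ) (ha : t + δ ≤ a) : ∫ r in a..(t + δ), ρ r = 0 := by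
    rw [intervalIntegral.integral_zero_ae]
    refine .of_forall fun r hr => hs r ?_
    rw [uIoc_of_ge ha] at hr
    exact le_trans (by linarith [hr.1]) (le_abs_self _)
  have hd (a : ℝ) : HasDerivAt (fun a => ∫ r in a..(t + δ), ρ r) (-ρ a) a :=
    intervalIntegral.integral_hasDerivAt_left (hc.intervalIntegrable _ _)
      (hc.stronglyMeasurableAtFilter _ _) hc.continuousAt
  have hanti : Antitone fun a => ∫ r in a..(t + δ), ρ r :=
    antitone_of_deriv_nonpos (fun a => (hd a).differentiableAt)
      fun a => by rw [(hd a).deriv]; linarith [h0 a]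
  refine ⟨ρ, fun a => ∫ r in a..(t + δ), ρ r, hc, h0, ?_, hs, hd, fun a => ?_, fun a => ?_,
    hR0, hR1⟩
  · rw [← ofReal_integral_eq_lintegral_ofReal hfint (.of_forall h0), hi, ENNReal.ofReal_one]
  · have := hanti (le_max_left a (t + δ))
    dsimp only at this
    rwa [hR0 _ (le_max_right _ _)] at this
  · have := hanti (min_le_left a (t - δ))
    dsimp only at this
    rwa [hR1 _ (min_le_right _ _)] at this

theorem differentiable_comp_add_norm_sub {ρ R : ℝ → ℝ} {t δ : ℝ}
    (hd : ∀ a, HasDerivAt R (-ρ a) a) (hR1 : ∀ a, a ≤ t - δ → R a = 1) (x : E3) {τ : ℝ}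
    (hτ : τ < t - δ) : Differentiable ℝ fun y : E3 => R (τ + ‖y - x‖) := by
  intro y
  by_cases hy : y = x
  · have : (fun y : E3 => R (τ + ‖y - x‖)) =ᶠ[nhds y] fun _ => 1 := by
      have hc : Continuous fun y : E3 => τ + ‖y - x‖ := by fun_prop
      filter_upwards [hc.continuousAt.eventually_lt continuousAt_const
        (by simpa [hy] using hτ : τ + ‖y - x‖ < t - δ)] with z hz
      exact hR1 _ hz.le
    exact (differentiableAt_const _).congr_of_eventuallyEq this
  · have h1 : DifferentiableAt ℝ (fun y : E3 => τ + ‖y - x‖) y :=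
      ((differentiableAt_id.sub_const x).norm ℝ (sub_ne_zero.2 hy)).const_add τ
    exact (hd _).differentiableAt.comp y h1

theorem norm_fderiv_comp_add_norm_sub_le {ρ R : ℝ → ℝ} {t δ : ℝ} (h0 : ∀ a, 0 ≤ ρ a)
    (hd : ∀ a, HasDerivAt R (-ρ a) a) (hR1 : ∀ a, a ≤ t - δ → R a = 1) (x : E3) {τ : ℝ}
    (hτ : τ < t - δ) (y : E3) :
    ‖fderiv ℝ (fun y : E3 => R (τ + ‖y - x‖)) y‖ ≤ ρ (τ + ‖y - x‖) := by
  by_cases hy : y = x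
  · have : (fun y : E3 => R (τ + ‖y - x‖)) =ᶠ[nhds y] fun _ => 1 := by
      have hc : Continuous fun y : E3 => τ + ‖y - x‖ := by fun_prop
      filter_upwards [hc.continuousAt.eventually_lt continuousAt_const
        (by simpa [hy] using hτ : τ + ‖y - x‖ < t - δ)] with z hz
      exact hR1 _ hz.le
    rw [this.fderiv_eq]
    simpa using h0 _
  · have h1 : DifferentiableAt ℝ (fun y : E3 => τ + ‖y - x‖) y :=
      ((differentiableAt_id.sub_const x).norm ℝ (sub_ne_zero.2 hy)).const_add τ
    have h2 : LipschitzWith 1 fun y : E3 => τ + ‖y - x‖ :=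
      LipschitzWith.of_dist_le_mul fun a b => by
        have := abs_norm_sub_norm_le (a - x) (b - x)
        rw [Real.dist_eq, dist_eq_norm]
        simpa using this
    have h3 := norm_fderiv_le_of_lipschitz ℝ h2 (x₀ := y)
    have h4 := (hd (τ + ‖y - x‖)).comp_hasFDerivAt y h1.hasFDerivAt
    have h5 : fderiv ℝ (fun y : E3 => R (τ + ‖y - x‖)) y = _ := h4.fderiv
    rw [h5, norm_smul, norm_neg, Real.norm_of_nonneg (h0 _)]
    calc _ ≤ ρ (τ + ‖y - x‖) * 1 := by gcongr; exacts [h0 _, by simpa using h3]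
      _ = _ := mul_one _

variable {u : ℝ → E3 → ℝ}

theorem IsNLW.le_integral_cutoff (hu : IsNLW u) (x : E3) {ρ : ℝ → ℝ} {t δ η τ : ℝ}
    (hc : Continuous ρ) (h0 : ∀ a, 0 ≤ ρ a) (h1 : ∫⁻ a, ENNReal.ofReal (ρ a) = 1)
    (hs : ∀ a, δ ≤ |a - t| → ρ a = 0) (hτ : τ < t - δ) {G : ℝ}
    (hG : ∀ a, |a - t| < δ → G - η ≤ (a - τ) ^ 2 * ∫ ω, u τ (x + (a - τ) • ω) ^ 6 ∂sphM) :
    G - η ≤ ∫ y, ρ (τ + ‖y - x‖) * u τ y ^ 6 := by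
  have hcu : Continuous (u τ) := (hu.isSchwartz τ).1.continuous
  have hcy : Continuous fun y => ρ (τ + ‖y - x‖) * u τ y ^ 6 := by fun_prop
  have hny (y : E3) : 0 ≤ ρ (τ + ‖y - x‖) * u τ y ^ 6 :=
    mul_nonneg (h0 _) (by positivity)
  have hfint : Integrable fun y => ρ (τ + ‖y - x‖) * u τ y ^ 6 := by
    refine hcy.integrable_of_hasCompactSupport
      (HasCompactSupport.intro (isCompact_closedBall x (t + δ - τ)) fun y hy => ?_)
    rw [Metric.mem_closedBall, dist_eq_norm, not_le] at hy
    rw [hs _ (le_trans (by linarith) (le_abs_self _)), zero_mul]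
  have key : ENNReal.ofReal (G - η) ≤ ENNReal.ofReal (∫ y, ρ (τ + ‖y - x‖) * u τ y ^ 6) := by
    rw [ofReal_integral_eq_lintegral_ofReal hfint (.of_forall hny)]
    have e1 : ∫⁻ y, ENNReal.ofReal (ρ (τ + ‖y - x‖) * u τ y ^ 6) =
        ∫⁻ z, ENNReal.ofReal (ρ (τ + ‖z‖) * u τ (x + z) ^ 6) := by
      rw [← lintegral_add_left_eq_self
        (fun y => ENNReal.ofReal (ρ (τ + ‖y - x‖) * u τ y ^ 6)) x]
      simp
    have hcz : Continuous fun z => ρ (τ + ‖z‖) * u τ (x + z) ^ 6 := by fun_prop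
    rw [e1, lintegral_polar hcz.measurable.ennreal_ofReal]
    have e2 : ∫⁻ r, ENNReal.ofReal (ρ (τ + r) * (G - η)) = ENNReal.ofReal (G - η) := by
      simp_rw [ENNReal.ofReal_mul (h0 _)]
      rw [lintegral_mul_const _ (by fun_prop),
        lintegral_add_left_eq_self (fun a => ENNReal.ofReal (ρ a)) τ, h1, one_mul]
    rw [← e2, ← setLIntegral_eq_of_support_subset (s := Ioi 0)]
    · refine setLIntegral_mono' measurableSet_Ioi fun r (hr : 0 < r) => ?_
      have e3 : ∫⁻ ω, ENNReal.ofReal (ρ (τ + ‖r • ω‖) * u τ (x + r • ω) ^ 6) ∂sphM =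
          ENNReal.ofReal (ρ (τ + r) * ∫ ω, u τ (x + r • ω) ^ 6 ∂sphM) := by
        rw [← integral_const_mul, ofReal_integral_eq_lintegral_ofReal]
        · refine lintegral_congr_ae ?_
          filter_upwards [isSphereInvariant_sphM.mem_sphere] with ω hω
          rw [mem_sphere_zero_iff_norm] at hω
          rw [norm_smul, hω, mul_one, Real.norm_of_nonneg hr.le]
        · exact integrable_of_continuous_of_compact (isCompact_sphere 0 1)
            isSphereInvariant_sphM.mem_sphere (by fun_prop)
        · exact .of_forall fun ω => mul_nonneg (h0 _) (by positivity)
      rw [e3, ← ENNReal.ofReal_mul (by positivity)]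
      refine ENNReal.ofReal_le_ofReal ?_
      by_cases ha : |τ + r - t| < δ
      · have := mul_le_mul_of_nonneg_left (hG _ ha) (h0 (τ + r))
        simp only [add_sub_cancel_left] at this
        linarith
      · rw [hs _ (not_lt.1 ha)]; simp
    · intro r hr
      by_contra hr0
      rw [mem_Ioi, not_lt] at hr0
      refine hr ?_
      dsimp only
      rw [hs _ (le_trans (by linarith) (neg_le_abs (τ + r - t))), zero_mul, ENNReal.ofReal_zero]
  rcases le_or_gt (G - η) 0 with h | h
  · exact h.trans (integral_nonneg hny)
  · exact (ENNReal.ofReal_le_ofReal_iff (integral_nonneg hny)).1 key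

end Flux

section Flux

variable {u : ℝ → E3 → ℝ}

theorem IsNLW.continuous_sphere_pow_six (hu : IsNLW u) (x : E3) :
    Continuous fun p : ℝ × ℝ =>
      (p.2 - p.1) ^ 2 * ∫ ω, u p.1 (x + (p.2 - p.1) • ω) ^ 6 ∂sphM := by
  have h : sphM.restrict (Metric.sphere 0 1) = sphM :=
    Measure.restrict_eq_self_of_ae_mem isSphereInvariant_sphM.mem_sphere
  have hc : Continuous fun q : (ℝ × ℝ) × E3 => u q.1.1 (x + (q.1.2 - q.1.1) • q.2) ^ 6 :=
    (hu.contDiff.continuous.comp (by fun_prop :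
      Continuous fun q : (ℝ × ℝ) × E3 => (q.1.1, x + (q.1.2 - q.1.1) • q.2))).pow 6
  have h2 := continuous_parametric_integral_of_continuous (μ := sphM)
    (f := fun (p : ℝ × ℝ) ω => u p.1 (x + (p.2 - p.1) • ω) ^ 6) hc (isCompact_sphere (0 : E3) 1)
  rw [h] at h2
  fun_prop

theorem IsNLW.cutoff_energy_le (hu : IsNLW u) {x : E3} {ρ R G : ℝ → ℝ} {t δ η s : ℝ}
    (hs0 : 0 ≤ s) (hst : s < t - δ) (hGc : Continuous G)
    (hρc : Continuous ρ) (hρ0 : ∀ a, 0 ≤ ρ a) (hρ1 : ∫⁻ a, ENNReal.ofReal (ρ a) = 1)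
    (hρs : ∀ a, δ ≤ |a - t| → ρ a = 0) (hRd : ∀ a, HasDerivAt R (-ρ a) a) (hR0 : ∀ a, 0 ≤ R a)
    (hR1 : ∀ a, R a ≤ 1) (hRr : ∀ a, t + δ ≤ a → R a = 0) (hRl : ∀ a, a ≤ t - δ → R a = 1)
    (hG : ∀ τ ∈ Icc 0 s, ∀ a, |a - t| < δ →
      G τ - η ≤ (a - τ) ^ 2 * ∫ ω, u τ (x + (a - τ) • ω) ^ 6 ∂sphM) :
    ∫ τ in (0 : ℝ)..s, (G τ - η) ≤ 6 * energy u 0 := by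
  set K := Metric.closedBall x (t + δ) with hK
  set e := energyDensity (uncurry u) with he
  have hec : Continuous e := continuous_energyDensity hu.contDiff
  have hec' := continuous_energyDensityDeriv hu.contDiff
  have hRc : Continuous R := continuous_iff_continuousAt.2 fun a => (hRd a).continuousAt
  set F : ℝ → E3 → ℝ := fun τ y => R (τ + ‖y - x‖) * e (τ, y) with hF
  set F' : ℝ → E3 → ℝ := fun τ y => -ρ (τ + ‖y - x‖) * e (τ, y) +
    R (τ + ‖y - x‖) * energyDensityDeriv (uncurry u) (τ, y) with hF'
  have hFc : Continuous (uncurry F) := by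
    simp only [hF, uncurry_def]; fun_prop
  have hFc' : Continuous (uncurry F') := by
    simp only [hF', uncurry_def]; fun_prop
  have hFd (τ : ℝ) (y : E3) : HasDerivAt (fun τ => F τ y) (F' τ y) τ := by
    have h1 : HasDerivAt (fun τ => R (τ + ‖y - x‖)) (-ρ (τ + ‖y - x‖)) τ :=
      HasDerivAt.comp_add_const τ _ (hRd _)
    exact h1.mul (hasDerivAt_energyDensity hu.contDiff y τ)
  have hfin : IsFiniteMeasure (volume.restrict K) :=
    ⟨by rw [Measure.restrict_apply_univ]; exact (isCompact_closedBall _ _).measure_lt_top⟩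
  have hd (τ : ℝ) : HasDerivAt (fun τ => ∫ y in K, F τ y) (∫ y in K, F' τ y) τ :=
    hasDerivAt_integral_of_compact (isCompact_closedBall _ _)
      (ae_restrict_mem Metric.isClosed_closedBall.measurableSet) hFc hFc' hFd τ
  have hout {τ : ℝ} (hτ : 0 ≤ τ) {y : E3} (hy : y ∉ K) : t + δ ≤ τ + ‖y - x‖ := by
    rw [hK, Metric.mem_closedBall, dist_eq_norm, not_le] at hy
    linarith
  have hle (τ : ℝ) (hτ : τ ∈ Icc 0 s) : ∫ y in K, F' τ y ≤ -(1 / 6) * (G τ - η) := by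
    have hχ0 (y : E3) (hy : y ∉ K) : R (τ + ‖y - x‖) = 0 := hRr _ (hout hτ.1 hy)
    have hσ0 (y : E3) (hy : y ∉ K) : ρ (τ + ‖y - x‖) = 0 :=
      hρs _ (le_trans (by linarith [hout hτ.1 hy]) (le_abs_self _))
    have hτt : τ < t - δ := hτ.2.trans_lt hst
    have k1 := hu.integral_energyDensityDeriv_le τ
      (differentiable_comp_add_norm_sub hRd hRl x hτt)
      (by fun_prop : Continuous fun y => ρ (τ + ‖y - x‖)) hχ0 hσ0
      (norm_fderiv_comp_add_norm_sub_le hρ0 hRd hRl x hτt)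
    have k2 := hu.le_integral_cutoff x hρc hρ0 hρ1 hρs hτt (hG τ hτ)
    have hcu : Continuous (u τ) := (hu.isSchwartz τ).1.continuous
    have hfint {f g : E3 → ℝ} (hf : Continuous f) (hg : Continuous g) (h0 : ∀ y, y ∉ K → f y = 0) :
        Integrable fun y => f y * g y :=
      (hf.mul hg).integrable_of_hasCompactSupport
        (HasCompactSupport.intro (isCompact_closedBall x (t + δ)) fun y hy => by simp [h0 y hy])
    have i1 : Integrable fun y => ρ (τ + ‖y - x‖) * e (τ, y) :=
      hfint (by fun_prop) (by fun_prop) hσ0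
    have i2 : Integrable fun y => R (τ + ‖y - x‖) * energyDensityDeriv (uncurry u) (τ, y) :=
      hfint (by fun_prop) (by fun_prop) hχ0
    have i3 : Integrable fun y => ρ (τ + ‖y - x‖) * u τ y ^ 6 :=
      hfint (by fun_prop) (by fun_prop) hσ0
    have k3 : ∫ y in K, F' τ y = -(∫ y, ρ (τ + ‖y - x‖) * e (τ, y)) +
        ∫ y, R (τ + ‖y - x‖) * energyDensityDeriv (uncurry u) (τ, y) := by
      rw [setIntegral_eq_integral_of_forall_compl_eq_zero fun y hy => by
        simp [hF', hχ0 y hy, hσ0 y hy], ← integral_neg]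
      have i4 : Integrable fun y => -(ρ (τ + ‖y - x‖) * e (τ, y)) := i1.neg
      rw [← integral_add i4 i2]
      simp only [hF', neg_mul]
    have k4 : ∫ y, ρ (τ + ‖y - x‖) * (e (τ, y) - 1 / 6 * u τ y ^ 6) =
        (∫ y, ρ (τ + ‖y - x‖) * e (τ, y)) - 1 / 6 * ∫ y, ρ (τ + ‖y - x‖) * u τ y ^ 6 := by
      rw [← integral_const_mul, ← integral_sub i1 (i3.const_mul _)]
      refine integral_congr_ae (.of_forall fun y => ?_)
      dsimp only; ring
    linarith
  have hGi (a b : ℝ) : IntervalIntegrable (fun τ => G τ - η) volume a b :=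
    (by fun_prop : Continuous fun τ => G τ - η).intervalIntegrable _ _
  have hh (τ : ℝ) : HasDerivAt (fun τ => (∫ y in K, F τ y) +
      1 / 6 * ∫ r in (0 : ℝ)..τ, (G r - η)) ((∫ y in K, F' τ y) + 1 / 6 * (G τ - η)) τ :=
    (hd τ).add ((intervalIntegral.integral_hasDerivAt_right (hGi _ _)
      ((by fun_prop : Continuous fun τ => G τ - η).stronglyMeasurableAtFilter _ _)
      (by fun_prop : Continuous fun τ => G τ - η).continuousAt).const_mul _)
  have hanti := antitoneOn_of_deriv_nonpos (convex_Icc 0 s)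
    (fun τ _ => (hh τ).continuousAt.continuousWithinAt)
    (fun τ _ => (hh τ).differentiableAt.differentiableWithinAt) fun τ hτ => by
      rw [(hh τ).deriv]
      have := hle τ (interior_subset hτ)
      linarith
  have h1 := hanti (left_mem_Icc.2 hs0) (right_mem_Icc.2 hs0) hs0
  dsimp only at h1
  rw [intervalIntegral.integral_same] at h1
  have h2 : 0 ≤ ∫ y in K, F s y :=
    integral_nonneg fun y => mul_nonneg (hR0 _) (energyDensity_nonneg _ _)
  have h3 : ∫ y in K, F 0 y ≤ energy u 0 := by
    rw [hu.energy_eq, setIntegral_eq_integral_of_forall_compl_eq_zero fun y hy => by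
      simp only [hF]; rw [hRr _ (hout le_rfl hy), zero_mul]]
    refine integral_mono_of_nonneg
      (.of_forall fun y => mul_nonneg (hR0 _) (energyDensity_nonneg _ _))
      (hu.integrable_energyDensity 0) (.of_forall fun y => ?_)
    exact mul_le_of_le_one_left (energyDensity_nonneg _ _) (hR1 _)
  linarith

theorem IsNLW.integral_cone_pow_six_le (hu : IsNLW u) (x : E3) {s t : ℝ} (hs0 : 0 ≤ s)
    (hst : s < t) :
    ∫ τ in (0 : ℝ)..s, (t - τ) ^ 2 * ∫ ω, u τ (x + (t - τ) • ω) ^ 6 ∂sphM ≤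
      6 * energy u 0 := by
  set H : ℝ × ℝ → ℝ := fun p =>
    (p.2 - p.1) ^ 2 * ∫ ω, u p.1 (x + (p.2 - p.1) • ω) ^ 6 ∂sphM with hH
  have hHc : Continuous H := hu.continuous_sphere_pow_six x
  have hGc : Continuous fun τ => H (τ, t) := by fun_prop
  have key (η : ℝ) (hη : 0 < η) : ∫ τ in (0 : ℝ)..s, H (τ, t) ≤ 6 * energy u 0 + η * s := by
    have huc := (isCompact_Icc.prod isCompact_Icc :
      IsCompact (Icc 0 s ×ˢ Icc (t - 1) (t + 1))).uniformContinuousOn_of_continuous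
        hHc.continuousOn
    obtain ⟨δ₀, hδ₀, hδ₁⟩ := Metric.uniformContinuousOn_iff.1 huc η hη
    set δ := min (min δ₀ 1) ((t - s) / 2) with hδ
    have hδpos : 0 < δ := lt_min (lt_min hδ₀ one_pos) (by linarith)
    have hδa : δ ≤ δ₀ := (min_le_left _ _).trans (min_le_left _ _)
    have hδb : δ ≤ 1 := (min_le_left _ _).trans (min_le_right _ _)
    have hδc : δ ≤ (t - s) / 2 := min_le_right _ _
    obtain ⟨ρ, R, hρc, hρ0, hρ1, hρs, hRd, hR0, hR1, hRr, hRl⟩ := exists_smooth_cutoff t hδpos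
    have := hu.cutoff_energy_le (x := x) (η := η) hs0 (by linarith) hGc hρc hρ0 hρ1 hρs
      hRd hR0 hR1 hRr hRl fun τ hτ a ha => by
        have h2 := abs_lt.1 ha
        have h1 := hδ₁ (τ, t) ⟨hτ, by constructor <;> dsimp only <;> linarith⟩ (τ, a)
          ⟨hτ, by constructor <;> dsimp only <;> linarith⟩ (by
            rw [Prod.dist_eq, dist_self, Real.dist_eq, abs_sub_comm,
              max_eq_right (abs_nonneg _)]
            dsimp only
            linarith)
        rw [Real.dist_eq] at h1
        have := (abs_lt.1 h1).2
        simp only [hH] at this ⊢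
        linarith
    rw [intervalIntegral.integral_sub (hGc.intervalIntegrable _ _)
      (continuous_const.intervalIntegrable _ _), intervalIntegral.integral_const,
      smul_eq_mul] at this
    linarith
  refine le_of_forall_pos_le_add fun η hη => ?_
  refine (key (η / (s + 1)) (by positivity)).trans ?_
  gcongr
  rw [div_mul_eq_mul_div, div_le_iff₀ (by linarith)]
  nlinarith

end Flux

section DuhamelBound

variable {u : ℝ → E3 → ℝ}

theorem mul_pow_five_le {l r v : ℝ} (hl : 0 < l) (hr : 0 < r) :
    r * |v| ^ 5 ≤ l * (r ^ 2 * v ^ 6) + (l ^ 5 * r ^ 4)⁻¹ := by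
  set w := l * r * |v| with hw
  have hw0 : 0 ≤ w := by positivity
  have h1 : w ^ 5 ≤ w ^ 6 + 1 := by
    rcases le_total w 1 with h | h
    · have := pow_le_one₀ (n := 5) hw0 h
      have : 0 ≤ w ^ 6 := by positivity
      linarith
    · have := pow_le_pow_right₀ h (show 5 ≤ 6 by norm_num)
      linarith
  have e1 : r * |v| ^ 5 = (l ^ 5 * r ^ 4)⁻¹ * w ^ 5 := by
    rw [hw]; field_simp
  have e2 : l * (r ^ 2 * v ^ 6) = (l ^ 5 * r ^ 4)⁻¹ * w ^ 6 := by
    have : v ^ 6 = |v| ^ 6 := (Even.pow_abs (by decide) v).symm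
    rw [hw, this]; field_simp
  rw [e1, e2]
  calc _ ≤ (l ^ 5 * r ^ 4)⁻¹ * (w ^ 6 + 1) := by gcongr
    _ = _ := by ring

theorem IsNLW.abs_duh_le_weighted (hu : IsNLW u) {κ : ℝ} (hκ0 : 0 ≤ κ)
    (hκ : ∀ x r f, 0 < r → sphInt x r f = κ * r ^ 2 * ∫ ω, f (x + r • ω) ∂sphM)
    {s t T l : ℝ} (hs : 0 ≤ s) (hT : 0 < T) (hst : T ≤ t - s) (hl : 0 < l) (x : E3) :
    |duh u 0 s t x| ≤ κ / (4 * π) *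
      (6 * l * energy u 0 + sphM.real univ * (3 * l ^ 5 * T ^ 3)⁻¹) := by
  have hst' : s < t := by linarith
  rw [duh_eq_integral u hκ hs hst', abs_mul, abs_of_nonneg (by positivity)]
  gcongr
  have hpos {τ : ℝ} (hτ : τ ∈ Icc 0 s) : 0 < t - τ := by linarith [hτ.2]
  have hcG : Continuous fun τ => (t - τ) ^ 2 * ∫ ω, u τ (x + (t - τ) • ω) ^ 6 ∂sphM :=
    (hu.continuous_sphere_pow_six x).comp (by fun_prop : Continuous fun τ : ℝ => (τ, t))
  have hd (τ : ℝ) (hτ : τ ∈ uIcc 0 s) :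
      HasDerivAt (fun τ => (3 * (t - τ) ^ 3)⁻¹) (((t - τ) ^ 4)⁻¹) τ := by
    rw [uIcc_of_le hs] at hτ
    have h0 := (hpos hτ).ne'
    refine (((((hasDerivAt_id τ).const_sub t).pow 3).const_mul 3).inv
      (by simpa using h0)).congr_deriv ?_
    simp only [id, Pi.pow_apply]
    field_simp
    push_cast
    ring
  have hi : IntervalIntegrable (fun τ => ((t - τ) ^ 4)⁻¹) volume 0 s := by
    refine ContinuousOn.intervalIntegrable ?_
    rw [uIcc_of_le hs]
    exact ContinuousOn.inv₀ (by fun_prop) fun τ hτ => (pow_pos (hpos hτ) 4).ne'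
  have h4 : ∫ τ in (0 : ℝ)..s, ((t - τ) ^ 4)⁻¹ ≤ (3 * T ^ 3)⁻¹ := by
    rw [intervalIntegral.integral_eq_sub_of_hasDerivAt hd hi]
    have h1 : (3 * (t - s) ^ 3)⁻¹ ≤ (3 * T ^ 3)⁻¹ := by gcongr
    have h2 : 0 ≤ (3 * (t - 0) ^ 3)⁻¹ := by
      have : 0 ≤ t - 0 := by linarith
      positivity
    linarith
  have hb : |∫ τ in (0 : ℝ)..s, (t - τ) * ∫ ω, u τ (x + (t - τ) • ω) ^ 5 ∂sphM| ≤
      ∫ τ in (0 : ℝ)..s, (l * ((t - τ) ^ 2 * ∫ ω, u τ (x + (t - τ) • ω) ^ 6 ∂sphM) +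
        sphM.real univ * (l ^ 5)⁻¹ * ((t - τ) ^ 4)⁻¹) := by
    rw [← Real.norm_eq_abs]
    refine intervalIntegral.norm_integral_le_of_norm_le hs (.of_forall fun τ hτ => ?_)
      (((hcG.const_mul l).intervalIntegrable _ _).add (hi.const_mul _))
    have hr := hpos (Ioc_subset_Icc_self hτ)
    have hcu : Continuous (u τ) := (hu.isSchwartz τ).1.continuous
    have hfint {f : E3 → ℝ} (hf : Continuous f) : Integrable f sphM :=
      integrable_of_continuous_of_compact (isCompact_sphere 0 1)
        isSphereInvariant_sphM.mem_sphere hf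
    rw [norm_mul, Real.norm_of_nonneg hr.le]
    have k1 : ‖∫ ω, u τ (x + (t - τ) • ω) ^ 5 ∂sphM‖ ≤
        ∫ ω, |u τ (x + (t - τ) • ω)| ^ 5 ∂sphM := by
      refine (norm_integral_le_integral_norm _).trans_eq ?_
      simp only [norm_pow, Real.norm_eq_abs]
    calc _ ≤ (t - τ) * ∫ ω, |u τ (x + (t - τ) • ω)| ^ 5 ∂sphM := by gcongr
      _ = ∫ ω, (t - τ) * |u τ (x + (t - τ) • ω)| ^ 5 ∂sphM := (integral_const_mul _ _).symm
      _ ≤ ∫ ω, (l * ((t - τ) ^ 2 * u τ (x + (t - τ) • ω) ^ 6) +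
          (l ^ 5 * (t - τ) ^ 4)⁻¹) ∂sphM :=
        integral_mono (hfint (by fun_prop)) (hfint (by fun_prop))
          fun ω => mul_pow_five_le hl hr
      _ = _ := by
        rw [integral_add (hfint (by fun_prop)) (hfint (by fun_prop)), integral_const_mul,
          integral_const_mul, integral_const, smul_eq_mul, mul_inv]
        ring
  refine hb.trans ?_
  rw [intervalIntegral.integral_add ((hcG.const_mul l).intervalIntegrable _ _)
    (hi.const_mul _), intervalIntegral.integral_const_mul, intervalIntegral.integral_const_mul]
  have h6 := mul_le_mul_of_nonneg_left (hu.integral_cone_pow_six_le x hs hst') hl.le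
  have h7 := mul_le_mul_of_nonneg_left h4
    (by positivity : 0 ≤ sphM.real univ * (l ^ 5)⁻¹)
  have e : sphM.real univ * (l ^ 5)⁻¹ * (3 * T ^ 3)⁻¹ =
      sphM.real univ * (3 * l ^ 5 * T ^ 3)⁻¹ := by
    simp only [mul_inv]; ring
  linarith

theorem exists_abs_duh_le : ∃ K : ℝ, 0 < K ∧ ∀ u : ℝ → E3 → ℝ, IsNLW u → ∀ E : ℝ, 0 < E →
    energy u 0 ≤ E → ∀ s t T : ℝ, 0 ≤ s → 0 < T → T ≤ t - s → ∀ x : E3,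
      |duh u 0 s t x| ≤ K * (E ^ ((5 : ℝ) / 6) * T ^ (-(1 : ℝ) / 2)) := by
  obtain ⟨κ, hκ0, hκ⟩ := exists_sphInt_eq
  refine ⟨κ / (4 * π) * (6 + sphM.real univ / 3) + 1, by positivity,
    fun u hu E hE hen s t T hs hT hst x => ?_⟩
  set l : ℝ := E ^ (-(1 : ℝ) / 6) * T ^ (-(1 : ℝ) / 2) with hl
  have hl0 : 0 < l := by positivity
  refine (hu.abs_duh_le_weighted hκ0 hκ hs hT hst hl0 x).trans ?_
  set P := E ^ ((5 : ℝ) / 6) * T ^ (-(1 : ℝ) / 2) with hP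
  have hP0 : 0 < P := by positivity
  have e1 : l * E = P := by
    rw [hl, hP, mul_right_comm, ← Real.rpow_add_one hE.ne']
    norm_num
  have e2 : (l ^ 5 * T ^ 3)⁻¹ = P := by
    rw [hl, hP, mul_pow, ← Real.rpow_mul_natCast hE.le, ← Real.rpow_mul_natCast hT.le, mul_assoc,
      ← Real.rpow_add_natCast hT.ne', mul_inv, ← Real.rpow_neg hE.le, ← Real.rpow_neg hT.le]
    norm_num
  calc _ ≤ κ / (4 * π) * (6 * (l * E) + sphM.real univ / 3 * (l ^ 5 * T ^ 3)⁻¹) := by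
        refine mul_le_mul_of_nonneg_left (add_le_add ?_ (le_of_eq ?_)) (by positivity)
        · rw [mul_assoc]; gcongr
        · simp only [mul_inv]; ring
    _ = κ / (4 * π) * (6 + sphM.real univ / 3) * P := by rw [e1, e2]; ring
    _ ≤ _ := by gcongr; linarith

end DuhamelBound

section Norms

open scoped SchwartzMap LineDeriv

theorem ENNReal.ofReal_rpow_le_coe_nnnorm_rpow (ξ : E3) {a : ℝ} (ha : a ≠ 0) :
    ENNReal.ofReal (‖ξ‖ ^ a) ≤ (‖ξ‖₊ : ℝ≥0∞) ^ a := by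
  by_cases h : ξ = 0
  · simp [h, Real.zero_rpow ha]
  · rw [← ENNReal.ofReal_rpow_of_pos (norm_pos_iff.2 h), ofReal_norm]
    rfl

theorem ENNReal.le_ofReal_sq_of_rpow_half_le {I : ℝ≥0∞} {A : ℝ} (hA : 0 < A)
    (h : I ^ ((1 : ℝ) / 2) ≤ ENNReal.ofReal A) : I ≤ ENNReal.ofReal (A ^ 2) := by
  rw [one_div, ENNReal.rpow_inv_le_iff two_pos, ENNReal.ofReal_rpow_of_pos hA] at h
  simpa using h

theorem ENNReal.ofReal_norm_sq {F : Type*} [NormedAddCommGroup F] (z : F) :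
    ENNReal.ofReal (‖z‖ ^ 2) = (‖z‖₊ : ℝ≥0∞) ^ (2 : ℝ) := by
  rw [ENNReal.ofReal_pow (norm_nonneg _), ofReal_norm]
  norm_cast

theorem SchwartzMap.integrable_norm_sq (φ : 𝓢(E3, ℂ)) : Integrable fun x => ‖φ x‖ ^ 2 :=
  (φ.memLp ((2 : ℕ) : ℝ≥0∞) volume).integrable_norm_pow two_ne_zero

theorem SchwartzMap.lintegral_norm_sq_fourier (φ : 𝓢(E3, ℂ)) :
    ∫⁻ ξ, ENNReal.ofReal (‖(𝓕 φ : 𝓢(E3, ℂ)) ξ‖ ^ 2) = ENNReal.ofReal (∫ x, ‖φ x‖ ^ 2) := by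
  rw [← SchwartzMap.integral_norm_sq_fourier, ofReal_integral_eq_lintegral_ofReal
    (SchwartzMap.integrable_norm_sq _) (.of_forall fun _ => by positivity)]

theorem IsSchwartz.lintegral_norm_fourier_sq_le {g : E3 → ℝ} (hg : IsSchwartz g) {A : ℝ}
    (hA : 0 < A) (h : xNorm 2 g ≤ ENNReal.ofReal A) :
    ∫⁻ ξ, ENNReal.ofReal (‖(𝓕 hg.toSchwartzMap : 𝓢(E3, ℂ)) ξ‖ ^ 2) ≤ ENNReal.ofReal (A ^ 2) := by
  rw [SchwartzMap.lintegral_norm_sq_fourier, ofReal_integral_eq_lintegral_ofReal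
    (SchwartzMap.integrable_norm_sq _) (.of_forall fun _ => by positivity)]
  refine le_trans (le_of_eq ?_) (ENNReal.le_ofReal_sq_of_rpow_half_le hA h)
  refine lintegral_congr fun x => ?_
  rw [← ENNReal.ofReal_norm_sq]
  simp

theorem IsSchwartz.lintegral_rpow_norm_fourier_sq_le {g : E3 → ℝ} (hg : IsSchwartz g) {A s : ℝ}
    (hA : 0 < A) (hs : 2 * s ≠ 0) (h : sobNorm s g ≤ ENNReal.ofReal A) :
    ∫⁻ ξ, ENNReal.ofReal (‖ξ‖ ^ (2 * s) * ‖(𝓕 hg.toSchwartzMap : 𝓢(E3, ℂ)) ξ‖ ^ 2) ≤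
      ENNReal.ofReal (A ^ 2) := by
  refine le_trans (lintegral_mono fun ξ => ?_) (ENNReal.le_ofReal_sq_of_rpow_half_le hA h)
  rw [ENNReal.ofReal_mul (by positivity), ENNReal.ofReal_norm_sq]
  gcongr
  · exact ENNReal.ofReal_rpow_le_coe_nnnorm_rpow ξ hs
  · rw [SchwartzMap.fourier_coe]; rfl

theorem IsSchwartz.lintegral_norm_sq_mul_norm_fourier_sq_le {g : E3 → ℝ} (hg : IsSchwartz g) :
    ∫⁻ ξ, ENNReal.ofReal (‖ξ‖ ^ 2 * ‖(𝓕 hg.toSchwartzMap : 𝓢(E3, ℂ)) ξ‖ ^ 2) ≤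
      ENNReal.ofReal (∑ i : Fin 3, ∫ y, fderiv ℝ g y (EuclideanSpace.single i 1) ^ 2) := by
  have h1 (i : Fin 3) : ENNReal.ofReal (∫ y, fderiv ℝ g y (EuclideanSpace.single i 1) ^ 2) =
      ∫⁻ ξ : E3, ENNReal.ofReal ((2 * π) ^ 2 *
        (ξ i ^ 2 * ‖(𝓕 hg.toSchwartzMap : 𝓢(E3, ℂ)) ξ‖ ^ 2)) := by
    have e1 : (hg.fderiv_apply (EuclideanSpace.single i 1)).toSchwartzMap =
        ∂_{(EuclideanSpace.single i 1 : E3)} hg.toSchwartzMap := by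
      ext x
      rw [SchwartzMap.lineDerivOp_apply_eq_fderiv]
      have : ((hg.toSchwartzMap : 𝓢(E3, ℂ)) : E3 → ℂ) = Complex.ofRealCLM ∘ g := rfl
      rw [this, fderiv_comp _ Complex.ofRealCLM.differentiableAt
        ((hg.1.differentiable (by simp)) x), ContinuousLinearMap.fderiv]
      simp
    have e2 := SchwartzMap.lintegral_norm_sq_fourier
      (hg.fderiv_apply (EuclideanSpace.single i 1)).toSchwartzMap
    simp only [IsSchwartz.toSchwartzMap_apply, Complex.norm_real, Real.norm_eq_abs, sq_abs] at e2
    rw [← e2, e1, SchwartzMap.fourier_lineDerivOp_eq]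
    refine lintegral_congr fun ξ => ?_
    rw [smul_apply, SchwartzMap.smulLeftCLM_apply_apply (by fun_prop),
      EuclideanSpace.inner_single_right, norm_smul, norm_smul, mul_pow, mul_pow]
    congr 2
    · simp [abs_of_pos pi_pos]
    · simp
  rw [ENNReal.ofReal_sum_of_nonneg fun i _ => integral_nonneg fun y => sq_nonneg _]
  simp_rw [h1]
  have hm (i : Fin 3) : Measurable fun ξ : E3 => ENNReal.ofReal ((2 * π) ^ 2 *
      (ξ i ^ 2 * ‖(𝓕 hg.toSchwartzMap : 𝓢(E3, ℂ)) ξ‖ ^ 2)) :=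
    (by fun_prop : Continuous fun ξ : E3 => (2 * π) ^ 2 *
      (ξ i ^ 2 * ‖(𝓕 hg.toSchwartzMap : 𝓢(E3, ℂ)) ξ‖ ^ 2)).measurable.ennreal_ofReal
  rw [← lintegral_finsetSum _ fun i _ => hm i]
  refine lintegral_mono fun ξ => ?_
  rw [← ENNReal.ofReal_sum_of_nonneg fun i _ => by positivity]
  refine ENNReal.ofReal_le_ofReal ?_
  rw [← Finset.mul_sum, ← Finset.sum_mul]
  have e3 : ‖ξ‖ ^ 2 = ∑ i, ξ i ^ 2 := by
    rw [EuclideanSpace.norm_sq_eq]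
    simp
  rw [← e3]
  have : 1 ≤ (2 * π) ^ 2 := one_le_pow₀ (by linarith [pi_gt_three])
  exact le_mul_of_one_le_left (by positivity) this

end Norms

section ProfileBounds

open scoped SchwartzMap

theorem lintegral_ofReal_le_add {g g₁ g₂ : E3 → ℝ} {a b A₁ A₂ : ℝ} (ha : 0 ≤ a) (hb : 0 ≤ b)
    (hA₁ : 0 ≤ A₁) (hA₂ : 0 ≤ A₂) (hm : Measurable g₁)
    (h : ∀ ξ, g ξ ≤ a * g₁ ξ + b * g₂ ξ)
    (h₁ : ∫⁻ ξ, ENNReal.ofReal (g₁ ξ) ≤ ENNReal.ofReal A₁)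
    (h₂ : ∫⁻ ξ, ENNReal.ofReal (g₂ ξ) ≤ ENNReal.ofReal A₂) :
    ∫⁻ ξ, ENNReal.ofReal (g ξ) ≤ ENNReal.ofReal (a * A₁ + b * A₂) := by
  calc ∫⁻ ξ, ENNReal.ofReal (g ξ) ≤
        ∫⁻ ξ, (ENNReal.ofReal a * ENNReal.ofReal (g₁ ξ) +
          ENNReal.ofReal b * ENNReal.ofReal (g₂ ξ)) := by
        refine lintegral_mono fun ξ => ?_
        rw [← ENNReal.ofReal_mul ha, ← ENNReal.ofReal_mul hb]
        exact (ENNReal.ofReal_le_ofReal (h ξ)).trans ENNReal.ofReal_add_le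
    _ = (ENNReal.ofReal a * ∫⁻ ξ, ENNReal.ofReal (g₁ ξ)) +
          ENNReal.ofReal b * ∫⁻ ξ, ENNReal.ofReal (g₂ ξ) := by
        rw [lintegral_add_left (by fun_prop), lintegral_const_mul' _ _ ENNReal.ofReal_ne_top,
          lintegral_const_mul' _ _ ENNReal.ofReal_ne_top]
    _ ≤ ENNReal.ofReal a * ENNReal.ofReal A₁ + ENNReal.ofReal b * ENNReal.ofReal A₂ := by gcongr
    _ = _ := by
        rw [ENNReal.ofReal_add (by positivity) (by positivity), ENNReal.ofReal_mul ha,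
          ENNReal.ofReal_mul hb]

theorem norm_waveProfile_le {σ : ℝ} (hσ : |σ| = 1) (φ ψ : 𝓢(E3, ℂ)) (ξ : E3) :
    ‖waveProfile σ φ ψ ξ‖ ≤
      1 / 2 * ‖(𝓕 φ : 𝓢(E3, ℂ)) ξ‖ + 1 / 2 * (‖ξ‖⁻¹ * ‖(𝓕 ψ : 𝓢(E3, ℂ)) ξ‖) := by
  rw [waveProfile]
  refine (norm_add_le _ _).trans (add_le_add ?_ ?_)
  · rw [norm_mul]; norm_num
  · rw [norm_mul, norm_mul, Complex.norm_real, Real.norm_eq_abs, hσ, one_mul, ← mul_assoc]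
    gcongr
    rw [norm_inv, norm_mul, norm_mul, norm_mul, Complex.norm_real, Complex.norm_real, norm_norm,
      Complex.norm_I, mul_one, mul_inv, Complex.norm_ofNat, Real.norm_of_nonneg pi_pos.le, one_div]
    refine mul_le_mul_of_nonneg_right (inv_anti₀ two_pos ?_) (by positivity)
    linarith [pi_gt_three]

/-- Quadratic frequency-space bounds on the pair of Cauchy data `(φ, ψ)`, from the a priori
bounds with constant `A` and the energy bound `E`. -/
structure ProfileBound (φ ψ : 𝓢(E3, ℂ)) (A E : ℝ) : Prop where
  fst_zero : ∫⁻ ξ, ENNReal.ofReal (‖(𝓕 φ : 𝓢(E3, ℂ)) ξ‖ ^ 2) ≤ ENNReal.ofReal (A ^ 2)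
  fst_four : ∫⁻ ξ, ENNReal.ofReal (‖ξ‖ ^ 4 * ‖(𝓕 φ : 𝓢(E3, ℂ)) ξ‖ ^ 2) ≤ ENNReal.ofReal (A ^ 2)
  snd_neg_two : ∫⁻ ξ, ENNReal.ofReal ((‖ξ‖⁻¹ * ‖(𝓕 ψ : 𝓢(E3, ℂ)) ξ‖) ^ 2) ≤
    ENNReal.ofReal (A ^ 2)
  snd_two : ∫⁻ ξ, ENNReal.ofReal (‖ξ‖ ^ 2 * ‖(𝓕 ψ : 𝓢(E3, ℂ)) ξ‖ ^ 2) ≤ ENNReal.ofReal (A ^ 2)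
  fst_two : ∫⁻ ξ, ENNReal.ofReal (‖ξ‖ ^ 2 * ‖(𝓕 φ : 𝓢(E3, ℂ)) ξ‖ ^ 2) ≤ ENNReal.ofReal (2 * E)
  snd_zero : ∫⁻ ξ, ENNReal.ofReal (‖(𝓕 ψ : 𝓢(E3, ℂ)) ξ‖ ^ 2) ≤ ENNReal.ofReal (2 * E)

theorem IsNLW.profileBound {u : ℝ → E3 → ℝ} (hu : IsNLW u) {A E : ℝ} (hA : 0 < A)
    (h : APriori u A) (hE : ∀ t, energy u t ≤ E) (s : ℝ) :
    ProfileBound (hu.isSchwartz s).toSchwartzMap (hu.isSchwartz_tderiv s).toSchwartzMap A E := by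
  obtain ⟨h0, h1, h2, h3⟩ := h s
  have g1 := (hu.isSchwartz_tderiv s).lintegral_rpow_norm_fourier_sq_le hA (by norm_num) h1
  have g2 := (hu.isSchwartz s).lintegral_rpow_norm_fourier_sq_le hA (by norm_num) h2
  have g3 := (hu.isSchwartz_tderiv s).lintegral_rpow_norm_fourier_sq_le hA (by norm_num) h3
  refine ⟨(hu.isSchwartz s).lintegral_norm_fourier_sq_le hA h0, ?_, ?_, ?_, ?_, ?_⟩
  · refine le_trans (le_of_eq (lintegral_congr fun ξ => ?_)) g2
    rw [← Real.rpow_natCast ‖ξ‖ 4]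
    norm_num
  · refine le_trans (le_of_eq (lintegral_congr fun ξ => ?_)) g1
    congr 1
    rw [mul_pow, mul_neg_one, Real.rpow_neg (norm_nonneg _), inv_pow]
    norm_num
  · refine le_trans (le_of_eq (lintegral_congr fun ξ => ?_)) g3
    rw [← Real.rpow_natCast ‖ξ‖ 2]
    norm_num
  · refine (hu.isSchwartz s).lintegral_norm_sq_mul_norm_fourier_sq_le.trans ?_
    exact ENNReal.ofReal_le_ofReal
      ((hu.sum_integral_fderiv_sq_le s).trans (by linarith [hE s]))
  · rw [SchwartzMap.lintegral_norm_sq_fourier]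
    refine ENNReal.ofReal_le_ofReal (le_trans (le_of_eq ?_)
      ((hu.integral_tderiv_sq_le s).trans (by linarith [hE s])))
    simp

variable {φ ψ : 𝓢(E3, ℂ)} {A E : ℝ}

theorem enorm_waveProfile_sq_mul_le {σ : ℝ} (hσ : |σ| = 1) (φ ψ : 𝓢(E3, ℂ)) (ξ : E3) :
    ‖waveProfile σ φ ψ ξ‖ₑ ^ 2 * ENNReal.ofReal ‖ξ‖ ≤
      ENNReal.ofReal (1 / 2 * (‖ξ‖ * ‖(𝓕 φ : 𝓢(E3, ℂ)) ξ‖ ^ 2) +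
        1 / 2 * (‖ξ‖⁻¹ * ‖(𝓕 ψ : 𝓢(E3, ℂ)) ξ‖ ^ 2)) := by
  rw [← ofReal_norm, ← ENNReal.ofReal_pow (norm_nonneg _), ← ENNReal.ofReal_mul (by positivity)]
  refine ENNReal.ofReal_le_ofReal ?_
  have h := norm_waveProfile_le hσ φ ψ ξ
  set p := ‖(𝓕 φ : 𝓢(E3, ℂ)) ξ‖
  set q := ‖(𝓕 ψ : 𝓢(E3, ℂ)) ξ‖
  have h2 : ‖waveProfile σ φ ψ ξ‖ ^ 2 ≤ 1 / 2 * p ^ 2 + 1 / 2 * (‖ξ‖⁻¹ * q) ^ 2 := by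
    have := pow_le_pow_left₀ (norm_nonneg _) h 2
    nlinarith [sq_nonneg (p - ‖ξ‖⁻¹ * q)]
  calc _ ≤ (1 / 2 * p ^ 2 + 1 / 2 * (‖ξ‖⁻¹ * q) ^ 2) * ‖ξ‖ := by gcongr
    _ = _ := by
      rcases eq_or_ne ‖ξ‖ 0 with h0 | h0
      · rw [h0]; simp
      · field_simp

theorem ProfileBound.lintegral_sq_le_sq (h : ProfileBound φ ψ A E) {σ : ℝ} (hσ : |σ| = 1) :
    ∫⁻ ξ, ‖waveProfile σ φ ψ ξ‖ₑ ^ 2 * ENNReal.ofReal ‖ξ‖ ≤ ENNReal.ofReal (2 * A ^ 2) := by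
  refine (lintegral_mono (enorm_waveProfile_sq_mul_le hσ φ ψ)).trans ?_
  have k1 : ∫⁻ ξ, ENNReal.ofReal (‖ξ‖ * ‖(𝓕 φ : 𝓢(E3, ℂ)) ξ‖ ^ 2) ≤
      ENNReal.ofReal (1 * A ^ 2 + 1 * A ^ 2) :=
    lintegral_ofReal_le_add one_pos.le one_pos.le (sq_nonneg A) (sq_nonneg A)
      (by fun_prop : Continuous _).measurable (fun ξ => by
        have h1 : ‖ξ‖ ≤ 1 + ‖ξ‖ ^ 4 := by
          nlinarith [sq_nonneg (‖ξ‖ ^ 2 - 1 / 2), sq_nonneg (‖ξ‖ - 1 / 2)]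
        have := mul_le_mul_of_nonneg_right h1 (sq_nonneg ‖(𝓕 φ : 𝓢(E3, ℂ)) ξ‖)
        linarith) h.fst_zero h.fst_four
  have k2 : ∫⁻ ξ, ENNReal.ofReal (‖ξ‖⁻¹ * ‖(𝓕 ψ : 𝓢(E3, ℂ)) ξ‖ ^ 2) ≤
      ENNReal.ofReal (1 * A ^ 2 + 1 * A ^ 2) :=
    lintegral_ofReal_le_add one_pos.le one_pos.le (sq_nonneg A) (sq_nonneg A)
      (by fun_prop : Continuous _).measurable (fun ξ => by
        rcases eq_or_ne ‖ξ‖ 0 with h0 | h0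
        · rw [h0]; simp
        have h1 : ‖ξ‖⁻¹ ≤ ‖ξ‖ ^ 2 + ‖ξ‖⁻¹ ^ 2 := by
          rcases le_total 1 ‖ξ‖ with h | h
          · have := inv_le_one_of_one_le₀ h
            nlinarith [sq_nonneg ‖ξ‖⁻¹]
          · have := (one_le_inv₀ (by positivity)).2 h
            nlinarith [sq_nonneg ‖ξ‖]
        have := mul_le_mul_of_nonneg_right h1 (sq_nonneg ‖(𝓕 ψ : 𝓢(E3, ℂ)) ξ‖)
        rw [mul_pow]
        linarith) h.snd_two h.snd_neg_two
  refine (lintegral_ofReal_le_add (by norm_num) (by norm_num) (by positivity) (by positivity)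
    (by fun_prop : Continuous _).measurable (fun ξ => le_rfl) k1 k2).trans_eq ?_
  congr 1; ring

theorem ProfileBound.lintegral_sq_le_mul (h : ProfileBound φ ψ A E) (hA : 0 < A) (hE : 0 < E)
    {σ : ℝ} (hσ : |σ| = 1) :
    ∫⁻ ξ, ‖waveProfile σ φ ψ ξ‖ₑ ^ 2 * ENNReal.ofReal ‖ξ‖ ≤ ENNReal.ofReal (3 * A * √E) := by
  refine (lintegral_mono (enorm_waveProfile_sq_mul_le hσ φ ψ)).trans ?_
  set l : ℝ := √E / A with hl
  have hE' : 0 < √E := Real.sqrt_pos.2 hE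
  have hl0 : 0 < l := by positivity
  have hcr (a : ℝ) : a ≤ l + l⁻¹ * a ^ 2 := by
    have : 0 ≤ l⁻¹ * (a - l) ^ 2 + l⁻¹ * a ^ 2 := by positivity
    have e : l⁻¹ * (a - l) ^ 2 + l⁻¹ * a ^ 2 = 2 * (l + l⁻¹ * a ^ 2 - a) - l := by
      field_simp; ring
    linarith
  have k1 : ∫⁻ ξ, ENNReal.ofReal (‖ξ‖ * ‖(𝓕 φ : 𝓢(E3, ℂ)) ξ‖ ^ 2) ≤
      ENNReal.ofReal (l * A ^ 2 + l⁻¹ * (2 * E)) :=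
    lintegral_ofReal_le_add hl0.le (inv_pos.2 hl0).le (sq_nonneg A) (by positivity)
      (by fun_prop : Continuous _).measurable (fun ξ => by
        have := mul_le_mul_of_nonneg_right (hcr ‖ξ‖) (sq_nonneg ‖(𝓕 φ : 𝓢(E3, ℂ)) ξ‖)
        linarith) h.fst_zero h.fst_two
  have k2 : ∫⁻ ξ, ENNReal.ofReal (‖ξ‖⁻¹ * ‖(𝓕 ψ : 𝓢(E3, ℂ)) ξ‖ ^ 2) ≤
      ENNReal.ofReal (l⁻¹ * (2 * E) + l * A ^ 2) :=
    lintegral_ofReal_le_add (inv_pos.2 hl0).le hl0.le (by positivity) (sq_nonneg A)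
      (by fun_prop : Continuous _).measurable (fun ξ => by
        have h1 : ‖ξ‖⁻¹ ≤ l⁻¹ + l * ‖ξ‖⁻¹ ^ 2 := by
          rcases eq_or_ne ‖ξ‖ 0 with h0 | h0
          · rw [h0]; simp [hl0.le]
          have e : l⁻¹ + l * ‖ξ‖⁻¹ ^ 2 - ‖ξ‖⁻¹ =
              l⁻¹ * ‖ξ‖⁻¹ ^ 2 * (‖ξ‖ ^ 2 - l * ‖ξ‖ + l ^ 2) := by
            field_simp
            ring
          have : 0 ≤ ‖ξ‖ ^ 2 - l * ‖ξ‖ + l ^ 2 := by nlinarith [sq_nonneg (‖ξ‖ - l)]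
          have : 0 ≤ l⁻¹ * ‖ξ‖⁻¹ ^ 2 * (‖ξ‖ ^ 2 - l * ‖ξ‖ + l ^ 2) := by positivity
          linarith
        have := mul_le_mul_of_nonneg_right h1 (sq_nonneg ‖(𝓕 ψ : 𝓢(E3, ℂ)) ξ‖)
        rw [mul_pow]
        linarith) h.snd_zero h.snd_neg_two
  refine (lintegral_ofReal_le_add (by norm_num) (by norm_num) (by positivity) (by positivity)
    (by fun_prop : Continuous _).measurable (fun ξ => le_rfl) k1 k2).trans_eq ?_
  congr 1
  have e1 : l * A ^ 2 = A * √E := by rw [hl]; field_simp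
  have e2 : l⁻¹ * E = A * √E := by
    rw [hl, inv_div]
    nth_rewrite 2 [← Real.mul_self_sqrt hE.le]
    field_simp
  linear_combination e1 + 2 * e2

theorem exists_lintegral_waveProfile_le : ∃ K : ℝ, 0 < K ∧
    ∀ (φ ψ : 𝓢(E3, ℂ)) (A E σ : ℝ), 0 < A → ProfileBound φ ψ A E → |σ| = 1 →
      ∫⁻ ξ, ‖waveProfile σ φ ψ ξ‖ₑ ≤ ENNReal.ofReal (K * A) := by
  set w : E3 → ℝ := fun ξ => (1 + ‖ξ‖) ^ (-(4 : ℝ)) with hw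
  have hwi : Integrable w := integrable_one_add_norm (by simp; norm_num)
  have hw0 (ξ : E3) : 0 ≤ w ξ := by positivity
  set W : ℝ := ∫ ξ, w ξ with hW
  have hW0 : 0 ≤ W := integral_nonneg hw0
  have hWl : ∫⁻ ξ, ENNReal.ofReal (w ξ) ≤ ENNReal.ofReal W :=
    (ofReal_integral_eq_lintegral_ofReal hwi (.of_forall hw0)).ge
  have hwm : Measurable w := by
    simp only [hw]; fun_prop
  have hwp (ξ : E3) {A p : ℝ} (hA : 0 < A) :
      p ≤ A * w ξ + 8 * A⁻¹ * ((1 + ‖ξ‖ ^ 4) * p ^ 2) := by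
    have h1 : (w ξ) * (1 + ‖ξ‖) ^ 4 = 1 := by
      simp only [hw]
      rw [Real.rpow_neg (by positivity), ← Real.rpow_natCast]
      push_cast
      exact inv_mul_cancel₀ (by positivity)
    have h2 : (1 + ‖ξ‖) ^ 4 ≤ 8 * (1 + ‖ξ‖ ^ 4) := by
      nlinarith [sq_nonneg (‖ξ‖ - 1), sq_nonneg (‖ξ‖ ^ 2 - 1), sq_nonneg (‖ξ‖ ^ 2 - ‖ξ‖)]
    set y := (1 + ‖ξ‖) ^ 4 with hy
    have hy0 : 0 < y := by positivity
    have hwy : w ξ = y⁻¹ := eq_inv_of_mul_eq_one_left h1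
    have h3 : p ≤ A * y⁻¹ + A⁻¹ * y * p ^ 2 := by
      have : 0 ≤ A⁻¹ * y * ((p - A * y⁻¹) ^ 2 + p ^ 2 + (A * y⁻¹) ^ 2) := by positivity
      have e : A⁻¹ * y * ((p - A * y⁻¹) ^ 2 + p ^ 2 + (A * y⁻¹) ^ 2) =
          2 * (A * y⁻¹ + A⁻¹ * y * p ^ 2 - p) := by field_simp; ring
      linarith
    have h4 : A⁻¹ * y * p ^ 2 ≤ A⁻¹ * (8 * (1 + ‖ξ‖ ^ 4)) * p ^ 2 := by gcongr
    rw [hwy]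
    linarith
  refine ⟨W + 16, by linarith, fun φ ψ A E σ hA h hσ => ?_⟩
  have k1 : ∫⁻ ξ, ENNReal.ofReal ((1 + ‖ξ‖ ^ 4) * ‖(𝓕 φ : 𝓢(E3, ℂ)) ξ‖ ^ 2) ≤
      ENNReal.ofReal (1 * A ^ 2 + 1 * A ^ 2) :=
    lintegral_ofReal_le_add one_pos.le one_pos.le (sq_nonneg A) (sq_nonneg A)
      (by fun_prop : Continuous _).measurable (fun ξ => by linarith) h.fst_zero h.fst_four
  have k2 : ∫⁻ ξ, ENNReal.ofReal ((1 + ‖ξ‖ ^ 4) * (‖ξ‖⁻¹ * ‖(𝓕 ψ : 𝓢(E3, ℂ)) ξ‖) ^ 2) ≤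
      ENNReal.ofReal (1 * A ^ 2 + 1 * A ^ 2) :=
    lintegral_ofReal_le_add one_pos.le one_pos.le (sq_nonneg A) (sq_nonneg A)
      (by fun_prop : Measurable _) (fun ξ => by
        rcases eq_or_ne ‖ξ‖ 0 with h0 | h0
        · rw [h0]; simp
        refine le_of_eq ?_
        field_simp) h.snd_neg_two h.snd_two
  have k3 : ∫⁻ ξ, ENNReal.ofReal ‖(𝓕 φ : 𝓢(E3, ℂ)) ξ‖ ≤
      ENNReal.ofReal (A * W + 8 * A⁻¹ * (1 * A ^ 2 + 1 * A ^ 2)) :=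
    lintegral_ofReal_le_add hA.le (by positivity) hW0 (by positivity) hwm
      (fun ξ => hwp ξ hA) hWl k1
  have k4 : ∫⁻ ξ, ENNReal.ofReal (‖ξ‖⁻¹ * ‖(𝓕 ψ : 𝓢(E3, ℂ)) ξ‖) ≤
      ENNReal.ofReal (A * W + 8 * A⁻¹ * (1 * A ^ 2 + 1 * A ^ 2)) :=
    lintegral_ofReal_le_add hA.le (by positivity) hW0 (by positivity) hwm
      (fun ξ => hwp ξ hA) hWl k2
  have k5 := lintegral_ofReal_le_add (by norm_num) (by norm_num) (by positivity) (by positivity)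
    (by fun_prop : Continuous _).measurable (norm_waveProfile_le hσ φ ψ) k3 k4
  simp only [ofReal_norm] at k5
  refine k5.trans_eq ?_
  congr 1
  field_simp
  ring

theorem ProfileBound.integrable_waveProfile (h : ProfileBound φ ψ A E) (hA : 0 < A) {σ : ℝ}
    (hσ : |σ| = 1) : Integrable (waveProfile σ φ ψ) := by
  obtain ⟨K, -, hK⟩ := exists_lintegral_waveProfile_le
  refine ⟨Measurable.aestronglyMeasurable ?_, (hK φ ψ A E σ hA h hσ).trans_lt
    ENNReal.ofReal_lt_top⟩
  unfold waveProfile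
  have h1 := (𝓕 φ : 𝓢(E3, ℂ)).continuous.measurable
  have h2 := (𝓕 ψ : 𝓢(E3, ℂ)).continuous.measurable
  fun_prop

end ProfileBounds

section FinalEstimate

theorem ENNReal.add_pow_four_le (a b : ℝ≥0∞) : (a + b) ^ 4 ≤ 16 * (a ^ 4 + b ^ 4) := by
  rcases le_total a b with h | h
  · calc (a + b) ^ 4 ≤ (b + b) ^ 4 := by gcongr
      _ = 16 * b ^ 4 := by ring
      _ ≤ _ := by gcongr; exact le_add_self
  · calc (a + b) ^ 4 ≤ (a + a) ^ 4 := by gcongr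
      _ = 16 * a ^ 4 := by ring
      _ ≤ _ := by gcongr; exact le_self_add

theorem lintegral_halfWave_sub_pow_four {f : E3 → ℂ} (hf : Integrable f) (s : ℝ) :
    ∫⁻ t : ℝ, ∫⁻ x, ‖halfWave f (t - s) x‖ₑ ^ 4 = ∫⁻ w : ℝ × E3, ‖halfWave f w.1 w.2‖ₑ ^ 4 := by
  have hc := continuous_halfWave hf
  rw [lintegral_sub_right_eq_self (fun t => ∫⁻ x, ‖halfWave f t x‖ₑ ^ 4) s,
    Measure.volume_eq_prod, lintegral_prod]
  exact (hc.enorm.measurable.pow_const 4).aemeasurable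

theorem lintegral_halfWave_neg_sub_pow_four {f : E3 → ℂ} (hf : Integrable f) (s : ℝ) :
    ∫⁻ t : ℝ, ∫⁻ x, ‖halfWave f (-(t - s)) x‖ₑ ^ 4 =
      ∫⁻ w : ℝ × E3, ‖halfWave f w.1 w.2‖ₑ ^ 4 := by
  have hc := continuous_halfWave hf
  simp_rw [neg_sub]
  rw [lintegral_sub_left_eq_self (fun t => ∫⁻ x, ‖halfWave f t x‖ₑ ^ 4) s,
    Measure.volume_eq_prod, lintegral_prod]
  exact (hc.enorm.measurable.pow_const 4).aemeasurable

variable {u : ℝ → E3 → ℝ}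

/-- The frequency profile of the half wave of sign `σ` with the Cauchy data of `u` at time `τ`. -/
def IsNLW.profile (hu : IsNLW u) (σ τ : ℝ) : E3 → ℂ :=
  waveProfile σ (hu.isSchwartz τ).toSchwartzMap (hu.isSchwartz_tderiv τ).toSchwartzMap

theorem IsNLW.enorm_coneFlux_le (hu : IsNLW u) (hi : ∀ σ τ, |σ| = 1 → Integrable (hu.profile σ τ))
    (t τ : ℝ) (x : E3) : ‖coneFlux (uncurry u) t x τ‖ₑ ≤ ENNReal.ofReal (sphM.real univ) *
      (‖halfWave (hu.profile 1 τ) (t - τ) x‖ₑ + ‖halfWave (hu.profile (-1) τ) (-(t - τ)) x‖ₑ) := by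
  have h1 : ‖coneFlux (uncurry u) t x τ‖ₑ = ‖(coneFlux (uncurry u) t x τ : ℂ)‖ₑ := by
    rw [← ofReal_norm, ← ofReal_norm, Complex.norm_real]
  rw [h1, hu.coneFlux_eq, cosMean_add_mul_sphMean (hi 1 τ (by simp)) (hi (-1) τ (by simp)),
    enorm_mul]
  gcongr
  · rw [← ofReal_norm, Complex.norm_real, Real.norm_of_nonneg (by positivity)]
  · exact enorm_add_le _ _

theorem IsNLW.enorm_duh_le (hu : IsNLW u) (hi : ∀ σ τ, |σ| = 1 → Integrable (hu.profile σ τ))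
    {κ : ℝ} (hκ0 : 0 ≤ κ)
    (hκ : ∀ x r f, 0 < r → sphInt x r f = κ * r ^ 2 * ∫ ω, f (x + r • ω) ∂sphM)
    {s t : ℝ} (hs : 0 ≤ s) (hst : s < t) (x : E3) :
    ‖duh u 0 s t x‖ₑ ≤ ENNReal.ofReal (κ / (4 * π) * sphM.real univ) *
      ((‖halfWave (hu.profile 1 0) (t - 0) x‖ₑ + ‖halfWave (hu.profile (-1) 0) (-(t - 0)) x‖ₑ) +
      (‖halfWave (hu.profile 1 s) (t - s) x‖ₑ + ‖halfWave (hu.profile (-1) s) (-(t - s)) x‖ₑ)) := by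
  have hk : 0 ≤ κ / (4 * π) := by positivity
  rw [hu.duh_eq_coneFlux hκ hs hst, enorm_mul, ENNReal.ofReal_mul hk, mul_assoc]
  gcongr
  · rw [← ofReal_norm, Real.norm_of_nonneg hk]
  · rw [mul_add]
    refine (enorm_sub_le).trans (add_le_add ?_ ?_)
    · exact hu.enorm_coneFlux_le hi t 0 x
    · exact hu.enorm_coneFlux_le hi t s x

theorem exists_abs_duh_le_mul : ∃ K : ℝ, 0 < K ∧ ∀ u : ℝ → E3 → ℝ, IsNLW u → ∀ A E : ℝ, 0 < A →
    APriori u A → (∀ t, energy u t ≤ E) → ∀ s t : ℝ, 0 ≤ s → s < t → ∀ x : E3,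
      |duh u 0 s t x| ≤ K * A := by
  obtain ⟨κ, hκ0, hκ⟩ := exists_sphInt_eq
  obtain ⟨L, hL0, hL⟩ := exists_lintegral_waveProfile_le
  refine ⟨κ / (4 * π) * sphM.real univ * (4 * L) + 1, by positivity,
    fun u hu A E hA hap hE s t hs hst x => ?_⟩
  have hi (σ τ : ℝ) (hσ : |σ| = 1) : Integrable (hu.profile σ τ) :=
    (hu.profileBound hA hap hE τ).integrable_waveProfile hA hσ
  have hb (σ τ r : ℝ) (hσ : |σ| = 1) : ‖halfWave (hu.profile σ τ) r x‖ₑ ≤ ENNReal.ofReal (L * A) :=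
    (enorm_halfWave_le _ r x).trans (hL _ _ A E σ hA (hu.profileBound hA hap hE τ) hσ)
  have h1 : |(1 : ℝ)| = 1 := by simp
  have h2 : |(-1 : ℝ)| = 1 := by simp
  have key := (hu.enorm_duh_le hi hκ0 hκ hs hst x).trans (mul_le_mul_right (add_le_add
    (add_le_add (hb 1 0 _ h1) (hb (-1) 0 _ h2)) (add_le_add (hb 1 s _ h1) (hb (-1) s _ h2))) _)
  have hLA : 0 ≤ L * A := by positivity
  rw [← ENNReal.ofReal_add hLA hLA, ← ENNReal.ofReal_add (by positivity) (by positivity),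
    ← ENNReal.ofReal_mul (by positivity), ← ofReal_norm,
    ENNReal.ofReal_le_ofReal_iff (by positivity), Real.norm_eq_abs] at key
  refine key.trans ?_
  nlinarith

theorem exists_lintegral_duh_pow_eight_le : ∃ K : ℝ, 0 < K ∧ ∀ u : ℝ → E3 → ℝ, ∀ hu : IsNLW u,
    (∀ σ τ, |σ| = 1 → Integrable (hu.profile σ τ)) → ∀ B M : ℝ, 0 ≤ B → 0 ≤ M →
    (∀ σ τ, |σ| = 1 →
      ∫⁻ ξ, ‖hu.profile σ τ ξ‖ₑ ^ 2 * ENNReal.ofReal ‖ξ‖ ≤ ENNReal.ofReal M) →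
    ∀ s a b : ℝ, 0 ≤ s → s < a → (∀ t ∈ Icc a b, ∀ x, |duh u 0 s t x| ≤ B) →
      ∫⁻ t in Icc a b, ∫⁻ x, ‖duh u 0 s t x‖ₑ ^ 8 ≤ ENNReal.ofReal (K * B ^ 4 * M ^ 2) := by
  obtain ⟨κ, hκ0, hκ⟩ := exists_sphInt_eq
  set k : ℝ := κ / (4 * π) * sphM.real univ with hk
  have hk0 : 0 ≤ k := by positivity
  set m : ℝ := sphM.real univ with hm
  have hm0 : 0 ≤ m := measureReal_nonneg
  refine ⟨1024 * k ^ 4 * m + 1, by positivity, fun u hu hi B M hB hM hprof s a b hs hsa hbd => ?_⟩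
  have h1 : |(1 : ℝ)| = 1 := by simp
  have h2 : |(-1 : ℝ)| = 1 := by simp
  set g : Fin 4 → ℝ → E3 → ℝ≥0∞ := ![
    fun t x => ‖halfWave (hu.profile 1 0) (t - 0) x‖ₑ,
    fun t x => ‖halfWave (hu.profile (-1) 0) (-(t - 0)) x‖ₑ,
    fun t x => ‖halfWave (hu.profile 1 s) (t - s) x‖ₑ,
    fun t x => ‖halfWave (hu.profile (-1) s) (-(t - s)) x‖ₑ] with hg
  have hprofM (σ τ : ℝ) (hσ : |σ| = 1) :
      ∫⁻ w : ℝ × E3, ‖halfWave (hu.profile σ τ) w.1 w.2‖ₑ ^ 4 ≤ ENNReal.ofReal (m * M ^ 2) := by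
    refine (lintegral_halfWave_pow_four_le (hi σ τ hσ)).trans ?_
    calc _ ≤ 2 * ENNReal.ofReal (m / 2) * (ENNReal.ofReal M) ^ 2 := by
          gcongr; exact hprof σ τ hσ
      _ = _ := by
          rw [← ENNReal.ofReal_ofNat, ← ENNReal.ofReal_mul two_pos.le,
            ← ENNReal.ofReal_pow hM, ← ENNReal.ofReal_mul (by positivity)]
          congr 1; ring
  have hgM (i : Fin 4) : ∫⁻ t, ∫⁻ x, g i t x ^ 4 ≤ ENNReal.ofReal (m * M ^ 2) := by
    fin_cases i
    · exact (lintegral_halfWave_sub_pow_four (hi 1 0 h1) 0).trans_le (hprofM 1 0 h1)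
    · exact (lintegral_halfWave_neg_sub_pow_four (hi (-1) 0 h2) 0).trans_le (hprofM (-1) 0 h2)
    · exact (lintegral_halfWave_sub_pow_four (hi 1 s h1) s).trans_le (hprofM 1 s h1)
    · exact (lintegral_halfWave_neg_sub_pow_four (hi (-1) s h2) s).trans_le (hprofM (-1) s h2)
  have hgc (i : Fin 4) : Measurable (uncurry (g i)) := by
    have hc (σ τ : ℝ) (hσ : |σ| = 1) := continuous_halfWave (hi σ τ hσ)
    refine Continuous.measurable ?_
    fin_cases i
    · exact ((hc 1 0 h1).comp
        (by fun_prop : Continuous fun p : ℝ × E3 => (p.1 - 0, p.2))).enorm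
    · exact ((hc (-1) 0 h2).comp
        (by fun_prop : Continuous fun p : ℝ × E3 => (-(p.1 - 0), p.2))).enorm
    · exact ((hc 1 s h1).comp
        (by fun_prop : Continuous fun p : ℝ × E3 => (p.1 - s, p.2))).enorm
    · exact ((hc (-1) s h2).comp
        (by fun_prop : Continuous fun p : ℝ × E3 => (-(p.1 - s), p.2))).enorm
  have hpt (t : ℝ) (ht : t ∈ Icc a b) (x : E3) : ‖duh u 0 s t x‖ₑ ^ 8 ≤
      ENNReal.ofReal (B ^ 4 * k ^ 4 * 256) * ∑ i, g i t x ^ 4 := by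
    have e1 : ‖duh u 0 s t x‖ₑ ≤ ENNReal.ofReal B := by
      rw [← ofReal_norm]
      exact ENNReal.ofReal_le_ofReal (hbd t ht x)
    have e2 := hu.enorm_duh_le hi hκ0 hκ hs (hsa.trans_le ht.1) x
    change _ ≤ ENNReal.ofReal k * ((g 0 t x + g 1 t x) + (g 2 t x + g 3 t x)) at e2
    have e3 : ENNReal.ofReal (B ^ 4 * k ^ 4 * 256) =
        ENNReal.ofReal B ^ 4 * ENNReal.ofReal k ^ 4 * 256 := by
      rw [ENNReal.ofReal_mul (p := B ^ 4 * k ^ 4) (by positivity),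
        ENNReal.ofReal_mul (p := B ^ 4) (by positivity),
        ENNReal.ofReal_pow hB, ENNReal.ofReal_pow hk0, ENNReal.ofReal_ofNat]
    calc _ = ‖duh u 0 s t x‖ₑ ^ 4 * ‖duh u 0 s t x‖ₑ ^ 4 := by ring
      _ ≤ ENNReal.ofReal B ^ 4 *
          (ENNReal.ofReal k * ((g 0 t x + g 1 t x) + (g 2 t x + g 3 t x))) ^ 4 := by gcongr
      _ ≤ ENNReal.ofReal B ^ 4 * (ENNReal.ofReal k ^ 4 * (16 * (16 * (g 0 t x ^ 4 + g 1 t x ^ 4) +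
          16 * (g 2 t x ^ 4 + g 3 t x ^ 4)))) := by
          rw [mul_pow]
          gcongr
          refine (ENNReal.add_pow_four_le _ _).trans ?_
          gcongr <;> exact ENNReal.add_pow_four_le _ _
      _ = _ := by
          rw [e3, Fin.sum_univ_four]
          ring
  calc ∫⁻ t in Icc a b, ∫⁻ x, ‖duh u 0 s t x‖ₑ ^ 8 ≤
      ∫⁻ t in Icc a b, ∫⁻ x, ENNReal.ofReal (B ^ 4 * k ^ 4 * 256) * ∑ i, g i t x ^ 4 :=
        setLIntegral_mono' measurableSet_Icc fun t ht => lintegral_mono fun x => hpt t ht x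
    _ ≤ ∫⁻ t, ∫⁻ x, ENNReal.ofReal (B ^ 4 * k ^ 4 * 256) * ∑ i, g i t x ^ 4 :=
        setLIntegral_le_lintegral _ _
    _ = ENNReal.ofReal (B ^ 4 * k ^ 4 * 256) * ∑ i, ∫⁻ t, ∫⁻ x, g i t x ^ 4 := by
        have hx (i : Fin 4) (t : ℝ) : Measurable fun x => g i t x ^ 4 :=
          ((hgc i).comp measurable_prodMk_left).pow_const 4
        have ht (i : Fin 4) : Measurable fun t => ∫⁻ x, g i t x ^ 4 :=
          Measurable.lintegral_prod_right' (f := fun p : ℝ × E3 => g i p.1 p.2 ^ 4)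
            ((hgc i).pow_const 4)
        simp_rw [lintegral_const_mul' _ _ ENNReal.ofReal_ne_top]
        congr 1
        rw [← lintegral_finsetSum _ fun i _ => ht i]
        refine lintegral_congr fun t => ?_
        rw [lintegral_finsetSum _ fun i _ => hx i t]
    _ ≤ ENNReal.ofReal (B ^ 4 * k ^ 4 * 256) * ∑ i : Fin 4, ENNReal.ofReal (m * M ^ 2) := by
        gcongr with i; exact hgM i
    _ = ENNReal.ofReal (1024 * k ^ 4 * m * B ^ 4 * M ^ 2) := by
        rw [Finset.sum_const, Finset.card_univ, Fintype.card_fin, nsmul_eq_mul,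
          ← ENNReal.ofReal_natCast, ← ENNReal.ofReal_mul (by positivity),
          ← ENNReal.ofReal_mul (by positivity)]
        congr 1; push_cast; ring
    _ ≤ _ := by
        refine ENNReal.ofReal_le_ofReal ?_
        gcongr
        linarith

theorem mixNorm_eight_le {v : ℝ → E3 → ℝ} {I : Set ℝ} {X : ℝ} (hX : 0 ≤ X)
    (h : ∫⁻ t in I, ∫⁻ x, ‖v t x‖ₑ ^ 8 ≤ ENNReal.ofReal (X ^ 8)) :
    mixNorm 8 8 I v ≤ ENNReal.ofReal X := by
  have e (t : ℝ) : xNorm 8 (v t) ^ (8 : ℝ) = ∫⁻ x, ‖v t x‖ₑ ^ 8 := by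
    rw [xNorm, ← ENNReal.rpow_mul, one_div, inv_mul_cancel₀ (by norm_num), ENNReal.rpow_one]
    refine lintegral_congr fun x => ?_
    norm_cast
  rw [mixNorm, one_div, ENNReal.rpow_inv_le_iff (by norm_num)]
  simp_rw [e]
  refine h.trans_eq ?_
  rw [ENNReal.ofReal_pow hX]
  norm_cast

end FinalEstimate

/-- `‖∫_0^{t_j-T} S(t-τ)(0,u⁵) dτ‖_{L⁸_{t,x}([t_j,b_j]×ℝ³)} ≤ ε/4`
with `ε = c E^{-1/14}` and `T = C A² E^{13/6} ε^{-4}`. -/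
theorem stmt10 :
    ∃ c C : ℝ, 0 < c ∧ 0 < C ∧ ∀ (E A : ℝ), 0 < E → 0 < A →
      ∀ ε T : ℝ, ε = c * E ^ (-(1:ℝ)/14) → T = C * A ^ 2 * E ^ ((13:ℝ)/6) * ε ^ (-(4:ℝ)) →
      ∀ u : ℝ → E3 → ℝ, IsNLW u → (∀ t : ℝ, energy u t ≤ E) → APriori u A →
      ∀ tj bj : ℝ, T ≤ tj → tj ≤ bj →
        mixNorm 8 8 (Icc tj bj) (fun t x => duh u 0 (tj - T) t x) ≤ ENNReal.ofReal (ε/4) := by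
  obtain ⟨K, hK0, hK⟩ := exists_abs_duh_le
  obtain ⟨L, hL0, hL⟩ := exists_abs_duh_le_mul
  obtain ⟨N, hN0, hN⟩ := exists_lintegral_duh_pow_eight_le
  refine ⟨4 ^ 9 * N * L ^ 4 + 1, 4 ^ 10 * N * K ^ 4 + 1, by positivity, by positivity,
    fun E A hE hA ε T hε hT u hu hen hap tj bj hTt htb => ?_⟩
  set c := 4 ^ 9 * N * L ^ 4 + 1 with hc
  set C := 4 ^ 10 * N * K ^ 4 + 1 with hC
  have hc1 : 1 ≤ c := by rw [hc]; linarith [show 0 ≤ 4 ^ 9 * N * L ^ 4 by positivity]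
  have hC1 : 1 ≤ C := by rw [hC]; linarith [show 0 ≤ 4 ^ 10 * N * K ^ 4 by positivity]
  have hε0 : 0 < ε := by rw [hε]; positivity
  have hT0 : 0 < T := by rw [hT]; positivity
  have hi (σ τ : ℝ) (hσ : |σ| = 1) : Integrable (hu.profile σ τ) :=
    (hu.profileBound hA hap hen τ).integrable_waveProfile hA hσ
  have hM₁ (σ τ : ℝ) (hσ : |σ| = 1) :=
    (hu.profileBound hA hap hen τ).lintegral_sq_le_sq hσ
  have hM₂ (σ τ : ℝ) (hσ : |σ| = 1) :=
    (hu.profileBound hA hap hen τ).lintegral_sq_le_mul hA hE hσ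
  have hs : 0 ≤ tj - T := by linarith
  have hsa : tj - T < tj := by linarith
  set B := K * (E ^ ((5 : ℝ) / 6) * T ^ (-(1 : ℝ) / 2)) with hB
  have hB0 : 0 ≤ B := by positivity
  have hB4 : B ^ 4 = K ^ 4 * ε ^ 8 / (C ^ 2 * A ^ 4 * E) := by
    have e1 : (E ^ ((5 : ℝ) / 6)) ^ 4 * E = (E ^ ((13 : ℝ) / 6)) ^ 2 := by
      rw [← Real.rpow_mul_natCast hE.le, ← Real.rpow_mul_natCast hE.le,
        ← Real.rpow_add_one hE.ne']
      norm_num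
    have e2 : (T ^ (-(1 : ℝ) / 2)) ^ 4 * T ^ 2 = 1 := by
      rw [← Real.rpow_mul_natCast hT0.le, ← Real.rpow_add_natCast hT0.ne']
      norm_num
    have e3 : T * ε ^ 4 = C * A ^ 2 * E ^ ((13 : ℝ) / 6) := by
      rw [hT, mul_assoc, ← Real.rpow_add_natCast hε0.ne']
      norm_num
    have e4 : T ^ 2 * ε ^ 8 = C ^ 2 * A ^ 4 * (E ^ ((13 : ℝ) / 6)) ^ 2 := by
      calc T ^ 2 * ε ^ 8 = (T * ε ^ 4) ^ 2 := by ring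
        _ = _ := by rw [e3]; ring
    rw [eq_div_iff (by positivity), hB]
    calc _ = K ^ 4 * ((T ^ (-(1 : ℝ) / 2)) ^ 4 *
          (C ^ 2 * A ^ 4 * ((E ^ ((5 : ℝ) / 6)) ^ 4 * E))) := by ring
      _ = K ^ 4 * ε ^ 8 * ((T ^ (-(1 : ℝ) / 2)) ^ 4 * T ^ 2) := by rw [e1, ← e4]; ring
      _ = _ := by rw [e2, mul_one]
  have hflux (t : ℝ) (ht : t ∈ Icc tj bj) (x : E3) : |duh u 0 (tj - T) t x| ≤ B :=
    hK u hu E hE (hen 0) (tj - T) t T hs hT0 (by linarith [ht.1]) x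
  have hsup (t : ℝ) (ht : t ∈ Icc tj bj) (x : E3) : |duh u 0 (tj - T) t x| ≤ L * A :=
    hL u hu A E hA hap hen (tj - T) t hs (by linarith [ht.1]) x
  have hC2 : 4 ^ 10 * N * K ^ 4 ≤ C ^ 2 := by nlinarith
  refine mixNorm_eight_le (by positivity) ?_
  rcases le_or_gt 1 E with hE1 | hE1
  · refine (hN u hu hi B (2 * A ^ 2) hB0 (by positivity) hM₁ _ tj bj hs hsa hflux).trans
      (ENNReal.ofReal_le_ofReal ?_)
    rw [hB4]
    have e : N * (K ^ 4 * ε ^ 8 / (C ^ 2 * A ^ 4 * E)) * (2 * A ^ 2) ^ 2 =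
        ε ^ 8 * (4 * N * K ^ 4 / (C ^ 2 * E)) := by field_simp; ring
    have e' : 4 * N * K ^ 4 / (C ^ 2 * E) ≤ 1 / 4 ^ 8 := by
      rw [div_le_div_iff₀ (by positivity) (by positivity)]
      have : C ^ 2 ≤ C ^ 2 * E := le_mul_of_one_le_right (by positivity) hE1
      have : 0 ≤ N * K ^ 4 := by positivity
      linarith
    calc _ = _ := e
      _ ≤ ε ^ 8 * (1 / 4 ^ 8) := by gcongr
      _ = _ := by ring
  rcases le_or_gt 1 A with hA1 | hA1
  · refine (hN u hu hi B (3 * A * √E) hB0 (by positivity) hM₂ _ tj bj hs hsa hflux).trans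
      (ENNReal.ofReal_le_ofReal ?_)
    rw [hB4, mul_pow, Real.sq_sqrt hE.le]
    have e : N * (K ^ 4 * ε ^ 8 / (C ^ 2 * A ^ 4 * E)) * ((3 * A) ^ 2 * E) =
        ε ^ 8 * (9 * N * K ^ 4 / (C ^ 2 * A ^ 2)) := by field_simp; ring
    have e' : 9 * N * K ^ 4 / (C ^ 2 * A ^ 2) ≤ 1 / 4 ^ 8 := by
      rw [div_le_div_iff₀ (by positivity) (by positivity)]
      have : C ^ 2 ≤ C ^ 2 * A ^ 2 :=
        le_mul_of_one_le_right (by positivity) (one_le_pow₀ hA1)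
      have : 0 ≤ N * K ^ 4 := by positivity
      linarith
    calc _ = _ := e
      _ ≤ ε ^ 8 * (1 / 4 ^ 8) := by gcongr
      _ = _ := by ring
  · refine (hN u hu hi (L * A) (2 * A ^ 2) (by positivity) (by positivity) hM₁ _ tj bj hs hsa
      hsup).trans (ENNReal.ofReal_le_ofReal ?_)
    have hcε : c ≤ ε := by
      rw [hε]
      exact le_mul_of_one_le_right (by positivity)
        (Real.one_le_rpow_of_pos_of_le_one_of_nonpos hE hE1.le (by norm_num))
    calc N * (L * A) ^ 4 * (2 * A ^ 2) ^ 2 = 4 * N * L ^ 4 * A ^ 8 := by ring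
      _ ≤ 4 * N * L ^ 4 * 1 := by gcongr; exact pow_le_one₀ hA.le hA1.le
      _ ≤ c / 4 ^ 8 := by rw [le_div_iff₀ (by positivity), hc]; linarith
      _ ≤ c ^ 8 / 4 ^ 8 := by gcongr; exact le_self_pow₀ hc1 (by norm_num)
      _ ≤ ε ^ 8 / 4 ^ 8 := by gcongr
      _ = (ε / 4) ^ 8 := by ring

end
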